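/- arXiv:2410.08795 — 6 statements merged into one kernel-verified Lean document; each statement's English description precedes it below -/
import Mathlib

section
/- Let A be a commutative Artinian local ring with maximal ideal m and residue field 𝔽 = A/m. Let M be a finite free A-module, T : M → M an A-linear endomorphism, and let T̄ denote the induced 𝔽-linear endomorphism of M̄ = M/mM. Suppose λ̄₁, …, λ̄_k ∈ 𝔽 are distinct elements which are exactly the eigenvalues of T̄ (so that M̄ is the internal direct sum of the generalized eigenspaces of T̄ for λ̄₁, …, λ̄_k), and fix lifts λ₁, …, λ_k ∈ A of λ̄₁, …, λ̄_k. Then there is a unique decomposition M = M₁ ⊕ M₂ ⊕ ⋯ ⊕ M_k into A-submodules such that for each i, T(M_i) ⊆ M_i and T − λ_i acts nilpotently on M_i. Moreover each M_i is a finite free A-module, and M_i/mM_i equals the generalized eigenspace of T̄ in M̄ for the eigenvalue λ̄_i. -/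
/-- The endomorphism of `M ⧸ I•M` induced by an endomorphism `T` of `M`. -/
noncomputable def quotIdealSMulEnd {A : Type*} [CommRing A] {M : Type*} [AddCommGroup M]
    [Module A M] (I : Ideal A) (T : M →ₗ[A] M) :
    (M ⧸ (I • ⊤ : Submodule A M)) →ₗ[A] (M ⧸ (I • ⊤ : Submodule A M)) :=
  Submodule.mapQ _ _ T (Submodule.smul_le.mpr fun r hr x _ => by
    simpa [Submodule.mem_comap, map_smul] using
      Submodule.smul_mem_smul hr (Submodule.mem_top (x := T x)))

open Polynomial in
theorem aux_iSup_ker {A : Type*} [CommRing A] {M : Type*} [AddCommGroup M] [Module A M]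
    (T : M →ₗ[A] M) {ι : Type*} (q : ι → A[X])
    (hq : Pairwise fun i j => IsCoprime (q i) (q j)) (s : Finset ι) :
    ⨆ i ∈ s, LinearMap.ker (aeval T (q i)) = LinearMap.ker (aeval T (∏ i ∈ s, q i)) := by
  classical
  induction s using Finset.induction_on with
  | empty => simp [Module.End.one_eq_id]
  | insert a s ha ih =>
    rw [Finset.iSup_insert, ih, Finset.prod_insert ha,
      sup_ker_aeval_eq_ker_aeval_mul_of_coprime]
    exact IsCoprime.prod_right fun i hi => hq (by rintro rfl; exact ha hi)

open Polynomial in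
theorem aux_indep {A : Type*} [CommRing A] {M : Type*} [AddCommGroup M] [Module A M]
    (T : M →ₗ[A] M) {ι : Type*} [Fintype ι] (q : ι → A[X])
    (hq : Pairwise fun i j => IsCoprime (q i) (q j)) :
    iSupIndep fun i => LinearMap.ker (aeval T (q i)) := by
  classical
  intro i
  have h : ⨆ j, ⨆ (_ : j ≠ i), LinearMap.ker (aeval T (q j)) =
      ⨆ j ∈ Finset.univ.erase i, LinearMap.ker (aeval T (q j)) := by simp
  rw [h, aux_iSup_ker T q hq]
  refine disjoint_ker_aeval_of_isCoprime T (IsCoprime.prod_right fun j hj => hq ?_)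
  exact (Finset.ne_of_mem_erase hj).symm

open Polynomial in
theorem aux_max_eq {A : Type*} [CommRing A] {M : Type*} [AddCommGroup M] [Module A M]
    [IsNoetherian A M] (T : Module.End A M) (a : A) :
    ∃ n : ℕ, T.maxGenEigenspace a = LinearMap.ker (aeval T ((X - C a) ^ n)) := by
  refine ⟨T.maxGenEigenspaceIndex a, ?_⟩
  rw [Module.End.maxGenEigenspace_eq, Module.End.genEigenspace_nat]
  simp [Algebra.algebraMap_eq_smul_one]

open Polynomial in
theorem aux_quot_aeval {A : Type*} [CommRing A] {M : Type*} [AddCommGroup M] [Module A M]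
    (I : Ideal A) (T : M →ₗ[A] M) (p : A[X]) (x : M) :
    aeval (quotIdealSMulEnd I T : Module.End A _) p ((I • ⊤ : Submodule A M).mkQ x) =
      (I • ⊤ : Submodule A M).mkQ (aeval (T : Module.End A M) p x) := by
  induction p using Polynomial.induction_on generalizing x with
  | C a => simp [Module.algebraMap_end_apply]
  | add p q hp hq => simp only [map_add, LinearMap.add_apply, hp, hq]
  | monomial n a ih =>
    rw [pow_succ, ← mul_assoc, map_mul _ (C a * X ^ n) X, map_mul _ (C a * X ^ n) X, Module.End.mul_apply,
      Module.End.mul_apply, ← ih]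
    simp only [aeval_X]
    rfl

theorem aux_pow_mem {A : Type*} [CommRing A] {M : Type*} [AddCommGroup M] [Module A M]
    (I : Ideal A) (S : Module.End A M) (h : ∀ x, S x ∈ (I • ⊤ : Submodule A M)) (r : ℕ) (x : M) :
    (S ^ r) x ∈ (I ^ r • ⊤ : Submodule A M) := by
  induction r with
  | zero => simp
  | succ r ih =>
    rw [pow_succ' S, Module.End.mul_apply]
    have h1 : Submodule.map S (I ^ r • ⊤) ≤ I ^ (r + 1) • ⊤ := by
      rw [Submodule.map_smul'', pow_succ, Submodule.mul_smul]
      refine Submodule.smul_mono le_rfl ?_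
      rintro _ ⟨y, -, rfl⟩
      exact h y
    exact h1 ⟨_, ih, rfl⟩

/-- Over an Artinian local ring `A` with maximal ideal `m`, a finite free module `M` with an
endomorphism `T` decomposes uniquely into `T`-stable submodules on which `T - λᵢ` is nilpotent,
where the `λ̄ᵢ` are the (distinct) eigenvalues of the induced endomorphism `T̄` of `M̄ = M/mM`,
assumed to decompose `M̄` into generalized eigenspaces.  Moreover each piece is finite free, and
its image in `M̄` is the corresponding generalized eigenspace. -/
theorem exists_unique_nilpotent_decomposition
    (A : Type*) [CommRing A] [IsArtinianRing A] [IsLocalRing A]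
    (M : Type*) [AddCommGroup M] [Module A M] [Module.Free A M] [Module.Finite A M]
    (T : M →ₗ[A] M) (k : ℕ) (lam : Fin k → A)
    (hdist : ∀ i j : Fin k, i ≠ j → lam i - lam j ∉ IsLocalRing.maximalIdeal A)
    -- the `λ̄ᵢ` are eigenvalues of `T̄` …
    (hne : ∀ i : Fin k,
      Module.End.maxGenEigenspace
        (quotIdealSMulEnd (IsLocalRing.maximalIdeal A) T) (lam i) ≠ ⊥)
    -- … and `M̄` is the internal direct sum of the corresponding generalized eigenspaces
    (hinternal : DirectSum.IsInternal fun i : Fin k =>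
      Module.End.maxGenEigenspace
        (quotIdealSMulEnd (IsLocalRing.maximalIdeal A) T) (lam i)) :
    ∃ N : Fin k → Submodule A M,
      -- `M = N₁ ⊕ ⋯ ⊕ N_k`, each `Nᵢ` is `T`-stable and `T - λᵢ` is nilpotent on `Nᵢ`
      (DirectSum.IsInternal N ∧
        (∀ i, ∀ x ∈ N i, T x ∈ N i) ∧
        (∀ i, ∃ m : ℕ, ∀ x ∈ N i, ((T - lam i • (1 : Module.End A M)) ^ m) x = 0)) ∧
      -- uniqueness of such a decomposition
      (∀ N' : Fin k → Submodule A M,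
        (DirectSum.IsInternal N' ∧
          (∀ i, ∀ x ∈ N' i, T x ∈ N' i) ∧
          (∀ i, ∃ m : ℕ, ∀ x ∈ N' i, ((T - lam i • (1 : Module.End A M)) ^ m) x = 0)) →
        N' = N) ∧
      -- each `Nᵢ` is a finite free `A`-module
      (∀ i, Module.Free A (N i)) ∧ (∀ i, Module.Finite A (N i)) ∧
      -- the image of `Nᵢ` in `M̄ = M/mM` is the generalized eigenspace for `λ̄ᵢ`
      (∀ i, Submodule.map ((IsLocalRing.maximalIdeal A • ⊤ : Submodule A M).mkQ) (N i) =
        Module.End.maxGenEigenspace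
          (quotIdealSMulEnd (IsLocalRing.maximalIdeal A) T) (lam i)) := by
  classical
  set Tb := quotIdealSMulEnd (IsLocalRing.maximalIdeal A) T with hTb
  have hcop : ∀ e : Fin k → ℕ, Pairwise fun i j =>
      IsCoprime ((Polynomial.X - Polynomial.C (lam i)) ^ e i)
        ((Polynomial.X - Polynomial.C (lam j)) ^ e j) := by
    intro e i j hij
    refine IsCoprime.pow (Polynomial.isCoprime_X_sub_C_of_isUnit_sub ?_)
    have := hdist i j hij
    simpa using this
  let N : Fin k → Submodule A M := fun i => Module.End.maxGenEigenspace T (lam i)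
  choose e he using fun i => aux_max_eq T (lam i)
  choose f hf using fun i => aux_max_eq Tb (lam i)
  have hindep : iSupIndep N := by
    have := aux_indep T _ (hcop e)
    simpa only [N, he] using this
  -- nilpotence of the product
  have hPb : Polynomial.aeval (Tb : Module.End A _)
      (∏ i, (Polynomial.X - Polynomial.C (lam i)) ^ f i) = 0 := by
    rw [← LinearMap.ker_eq_top, ← aux_iSup_ker Tb _ (hcop f)]
    have := hinternal.submodule_iSup_eq_top
    simpa [hf] using this
  obtain ⟨r, hr⟩ : IsNilpotent (IsLocalRing.maximalIdeal A) :=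
    (isArtinianRing_iff_isNilpotent_maximalIdeal A).mp ‹_›
  have hP : Polynomial.aeval (T : Module.End A M)
      (∏ i, (Polynomial.X - Polynomial.C (lam i)) ^ (f i * r)) = 0 := by
    simp_rw [pow_mul]
    rw [Finset.prod_pow, map_pow]
    ext x
    have := aux_pow_mem (IsLocalRing.maximalIdeal A) (Polynomial.aeval (T : Module.End A M)
      (∏ i, (Polynomial.X - Polynomial.C (lam i)) ^ f i)) (fun x => by
        rw [← Submodule.Quotient.mk_eq_zero, ← Submodule.mkQ_apply, ← aux_quot_aeval, ← hTb, hPb]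
        rfl) r x
    rw [hr] at this
    simpa using this
  have htop : iSup N = ⊤ := by
    rw [eq_top_iff, ← LinearMap.ker_eq_top.mpr hP,
      ← aux_iSup_ker T _ (hcop fun i => f i * r)]
    refine iSup₂_le fun i _ => le_trans ?_ (le_iSup N i)
    intro x hx
    refine (Module.End.mem_maxGenEigenspace T _ x).mpr ⟨f i * r, ?_⟩
    simpa [Algebra.algebraMap_eq_smul_one] using hx
  have hint : DirectSum.IsInternal N :=
    (DirectSum.isInternal_submodule_iff_iSupIndep_and_iSup_eq_top N).mpr ⟨hindep, htop⟩
  refine ⟨N, ⟨hint, ?_, ?_⟩, ?_, ?_, ?_, ?_⟩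
  · intro i x hx
    exact Module.End.mapsTo_maxGenEigenspace_of_comm (Commute.refl T) (lam i) hx
  · intro i
    refine ⟨e i, fun x hx => ?_⟩
    have hx' : x ∈ Module.End.maxGenEigenspace T (lam i) := hx
    rw [he i] at hx'
    simpa [Algebra.algebraMap_eq_smul_one] using hx'
  · rintro N' ⟨h1, -, h3⟩
    refine (hindep.le_iff_eq_of_iSup_eq_top h1.submodule_iSup_eq_top).mp fun i x hx => ?_
    obtain ⟨m, hm⟩ := h3 i
    exact (Module.End.mem_maxGenEigenspace T _ x).mpr ⟨m, hm x hx⟩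
  · intro i
    have hc : IsCompl (N i) (⨆ j, ⨆ (_ : j ≠ i), N j) := by
      refine ⟨hindep i, codisjoint_iff.mpr ?_⟩
      rw [eq_top_iff, ← htop]
      refine iSup_le fun j => ?_
      by_cases hj : j = i
      · subst hj; exact le_sup_left
      · exact le_sup_of_le_right (le_iSup₂_of_le j hj le_rfl)
    have : Module.Projective A (N i) :=
      Module.Projective.of_split _ _ (Submodule.projectionOnto_comp_subtype hc)
    exact Module.free_of_flat_of_isLocalRing
  · intro i
    infer_instance
  · have hle : (fun i => Submodule.map
        ((IsLocalRing.maximalIdeal A • ⊤ : Submodule A M).mkQ) (N i)) ≤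
        fun i => Module.End.maxGenEigenspace Tb (lam i) := by
      rintro i _ ⟨x, hx, rfl⟩
      have hx' : x ∈ Module.End.maxGenEigenspace T (lam i) := hx
      rw [he i] at hx'
      refine (Module.End.mem_maxGenEigenspace Tb _ _).mpr ⟨e i, ?_⟩
      have := aux_quot_aeval (IsLocalRing.maximalIdeal A) T
        ((Polynomial.X - Polynomial.C (lam i)) ^ e i) x
      rw [LinearMap.mem_ker.mp hx', map_zero] at this
      simpa [Algebra.algebraMap_eq_smul_one] using this
    refine fun i => congrFun ((hinternal.submodule_iSupIndep.le_iff_eq_of_iSup_eq_top ?_).mp hle) i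
    rw [← Submodule.map_iSup, htop, Submodule.map_top, Submodule.range_mkQ]
end

section
/- Let k be a field and let R̃^{2,2}_k be the quotient of the polynomial ring k[A,B,C,D,S,T,U,X,Y,Z] by the ideal generated by the five polynomials XA+ZB−AS−CT, YA−XB−BS−DT, ZD+XC+CS−AU, XD−YC−DS+BU, and X²+YZ−S²−TU. Then the images of the seven elements U, T, S, C, B, D−Z, Y−A form a regular sequence on R̃^{2,2}_k, and the quotient of R̃^{2,2}_k by the ideal they generate is isomorphic as a k-algebra to k[X,Y,Z]/(XY, Y², XZ, Z², X²+YZ). -/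
open MvPolynomial

set_option maxHeartbeats 1000000
set_option synthInstance.maxHeartbeats 400000

/-- variables: `A=0, B=1, C=2, D=3, S=4, T=5, U=6, X=7, Y=8, Z=9`.
The defining ideal of `R̃^{2,2}_k`, generated by the entries of
`[[S,T],[U,−S]]·[[A,B],[C,D]] = [[A,B],[C,D]]·[[X,Y],[Z,−X]]` together with
`S²+TU = X²+YZ`. -/
noncomputable def idealR22 (k : Type*) [Field k] : Ideal (MvPolynomial (Fin 10) k) :=
  Ideal.span
    { X 7 * X 0 + X 9 * X 1 - X 0 * X 4 - X 2 * X 5,   -- XA+ZB−AS−CT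
      X 8 * X 0 - X 7 * X 1 - X 1 * X 4 - X 3 * X 5,   -- YA−XB−BS−DT
      X 9 * X 3 + X 7 * X 2 + X 2 * X 4 - X 0 * X 6,   -- ZD+XC+CS−AU
      X 7 * X 3 - X 8 * X 2 - X 3 * X 4 + X 1 * X 6,   -- XD−YC−DS+BU
      X 7 ^ 2 + X 8 * X 9 - X 4 ^ 2 - X 5 * X 6 }      -- X²+YZ−S²−TU

/-- The ring `R̃^{2,2}_k`. -/
abbrev RTilde22 (k : Type*) [Field k] : Type _ := MvPolynomial (Fin 10) k ⧸ idealR22 k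

set_option linter.unusedSimpArgs false

section MatrixModel

variable {P : Type*} [CommRing P]

/-- Matrix of multiplication by `X` in the basis `1, X, Y, Z, YZ`. -/
def matX (a d B C S T U : P) : Matrix (Fin 5) (Fin 5) P :=
  !![0, S ^ 2 + T * U, C * T - a * S, d * S - B * U, a * d * S + B * C * S;
     1, 0, a, -d, B * C - a * d;
     0, 0, S, C, a * C - B * U;
     0, 0, -B, S, C * T + B * d;
     0, -1, 0, 0, S]

/-- Matrix of multiplication by `Y` in the basis `1, X, Y, Z, YZ`. -/
def matY (a d B C S T U : P) : Matrix (Fin 5) (Fin 5) P :=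
  !![0, C * T - a * S, B * S + d * T, 0, B * (d * S - B * U) - T * (C * S + a * U);
     0, a, B, 0, -(B * d) - T * C;
     1, S, a, 0, B * C + T * U;
     0, -B, T, 0, 2 * B * S;
     0, 0, 0, 1, a]

/-- Matrix of multiplication by `Z` in the basis `1, X, Y, Z, YZ`. -/
def matZ (a d B C S T U : P) : Matrix (Fin 5) (Fin 5) P :=
  !![0, d * S - B * U, 0, -(C * S) - a * U, -(C * (C * T - a * S)) + U * (B * S + d * T);
     0, -d, 0, -C, U * B - a * C;
     0, C, 0, U, -(2 * C * S);
     1, S, 0, -d, B * C + U * T;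
     0, 0, 1, 0, -d]

variable (a d B C S T U : P)

lemma matXY_comm : matX a d B C S T U * matY a d B C S T U
    = matY a d B C S T U * matX a d B C S T U := by
  ext i j
  fin_cases i <;> fin_cases j <;>
    simp [matX, matY, Matrix.mul_apply, Fin.sum_univ_succ] <;> ring

lemma matXZ_comm : matX a d B C S T U * matZ a d B C S T U
    = matZ a d B C S T U * matX a d B C S T U := by
  ext i j
  fin_cases i <;> fin_cases j <;>
    simp [matX, matZ, Matrix.mul_apply, Fin.sum_univ_succ] <;> ring

lemma matYZ_comm : matY a d B C S T U * matZ a d B C S T U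
    = matZ a d B C S T U * matY a d B C S T U := by
  ext i j
  fin_cases i <;> fin_cases j <;>
    simp [matY, matZ, Matrix.mul_apply, Fin.sum_univ_succ] <;> ring

lemma mat_rel1 : matX a d B C S T U * matY a d B C S T U =
    a • matX a d B C S T U + S • matY a d B C S T U - B • matZ a d B C S T U
      + (C * T - a * S) • 1 := by
  ext i j
  fin_cases i <;> fin_cases j <;>
    simp [matX, matY, matZ, Matrix.mul_apply, Fin.sum_univ_succ] <;> ring

lemma mat_rel2 : matY a d B C S T U * matY a d B C S T U =
    B • matX a d B C S T U + a • matY a d B C S T U + T • matZ a d B C S T U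
      + (B * S + d * T) • 1 := by
  ext i j
  fin_cases i <;> fin_cases j <;>
    simp [matX, matY, matZ, Matrix.mul_apply, Fin.sum_univ_succ] <;> ring

lemma mat_rel3 : matZ a d B C S T U * matZ a d B C S T U =
    -C • matX a d B C S T U + U • matY a d B C S T U - d • matZ a d B C S T U
      + (-(C * S) - a * U) • 1 := by
  ext i j
  fin_cases i <;> fin_cases j <;>
    simp [matX, matY, matZ, Matrix.mul_apply, Fin.sum_univ_succ] <;> ring

lemma mat_rel4 : matX a d B C S T U * matZ a d B C S T U =
    -d • matX a d B C S T U + C • matY a d B C S T U + S • matZ a d B C S T U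
      + (d * S - B * U) • 1 := by
  ext i j
  fin_cases i <;> fin_cases j <;>
    simp [matX, matY, matZ, Matrix.mul_apply, Fin.sum_univ_succ] <;> ring

lemma mat_rel5 : matX a d B C S T U * matX a d B C S T U =
    -(matY a d B C S T U * matZ a d B C S T U) + (S ^ 2 + T * U) • 1 := by
  ext i j
  fin_cases i <;> fin_cases j <;>
    simp [matX, matY, matZ, Matrix.mul_apply, Fin.sum_univ_succ] <;> ring

end MatrixModel

section VariablesRegular

lemma isRegular_vars (k : Type*) [Field k] :
    RingTheory.Sequence.IsRegular (MvPolynomial (Fin 7) k)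
      ((List.finRange 7).map (X : Fin 7 → MvPolynomial (Fin 7) k)) := by
  have key : ∀ i, Ideal.ofList (((List.finRange 7).map (X : Fin 7 → MvPolynomial (Fin 7) k)).take i)
      = Ideal.span (X '' {j : Fin 7 | (j : ℕ) < i}) := by
    intro i
    unfold Ideal.ofList
    congr 1
    ext r
    simp only [← List.map_take, List.mem_map, Set.mem_ofPred_eq, Set.mem_image]
    refine exists_congr fun j => and_congr_left fun _ => ?_
    rw [List.mem_take_iff_getElem]
    constructor
    · rintro ⟨n, hn, rfl⟩
      simp at hn ⊢
      omega
    · intro h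
      exact ⟨j, by simp; omega, by simp⟩
  refine ⟨⟨?_⟩, ?_⟩
  · intro i hi
    have hi7 : i < 7 := by simpa using hi
    rw [key, smul_eq_mul, Ideal.mul_top]
    rw [isSMulRegular_iff_right_eq_zero_of_smul]
    intro f
    obtain ⟨f, rfl⟩ := Submodule.Quotient.mk_surjective _ f
    rw [← Submodule.Quotient.mk_smul, Submodule.Quotient.mk_eq_zero,
      Submodule.Quotient.mk_eq_zero, mem_ideal_span_X_image, mem_ideal_span_X_image]
    intro h m hm
    obtain ⟨j, hj, hmj⟩ := h (m + Finsupp.single ⟨i, hi7⟩ 1) (by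
      simp only [List.getElem_map, List.getElem_finRange, smul_eq_mul]
      rw [mem_support_iff] at hm ⊢
      simpa [add_comm m, coeff_X_mul] using hm)
    refine ⟨j, hj, ?_⟩
    have : (⟨i, hi7⟩ : Fin 7) ≠ j := by
      rintro rfl
      simp at hj
    simpa [Finsupp.single_apply, this] using hmj
  · have h7 := key 7
    rw [List.take_of_length_le (by simp)] at h7
    rw [h7, smul_eq_mul, Ideal.mul_top]
    intro h
    have h1 : (1 : MvPolynomial (Fin 7) k) ∈ Ideal.span (X '' {j : Fin 7 | (j : ℕ) < 7}) := by
      rw [← h]; trivial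
    rw [mem_ideal_span_X_image] at h1
    obtain ⟨j, _, hj⟩ := h1 0 (by simp)
    simp at hj

end VariablesRegular

section Model

lemma exists_model.{v} {P : Type v} [CommRing P] (a d B C S T U : P) :
    ∃ (E : Type v) (_ : CommRing E) (_ : Algebra P E) (x y z : E) (c : E →ₗ[P] (Fin 5 → P)),
      (x * y = a • x + S • y - B • z + (C * T - a * S) • 1 ∧
       y * y = B • x + a • y + T • z + (B * S + d * T) • 1 ∧
       z * z = -C • x + U • y - d • z + (-(C * S) - a * U) • 1 ∧
       x * z = -d • x + C • y + S • z + (d * S - B * U) • 1 ∧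
       x * x = -(y * z) + (S ^ 2 + T * U) • 1) ∧
      c 1 = Pi.single 0 1 ∧ c x = Pi.single 1 1 ∧ c y = Pi.single 2 1 ∧
      c z = Pi.single 3 1 ∧ c (y * z) = Pi.single 4 1 := by
  set MX := matX a d B C S T U with hX
  set MY := matY a d B C S T U with hY
  set MZ := matZ a d B C S T U with hZ
  have hcomm : ∀ p ∈ ({MX, MY, MZ} : Set (Matrix (Fin 5) (Fin 5) P)),
      ∀ q ∈ ({MX, MY, MZ} : Set (Matrix (Fin 5) (Fin 5) P)), p * q = q * p := by
    have h1 := matXY_comm a d B C S T U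
    have h2 := matXZ_comm a d B C S T U
    have h3 := matYZ_comm a d B C S T U
    rintro p (rfl | rfl | rfl) q (rfl | rfl | rfl) <;>
      first | rfl | assumption | (symm; assumption)
  let E := Algebra.adjoin P ({MX, MY, MZ} : Set (Matrix (Fin 5) (Fin 5) P))
  letI : CommRing E := Algebra.adjoinCommRingOfComm P hcomm
  let col : Matrix (Fin 5) (Fin 5) P →ₗ[P] (Fin 5 → P) :=
    { toFun := fun M i => M i 0
      map_add' := fun _ _ => rfl
      map_smul' := fun _ _ => rfl }
  refine ⟨E, inferInstance, inferInstance,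
    ⟨MX, Algebra.subset_adjoin (by simp)⟩, ⟨MY, Algebra.subset_adjoin (by simp)⟩,
    ⟨MZ, Algebra.subset_adjoin (by simp)⟩, col ∘ₗ E.val.toLinearMap,
    ⟨Subtype.ext (mat_rel1 a d B C S T U), Subtype.ext (mat_rel2 a d B C S T U),
      Subtype.ext (mat_rel3 a d B C S T U), Subtype.ext (mat_rel4 a d B C S T U),
      Subtype.ext (mat_rel5 a d B C S T U)⟩, ?_, ?_, ?_, ?_, ?_⟩
  · change (fun i => (1 : Matrix (Fin 5) (Fin 5) P) i 0) = _
    ext i; simp [Matrix.one_apply, Pi.single_apply]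
  · change (fun i => MX i 0) = _
    ext i; fin_cases i <;> simp [hX, matX]
  · change (fun i => MY i 0) = _
    ext i; fin_cases i <;> simp [hY, matY]
  · change (fun i => MZ i 0) = _
    ext i; fin_cases i <;> simp [hZ, matZ]
  · change (fun i => (MY * MZ) i 0) = _
    ext i; fin_cases i <;> simp [hY, hZ, matY, matZ, Matrix.mul_apply, Fin.sum_univ_succ]

end Model

section Freeness

variable (k : Type*) [Field k]

/-- The structure map from `k[u,t,s,c,b,d,a]` to `R̃`. -/
noncomputable def baseMap : MvPolynomial (Fin 7) k →ₐ[k] RTilde22 k :=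
  aeval ![Ideal.Quotient.mk (idealR22 k) (X 6), Ideal.Quotient.mk (idealR22 k) (X 5),
        Ideal.Quotient.mk (idealR22 k) (X 4), Ideal.Quotient.mk (idealR22 k) (X 2),
        Ideal.Quotient.mk (idealR22 k) (X 1),
        Ideal.Quotient.mk (idealR22 k) (X 3 - X 9),
        Ideal.Quotient.mk (idealR22 k) (X 8 - X 0)]

lemma relations :
    let q := Ideal.Quotient.mk (idealR22 k)
    q (X 7) * q (X 0) + q (X 9) * q (X 1) - q (X 0) * q (X 4) - q (X 2) * q (X 5) = 0 ∧
    q (X 8) * q (X 0) - q (X 7) * q (X 1) - q (X 1) * q (X 4) - q (X 3) * q (X 5) = 0 ∧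
    q (X 9) * q (X 3) + q (X 7) * q (X 2) + q (X 2) * q (X 4) - q (X 0) * q (X 6) = 0 ∧
    q (X 7) * q (X 3) - q (X 8) * q (X 2) - q (X 3) * q (X 4) + q (X 1) * q (X 6) = 0 ∧
    q (X 7) ^ 2 + q (X 8) * q (X 9) - q (X 4) ^ 2 - q (X 5) * q (X 6) = 0 := by
  intro q
  simp only [← map_mul, ← map_add, ← map_sub, ← map_pow]
  refine ⟨?_, ?_, ?_, ?_, ?_⟩ <;>
    exact Ideal.Quotient.eq_zero_iff_mem.mpr (Ideal.subset_span (by simp))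

/-- `R̃` is free over `k[u,t,s,c,b,d,a]`. -/
lemma free_rTilde22 :
    letI : Algebra (MvPolynomial (Fin 7) k) (RTilde22 k) := (baseMap k).toRingHom.toAlgebra
    Module.Free (MvPolynomial (Fin 7) k) (RTilde22 k) ∧ Nontrivial (RTilde22 k) := by
  letI : Algebra (MvPolynomial (Fin 7) k) (RTilde22 k) := (baseMap k).toRingHom.toAlgebra
  have hsmul : ∀ (p : MvPolynomial (Fin 7) k) (r : RTilde22 k), p • r = baseMap k p * r :=
    fun p r => rfl
  obtain ⟨E, _, _, x, y, z, c, ⟨h1, h2, h3, h4, h5⟩, c1, cx, cy, cz, cw⟩ :=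
    exists_model (P := MvPolynomial (Fin 7) k) (X 6) (X 5) (X 4) (X 3) (X 2) (X 1) (X 0)
  let α := algebraMap (MvPolynomial (Fin 7) k) E
  simp only [Algebra.smul_def, map_add, map_sub, map_neg, map_mul, map_pow, mul_one]
    at h1 h2 h3 h4 h5
  let ψ₀ : MvPolynomial (Fin 10) k →+* E :=
    eval₂Hom (α.comp MvPolynomial.C)
      ![y - α (X 6), α (X 4), α (X 3), z + α (X 5), α (X 2), α (X 1), α (X 0), x, y, z]
  let ψ : RTilde22 k →+* E := Ideal.Quotient.lift (idealR22 k) ψ₀ (by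
    intro f hf
    have : idealR22 k ≤ RingHom.ker ψ₀ := by
      unfold idealR22
      rw [Ideal.span_le]
      rintro f (rfl | rfl | rfl | rfl | rfl) <;>
        simp [ψ₀, RingHom.mem_ker, α]
      · linear_combination h1
      · linear_combination h2
      · linear_combination h3
      · linear_combination h4
      · linear_combination h5
    exact this hf)
  have hψq : ∀ i, ψ (Ideal.Quotient.mk (idealR22 k) (X i)) =
      ![y - α (X 6), α (X 4), α (X 3), z + α (X 5), α (X 2), α (X 1), α (X 0), x, y, z] i := by
    intro i
    change ψ₀ (X i) = _
    simp [ψ₀]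
  have hψ : ∀ p, ψ (baseMap k p) = α p := by
    intro p
    have : (ψ.comp (baseMap k).toRingHom) = α := by
      apply MvPolynomial.ringHom_ext
      · intro r
        have : baseMap k (MvPolynomial.C r)
            = Ideal.Quotient.mk (idealR22 k) (MvPolynomial.C r) := by
          unfold baseMap
          rw [MvPolynomial.aeval_C]; rfl
        change ψ (baseMap k (MvPolynomial.C r)) = _
        rw [this]
        change ψ₀ (MvPolynomial.C r) = _
        simp [ψ₀]
      · intro i
        fin_cases i <;> simp [baseMap, hψq]
    exact congrArg (fun f => f p) this
  let ψa : RTilde22 k →ₐ[MvPolynomial (Fin 7) k] E := { ψ with commutes' := hψ }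
  let ε : RTilde22 k →ₗ[MvPolynomial (Fin 7) k] (Fin 5 → MvPolynomial (Fin 7) k) :=
    c ∘ₗ ψa.toLinearMap
  have hε : ∀ r, ε r = c (ψ r) := fun r => rfl
  let q := Ideal.Quotient.mk (idealR22 k)
  let b : Fin 5 → RTilde22 k := ![1, q (X 7), q (X 8), q (X 9), q (X 8) * q (X 9)]
  have hli : LinearIndependent (MvPolynomial (Fin 7) k) b := by
    apply LinearIndependent.of_comp ε
    have : ε ∘ b = Pi.basisFun (MvPolynomial (Fin 7) k) (Fin 5) := by
      funext i
      fin_cases i <;> simp [hε, b, q, hψq, c1, cx, cy, cz, cw]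
    rw [this]
    exact (Pi.basisFun _ _).linearIndependent
  have hmem : ∀ (r : RTilde22 k) (p0 p1 p2 p3 p4 : MvPolynomial (Fin 7) k),
      r = baseMap k p0 + baseMap k p1 * q (X 7) + baseMap k p2 * q (X 8)
        + baseMap k p3 * q (X 9) + baseMap k p4 * (q (X 8) * q (X 9)) →
      r ∈ Submodule.span (MvPolynomial (Fin 7) k) (Set.range b) := by
    intro r p0 p1 p2 p3 p4 h
    rw [h, ← mul_one (baseMap k p0)]
    simp only [← hsmul]
    have hb : ∀ i, b i ∈ Submodule.span (MvPolynomial (Fin 7) k) (Set.range b) :=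
      fun i => Submodule.subset_span ⟨i, rfl⟩
    exact add_mem (add_mem (add_mem (add_mem (Submodule.smul_mem _ _ (hb 0))
      (Submodule.smul_mem _ _ (hb 1))) (Submodule.smul_mem _ _ (hb 2)))
      (Submodule.smul_mem _ _ (hb 3))) (Submodule.smul_mem _ _ (hb 4))
  obtain ⟨r1, r2, r3, r4, r5⟩ := relations k
  have v0 : baseMap k (X 0) = q (X 6) := by simp [baseMap, q]
  have v1 : baseMap k (X 1) = q (X 5) := by simp [baseMap, q]
  have v2 : baseMap k (X 2) = q (X 4) := by simp [baseMap, q]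
  have v3 : baseMap k (X 3) = q (X 2) := by simp [baseMap, q]
  have v4 : baseMap k (X 4) = q (X 1) := by simp [baseMap, q]
  have v5 : baseMap k (X 5) = q (X 3) - q (X 9) := by simp [baseMap, q]
  have v6 : baseMap k (X 6) = q (X 8) - q (X 0) := by simp [baseMap, q]
  have clos : ∀ g : RTilde22 k,
      (∀ i, b i * g ∈ Submodule.span (MvPolynomial (Fin 7) k) (Set.range b)) →
      ∀ r ∈ Submodule.span (MvPolynomial (Fin 7) k) (Set.range b),
        r * g ∈ Submodule.span (MvPolynomial (Fin 7) k) (Set.range b) := by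
    intro g hg r hr
    induction hr using Submodule.span_induction with
    | mem r hr => obtain ⟨i, rfl⟩ := hr; exact hg i
    | zero => rw [zero_mul]; exact zero_mem _
    | add r s _ _ hr hs => rw [add_mul]; exact add_mem hr hs
    | smul p r _ hr => rw [smul_mul_assoc]; exact Submodule.smul_mem _ _ hr
  have closP : ∀ (p : MvPolynomial (Fin 7) k),
      ∀ r ∈ Submodule.span (MvPolynomial (Fin 7) k) (Set.range b),
        r * baseMap k p ∈ Submodule.span (MvPolynomial (Fin 7) k) (Set.range b) := by
    intro p r hr
    rw [mul_comm, ← hsmul]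
    exact Submodule.smul_mem _ _ hr
  have closX := clos (q (X 7)) (by
    intro i
    fin_cases i
    · apply hmem _ 0 1 0 0 0; simp [b]
    · apply hmem _ (X 2 ^ 2 + X 1 * X 0) 0 0 0 (-1)
      simp [b, v0, v1, v2, v3, v4, v5, v6]
      linear_combination r5
    · apply hmem _ (X 3 * X 1 - X 6 * X 2) (X 6) (X 2) (-X 4) 0
      simp [b, v0, v1, v2, v3, v4, v5, v6]
      linear_combination r1
    · apply hmem _ (X 5 * X 2 - X 4 * X 0) (-X 5) (X 3) (X 2) 0
      simp [b, v0, v1, v2, v3, v4, v5, v6]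
      linear_combination r4
    · apply hmem _ (X 6 * X 5 * X 2 + X 4 * X 3 * X 2) (X 4 * X 3 - X 6 * X 5)
        (X 6 * X 3 - X 4 * X 0) (X 3 * X 1 + X 4 * X 5) (X 2)
      simp [b, v0, v1, v2, v3, v4, v5, v6]
      linear_combination q (X 9) * r1 + (q (X 8) - q (X 0)) * r4 - q (X 1) * r3)
  have closY := clos (q (X 8)) (by
    intro i
    fin_cases i
    · apply hmem _ 0 0 1 0 0; simp [b]
    · apply hmem _ (X 3 * X 1 - X 6 * X 2) (X 6) (X 2) (-X 4) 0
      simp [b, v0, v1, v2, v3, v4, v5, v6]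
      linear_combination r1
    · apply hmem _ (X 4 * X 2 + X 5 * X 1) (X 4) (X 6) (X 1) 0
      simp [b, v0, v1, v2, v3, v4, v5, v6]
      linear_combination r2
    · apply hmem _ 0 0 0 0 1
      simp [b, mul_comm]
    · apply hmem _ (X 4 * (X 5 * X 2 - X 4 * X 0) - X 1 * (X 3 * X 2 + X 6 * X 0))
        (-(X 4 * X 5) - X 1 * X 3) (X 4 * X 3 + X 1 * X 0) (X 4 * X 2 + X 4 * X 2) (X 6)
      simp [b, v0, v1, v2, v3, v4, v5, v6]
      linear_combination q (X 9) * r2 + q (X 1) * r4 + q (X 5) * r3)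
  have closZ := clos (q (X 9)) (by
    intro i
    fin_cases i
    · apply hmem _ 0 0 0 1 0; simp [b]
    · apply hmem _ (X 5 * X 2 - X 4 * X 0) (-X 5) (X 3) (X 2) 0
      simp [b, v0, v1, v2, v3, v4, v5, v6]
      linear_combination r4
    · apply hmem _ 0 0 0 0 1
      simp [b]
    · apply hmem _ (-(X 3 * X 2) - X 6 * X 0) (-X 3) (X 0) (-X 5) 0
      simp [b, v0, v1, v2, v3, v4, v5, v6]
      linear_combination r3
    · apply hmem _ (-(X 3 * (X 3 * X 1 - X 6 * X 2)) + X 0 * (X 4 * X 2 + X 5 * X 1))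
        (X 0 * X 4 - X 6 * X 3) (-(X 3 * X 2 + X 3 * X 2)) (X 4 * X 3 + X 0 * X 1) (-X 5)
      simp [b, v0, v1, v2, v3, v4, v5, v6]
      linear_combination q (X 8) * r3 - q (X 2) * r1 + q (X 6) * r2)
  have hall : ∀ p : MvPolynomial (Fin 10) k,
      q p ∈ Submodule.span (MvPolynomial (Fin 7) k) (Set.range b) := by
    intro p
    induction p using MvPolynomial.induction_on with
    | C r =>
      apply hmem _ (MvPolynomial.C r) 0 0 0 0
      have : baseMap k (MvPolynomial.C r) = q (MvPolynomial.C r) := by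
        unfold baseMap
        rw [MvPolynomial.aeval_C]; rfl
      simp [this]
    | add f g hf hg => rw [map_add]; exact add_mem hf hg
    | mul_X f i hf =>
      rw [map_mul]
      fin_cases i
      · have : q (X 0) = q (X 8) - baseMap k (X 6) := by rw [v6]; ring
        change q f * q (X 0) ∈ _
        rw [this, mul_sub]
        exact sub_mem (closY _ hf) (closP _ _ hf)
      · have := closP (X 4) _ hf; rwa [v4] at this
      · have := closP (X 3) _ hf; rwa [v3] at this
      · have : q (X 3) = q (X 9) + baseMap k (X 5) := by rw [v5]; ring
        change q f * q (X 3) ∈ _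
        rw [this, mul_add]
        exact add_mem (closZ _ hf) (closP _ _ hf)
      · have := closP (X 2) _ hf; rwa [v2] at this
      · have := closP (X 1) _ hf; rwa [v1] at this
      · have := closP (X 0) _ hf; rwa [v0] at this
      · exact closX _ hf
      · exact closY _ hf
      · exact closZ _ hf
  have hspan : ⊤ ≤ Submodule.span (MvPolynomial (Fin 7) k) (Set.range b) := by
    rintro r -
    obtain ⟨p, rfl⟩ := Ideal.Quotient.mk_surjective r
    exact hall p
  refine ⟨Module.Free.of_basis (Module.Basis.mk hli hspan), ⟨⟨b 0, 0, hli.ne_zero 0⟩⟩⟩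

end Freeness

section Quotient

variable (k : Type*) [Field k]

lemma quotient_equiv : Nonempty
      ((RTilde22 k ⧸ Ideal.span
          ({Ideal.Quotient.mk (idealR22 k) (X 6), Ideal.Quotient.mk (idealR22 k) (X 5),
            Ideal.Quotient.mk (idealR22 k) (X 4), Ideal.Quotient.mk (idealR22 k) (X 2),
            Ideal.Quotient.mk (idealR22 k) (X 1),
            Ideal.Quotient.mk (idealR22 k) (X 3 - X 9),
            Ideal.Quotient.mk (idealR22 k) (X 8 - X 0)} : Set (RTilde22 k))) ≃ₐ[k]
        (MvPolynomial (Fin 3) k ⧸ Ideal.span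
          ({X 0 * X 1, X 1 ^ 2, X 0 * X 2, X 2 ^ 2, X 0 ^ 2 + X 1 * X 2} :
            Set (MvPolynomial (Fin 3) k)))) := by
  set J := Ideal.span
          ({Ideal.Quotient.mk (idealR22 k) (X 6), Ideal.Quotient.mk (idealR22 k) (X 5),
            Ideal.Quotient.mk (idealR22 k) (X 4), Ideal.Quotient.mk (idealR22 k) (X 2),
            Ideal.Quotient.mk (idealR22 k) (X 1),
            Ideal.Quotient.mk (idealR22 k) (X 3 - X 9),
            Ideal.Quotient.mk (idealR22 k) (X 8 - X 0)} : Set (RTilde22 k)) with hJ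
  set K := Ideal.span
          ({X 0 * X 1, X 1 ^ 2, X 0 * X 2, X 2 ^ 2, X 0 ^ 2 + X 1 * X 2} :
            Set (MvPolynomial (Fin 3) k)) with hK
  let x := Ideal.Quotient.mk K (X 0)
  let y := Ideal.Quotient.mk K (X 1)
  let z := Ideal.Quotient.mk K (X 2)
  have k1 : x * y = 0 := by
    simp only [x, y, ← map_mul]
    exact Ideal.Quotient.eq_zero_iff_mem.mpr (Ideal.subset_span (by simp))
  have k2 : y ^ 2 = 0 := by
    simp only [y, ← map_pow]
    exact Ideal.Quotient.eq_zero_iff_mem.mpr (Ideal.subset_span (by simp))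
  have k3 : x * z = 0 := by
    simp only [x, z, ← map_mul]
    exact Ideal.Quotient.eq_zero_iff_mem.mpr (Ideal.subset_span (by simp))
  have k4 : z ^ 2 = 0 := by
    simp only [z, ← map_pow]
    exact Ideal.Quotient.eq_zero_iff_mem.mpr (Ideal.subset_span (by simp))
  have k5 : x ^ 2 + y * z = 0 := by
    simp only [x, y, z, ← map_pow, ← map_mul, ← map_add]
    exact Ideal.Quotient.eq_zero_iff_mem.mpr (Ideal.subset_span (by simp))
  let f₀ : MvPolynomial (Fin 10) k →ₐ[k] MvPolynomial (Fin 3) k ⧸ K :=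
    aeval ![y, 0, 0, z, 0, 0, 0, x, y, z]
  let f₁ : RTilde22 k →ₐ[k] MvPolynomial (Fin 3) k ⧸ K := Ideal.Quotient.liftₐ (idealR22 k) f₀ (by
    intro g hg
    have : idealR22 k ≤ RingHom.ker f₀ := by
      unfold idealR22
      rw [Ideal.span_le]
      rintro f (rfl | rfl | rfl | rfl | rfl) <;>
        simp [f₀, RingHom.mem_ker]
      · exact k1
      · linear_combination k2
      · linear_combination k4
      · exact k3
      · exact k5
    exact this hg)
  have hf₁ : ∀ i, f₁ (Ideal.Quotient.mk (idealR22 k) (X i))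
      = (![y, 0, 0, z, 0, 0, 0, x, y, z] : Fin 10 → MvPolynomial (Fin 3) k ⧸ K) i := by
    intro i
    change f₀ (X i) = _
    simp [f₀]
  let f : RTilde22 k ⧸ J →ₐ[k] MvPolynomial (Fin 3) k ⧸ K := Ideal.Quotient.liftₐ J f₁ (by
    intro g hg
    have : J ≤ RingHom.ker f₁ := by
      rw [hJ, Ideal.span_le]
      rintro f (rfl | rfl | rfl | rfl | rfl | rfl | rfl) <;>
        simp [RingHom.mem_ker, hf₁]
    exact this hg)
  let p : Fin 10 → RTilde22 k ⧸ J := fun i => Ideal.Quotient.mk J (Ideal.Quotient.mk (idealR22 k) (X i))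
  have hf : ∀ i, f (p i)
      = (![y, 0, 0, z, 0, 0, 0, x, y, z] : Fin 10 → MvPolynomial (Fin 3) k ⧸ K) i := hf₁
  obtain ⟨r1, r2, r3, r4, r5⟩ := relations k
  replace r1 := congrArg (Ideal.Quotient.mk J) r1
  replace r2 := congrArg (Ideal.Quotient.mk J) r2
  replace r3 := congrArg (Ideal.Quotient.mk J) r3
  replace r4 := congrArg (Ideal.Quotient.mk J) r4
  replace r5 := congrArg (Ideal.Quotient.mk J) r5
  simp only [map_add, map_sub, map_mul, map_pow, map_zero] at r1 r2 r3 r4 r5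
  have p6 : p 6 = 0 := Ideal.Quotient.eq_zero_iff_mem.mpr (Ideal.subset_span (by simp))
  have p5 : p 5 = 0 := Ideal.Quotient.eq_zero_iff_mem.mpr (Ideal.subset_span (by simp))
  have p4 : p 4 = 0 := Ideal.Quotient.eq_zero_iff_mem.mpr (Ideal.subset_span (by simp))
  have p2 : p 2 = 0 := Ideal.Quotient.eq_zero_iff_mem.mpr (Ideal.subset_span (by simp))
  have p1 : p 1 = 0 := Ideal.Quotient.eq_zero_iff_mem.mpr (Ideal.subset_span (by simp))
  have p3 : p 3 = p 9 := by
    rw [← sub_eq_zero]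
    simp only [p, ← map_sub]
    exact Ideal.Quotient.eq_zero_iff_mem.mpr (Ideal.subset_span (by simp))
  have p0 : p 0 = p 8 := by
    symm
    rw [← sub_eq_zero]
    simp only [p, ← map_sub]
    exact Ideal.Quotient.eq_zero_iff_mem.mpr (Ideal.subset_span (by simp))
  change p 7 * p 0 + p 9 * p 1 - p 0 * p 4 - p 2 * p 5 = 0 at r1
  change p 8 * p 0 - p 7 * p 1 - p 1 * p 4 - p 3 * p 5 = 0 at r2
  change p 9 * p 3 + p 7 * p 2 + p 2 * p 4 - p 0 * p 6 = 0 at r3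
  change p 7 * p 3 - p 8 * p 2 - p 3 * p 4 + p 1 * p 6 = 0 at r4
  change p 7 ^ 2 + p 8 * p 9 - p 4 ^ 2 - p 5 * p 6 = 0 at r5
  rw [p0, p1, p2, p4, p5] at r1
  rw [p0, p1, p5] at r2
  rw [p3, p2, p6] at r3
  rw [p3, p2, p4, p6] at r4
  rw [p4, p6] at r5
  let g₀ : MvPolynomial (Fin 3) k →ₐ[k] RTilde22 k ⧸ J := aeval ![p 7, p 8, p 9]
  let g : MvPolynomial (Fin 3) k ⧸ K →ₐ[k] RTilde22 k ⧸ J := Ideal.Quotient.liftₐ K g₀ (by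
    intro h hh
    have : K ≤ RingHom.ker g₀ := by
      rw [hK, Ideal.span_le]
      rintro f (rfl | rfl | rfl | rfl | rfl) <;>
        simp [g₀, RingHom.mem_ker]
      · linear_combination r1
      · linear_combination r2
      · linear_combination r4
      · linear_combination r3
      · linear_combination r5
    exact this hh)
  have hg : ∀ i, g (Ideal.Quotient.mk K (X i))
      = (![p 7, p 8, p 9] : Fin 3 → RTilde22 k ⧸ J) i := by
    intro i
    change g₀ (X i) = _
    simp [g₀]
  refine ⟨AlgEquiv.ofAlgHom f g ?_ ?_⟩
  · apply Ideal.Quotient.algHom_ext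
    apply MvPolynomial.algHom_ext
    intro i
    change f (g (Ideal.Quotient.mk K (X i))) = Ideal.Quotient.mk K (X i)
    rw [hg]
    fin_cases i
    · exact hf 7
    · exact hf 8
    · exact hf 9
  · apply Ideal.Quotient.algHom_ext
    apply Ideal.Quotient.algHom_ext
    apply MvPolynomial.algHom_ext
    intro i
    change g (f (p i)) = p i
    rw [hf]
    fin_cases i
    · exact (hg 1).trans p0.symm
    · exact (map_zero g).trans p1.symm
    · exact (map_zero g).trans p2.symm
    · exact (hg 2).trans p3.symm
    · exact (map_zero g).trans p4.symm
    · exact (map_zero g).trans p5.symm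
    · exact (map_zero g).trans p6.symm
    · exact hg 0
    · exact hg 1
    · exact hg 2

end Quotient

/-- In `R̃^{2,2}_k`, the elements `U, T, S, C, B, D−Z, Y−A` form a regular sequence, with
quotient isomorphic to `k[X,Y,Z]/(XY, Y², XZ, Z², X²+YZ)` (variables `X=0, Y=1, Z=2`). -/
theorem rTilde22_regular_sequence (k : Type*) [Field k] :
    RingTheory.Sequence.IsRegular (RTilde22 k)
      [Ideal.Quotient.mk (idealR22 k) (X 6), Ideal.Quotient.mk (idealR22 k) (X 5),
        Ideal.Quotient.mk (idealR22 k) (X 4), Ideal.Quotient.mk (idealR22 k) (X 2),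
        Ideal.Quotient.mk (idealR22 k) (X 1),
        Ideal.Quotient.mk (idealR22 k) (X 3 - X 9),
        Ideal.Quotient.mk (idealR22 k) (X 8 - X 0)] ∧
    Nonempty
      ((RTilde22 k ⧸ Ideal.span
          ({Ideal.Quotient.mk (idealR22 k) (X 6), Ideal.Quotient.mk (idealR22 k) (X 5),
            Ideal.Quotient.mk (idealR22 k) (X 4), Ideal.Quotient.mk (idealR22 k) (X 2),
            Ideal.Quotient.mk (idealR22 k) (X 1),
            Ideal.Quotient.mk (idealR22 k) (X 3 - X 9),
            Ideal.Quotient.mk (idealR22 k) (X 8 - X 0)} : Set (RTilde22 k))) ≃ₐ[k]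
        (MvPolynomial (Fin 3) k ⧸ Ideal.span
          ({X 0 * X 1, X 1 ^ 2, X 0 * X 2, X 2 ^ 2, X 0 ^ 2 + X 1 * X 2} :
            Set (MvPolynomial (Fin 3) k)))) := by
  refine ⟨?_, quotient_equiv k⟩
  letI : Algebra (MvPolynomial (Fin 7) k) (RTilde22 k) := (baseMap k).toRingHom.toAlgebra
  obtain ⟨hfree, hnt⟩ := free_rTilde22 k
  haveI : Module.Free (MvPolynomial (Fin 7) k) (RTilde22 k) := hfree
  have := (isRegular_vars k).of_faithfullyFlat (S := RTilde22 k)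
  have hmap : ∀ i, algebraMap (MvPolynomial (Fin 7) k) (RTilde22 k) (X i) = baseMap k (X i) :=
    fun _ => rfl
  have hfr : List.finRange 7 = [0, 1, 2, 3, 4, 5, 6] := by decide
  rw [hfr] at this
  simp only [List.map_cons, List.map_nil, hmap, baseMap, aeval_X] at this
  exact this
end

section
/- Let k be a field and let R̃^{1,2,1}_k be the quotient of the polynomial ring k[A,B,C,D,R,X,Y,Z] by the ideal generated by the six polynomials XA+ZB−AR, YA−XB−BR, XC+YD+CR, ZC−XD+DR, X²+YZ−R², and AC+BD. Then the images of the five elements R, D, B, C−Z, Y−A form a regular sequence on R̃^{1,2,1}_k, and the quotient of R̃^{1,2,1}_k by the ideal they generate is isomorphic as a k-algebra to k[X,Y,Z]/(X², Y², Z², XY, XZ, YZ). -/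
open MvPolynomial

set_option maxHeartbeats 1000000
set_option synthInstance.maxHeartbeats 400000

/-- variables: `A=0, B=1, C=2, D=3, R=4, X=5, Y=6, Z=7`.
The defining ideal of `R̃^{1,2,1}_k`, expressing `(A B)·[[X,Y],[Z,−X]] = R·(A B)`,
`[[X,Y],[Z,−X]]·(C,D)ᵀ = −R·(C,D)ᵀ`, `R² = X²+YZ` and `AC+BD = 0`. -/
noncomputable def idealR121 (k : Type*) [Field k] : Ideal (MvPolynomial (Fin 8) k) :=
  Ideal.span
    { X 5 * X 0 + X 7 * X 1 - X 0 * X 4,   -- XA+ZB−AR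
      X 6 * X 0 - X 5 * X 1 - X 1 * X 4,   -- YA−XB−BR
      X 5 * X 2 + X 6 * X 3 + X 2 * X 4,   -- XC+YD+CR
      X 7 * X 2 - X 5 * X 3 + X 3 * X 4,   -- ZC−XD+DR
      X 5 ^ 2 + X 6 * X 7 - X 4 ^ 2,       -- X²+YZ−R²
      X 0 * X 2 + X 1 * X 3 }              -- AC+BD

/-- The ring `R̃^{1,2,1}_k`. -/
abbrev RTilde121 (k : Type*) [Field k] : Type _ := MvPolynomial (Fin 8) k ⧸ idealR121 k

/-- The rank four algebra over `P` with basis `1, X, Y, Z` and parameters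
`r = R`, `d = D`, `b = B`, `c = C - Z`, `t = Y - A`. -/
@[ext]
structure Q4 (P : Type*) [CommRing P] (r d b c t : P) where
  c0 : P
  c1 : P
  c2 : P
  c3 : P

namespace Q4

variable {P : Type*} [CommRing P] {r d b c t : P}

instance : Zero (Q4 P r d b c t) := ⟨⟨0, 0, 0, 0⟩⟩
instance : One (Q4 P r d b c t) := ⟨⟨1, 0, 0, 0⟩⟩
instance : Add (Q4 P r d b c t) :=
  ⟨fun p q => ⟨p.c0 + q.c0, p.c1 + q.c1, p.c2 + q.c2, p.c3 + q.c3⟩⟩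
instance : Neg (Q4 P r d b c t) := ⟨fun p => ⟨-p.c0, -p.c1, -p.c2, -p.c3⟩⟩
instance : Mul (Q4 P r d b c t) :=
  ⟨fun p q =>
    ⟨p.c0 * q.c0 + p.c1 * q.c1 * (r ^ 2 - t * c + b * d) + p.c2 * q.c2 * (b * r)
      + p.c3 * q.c3 * (-d * r) + (p.c1 * q.c2 + p.c2 * q.c1) * (-t * r)
      + (p.c1 * q.c3 + p.c3 * q.c1) * (-c * r) + (p.c2 * q.c3 + p.c3 * q.c2) * (t * c - b * d),
     p.c0 * q.c1 + p.c1 * q.c0 + p.c2 * q.c2 * b + p.c3 * q.c3 * d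
      + (p.c1 * q.c2 + p.c2 * q.c1) * t - (p.c1 * q.c3 + p.c3 * q.c1) * c,
     p.c0 * q.c2 + p.c2 * q.c0 + p.c1 * q.c1 * c + p.c2 * q.c2 * t
      + (p.c1 * q.c2 + p.c2 * q.c1) * r - (p.c1 * q.c3 + p.c3 * q.c1) * d
      - (p.c2 * q.c3 + p.c3 * q.c2) * c,
     p.c0 * q.c3 + p.c3 * q.c0 - p.c1 * q.c1 * t - p.c3 * q.c3 * c
      - (p.c1 * q.c2 + p.c2 * q.c1) * b - (p.c1 * q.c3 + p.c3 * q.c1) * r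
      + (p.c2 * q.c3 + p.c3 * q.c2) * t⟩⟩

@[simp] lemma zero_c0 : (0 : Q4 P r d b c t).c0 = 0 := rfl
@[simp] lemma zero_c1 : (0 : Q4 P r d b c t).c1 = 0 := rfl
@[simp] lemma zero_c2 : (0 : Q4 P r d b c t).c2 = 0 := rfl
@[simp] lemma zero_c3 : (0 : Q4 P r d b c t).c3 = 0 := rfl
@[simp] lemma one_c0 : (1 : Q4 P r d b c t).c0 = 1 := rfl
@[simp] lemma one_c1 : (1 : Q4 P r d b c t).c1 = 0 := rfl
@[simp] lemma one_c2 : (1 : Q4 P r d b c t).c2 = 0 := rfl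
@[simp] lemma one_c3 : (1 : Q4 P r d b c t).c3 = 0 := rfl
@[simp] lemma add_c0 (p q : Q4 P r d b c t) : (p + q).c0 = p.c0 + q.c0 := rfl
@[simp] lemma add_c1 (p q : Q4 P r d b c t) : (p + q).c1 = p.c1 + q.c1 := rfl
@[simp] lemma add_c2 (p q : Q4 P r d b c t) : (p + q).c2 = p.c2 + q.c2 := rfl
@[simp] lemma add_c3 (p q : Q4 P r d b c t) : (p + q).c3 = p.c3 + q.c3 := rfl
@[simp] lemma neg_c0 (p : Q4 P r d b c t) : (-p).c0 = -p.c0 := rfl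
@[simp] lemma neg_c1 (p : Q4 P r d b c t) : (-p).c1 = -p.c1 := rfl
@[simp] lemma neg_c2 (p : Q4 P r d b c t) : (-p).c2 = -p.c2 := rfl
@[simp] lemma neg_c3 (p : Q4 P r d b c t) : (-p).c3 = -p.c3 := rfl
@[simp] lemma mul_c0 (p q : Q4 P r d b c t) : (p * q).c0 =
    p.c0 * q.c0 + p.c1 * q.c1 * (r ^ 2 - t * c + b * d) + p.c2 * q.c2 * (b * r)
      + p.c3 * q.c3 * (-d * r) + (p.c1 * q.c2 + p.c2 * q.c1) * (-t * r)
      + (p.c1 * q.c3 + p.c3 * q.c1) * (-c * r)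
      + (p.c2 * q.c3 + p.c3 * q.c2) * (t * c - b * d) := rfl
@[simp] lemma mul_c1 (p q : Q4 P r d b c t) : (p * q).c1 =
    p.c0 * q.c1 + p.c1 * q.c0 + p.c2 * q.c2 * b + p.c3 * q.c3 * d
      + (p.c1 * q.c2 + p.c2 * q.c1) * t - (p.c1 * q.c3 + p.c3 * q.c1) * c := rfl
@[simp] lemma mul_c2 (p q : Q4 P r d b c t) : (p * q).c2 =
    p.c0 * q.c2 + p.c2 * q.c0 + p.c1 * q.c1 * c + p.c2 * q.c2 * t
      + (p.c1 * q.c2 + p.c2 * q.c1) * r - (p.c1 * q.c3 + p.c3 * q.c1) * d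
      - (p.c2 * q.c3 + p.c3 * q.c2) * c := rfl
@[simp] lemma mul_c3 (p q : Q4 P r d b c t) : (p * q).c3 =
    p.c0 * q.c3 + p.c3 * q.c0 - p.c1 * q.c1 * t - p.c3 * q.c3 * c
      - (p.c1 * q.c2 + p.c2 * q.c1) * b - (p.c1 * q.c3 + p.c3 * q.c1) * r
      + (p.c2 * q.c3 + p.c3 * q.c2) * t := rfl

instance : CommRing (Q4 P r d b c t) where
  add_assoc p q s := by ext <;> simp <;> ring
  zero_add p := by ext <;> simp
  add_zero p := by ext <;> simp
  add_comm p q := by ext <;> simp <;> ring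
  neg_add_cancel p := by ext <;> simp
  mul_assoc p q s := by ext <;> simp <;> ring
  one_mul p := by ext <;> simp
  mul_one p := by ext <;> simp
  mul_comm p q := by ext <;> simp <;> ring
  left_distrib p q s := by ext <;> simp <;> ring
  right_distrib p q s := by ext <;> simp <;> ring
  zero_mul p := by ext <;> simp
  mul_zero p := by ext <;> simp
  nsmul := nsmulRec
  zsmul := zsmulRec

@[simp] lemma sub_c0 (p q : Q4 P r d b c t) : (p - q).c0 = p.c0 - q.c0 := by
  rw [sub_eq_add_neg, sub_eq_add_neg]; rfl
@[simp] lemma sub_c1 (p q : Q4 P r d b c t) : (p - q).c1 = p.c1 - q.c1 := by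
  rw [sub_eq_add_neg, sub_eq_add_neg]; rfl
@[simp] lemma sub_c2 (p q : Q4 P r d b c t) : (p - q).c2 = p.c2 - q.c2 := by
  rw [sub_eq_add_neg, sub_eq_add_neg]; rfl
@[simp] lemma sub_c3 (p q : Q4 P r d b c t) : (p - q).c3 = p.c3 - q.c3 := by
  rw [sub_eq_add_neg, sub_eq_add_neg]; rfl

/-- The inclusion of the base ring. -/
def incl : P →+* Q4 P r d b c t where
  toFun p := ⟨p, 0, 0, 0⟩
  map_one' := rfl
  map_zero' := rfl
  map_add' p q := by ext <;> simp
  map_mul' p q := by ext <;> simp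

instance : Algebra P (Q4 P r d b c t) := incl.toAlgebra

lemma algebraMap_eq (p : P) : algebraMap P (Q4 P r d b c t) p = ⟨p, 0, 0, 0⟩ := rfl

/-- The underlying module is free of rank four. -/
def equivProd : (P × P × P × P) ≃ₗ[P] Q4 P r d b c t where
  toFun v := ⟨v.1, v.2.1, v.2.2.1, v.2.2.2⟩
  invFun p := (p.c0, p.c1, p.c2, p.c3)
  left_inv _ := rfl
  right_inv _ := rfl
  map_add' _ _ := rfl
  map_smul' p v := by
    rw [Algebra.smul_def (A := Q4 P r d b c t), algebraMap_eq]
    ext <;> simp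

instance : Module.Free P (Q4 P r d b c t) := Module.Free.of_equiv equivProd

/-- Universal property of the rank four algebra. -/
def lift {S : Type*} [CommRing S] (φ : P →+* S) (x y z : S)
    (hxy : x * y = φ t * x - φ b * z + φ r * y - φ t * φ r)
    (hyy : y * y = φ t * y + φ b * x + φ b * φ r)
    (hxz : x * z = - φ c * x - φ d * y - φ r * z - φ c * φ r)
    (hzz : z * z = - φ c * z + φ d * x - φ d * φ r)
    (hyz : y * z = φ t * z - φ c * y + φ t * φ c - φ b * φ d)
    (hxx : x * x = φ r ^ 2 - y * z) : Q4 P r d b c t →+* S where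
  toFun p := φ p.c0 + φ p.c1 * x + φ p.c2 * y + φ p.c3 * z
  map_one' := by simp
  map_zero' := by simp
  map_add' p q := by simp; ring
  map_mul' p q := by
    simp only [mul_c0, mul_c1, mul_c2, mul_c3, map_add, map_sub, map_mul, map_neg, map_pow]
    linear_combination (-φ p.c1 * φ q.c1) * hxx - (φ p.c2 * φ q.c2) * hyy
      - (φ p.c3 * φ q.c3) * hzz - (φ p.c1 * φ q.c2 + φ p.c2 * φ q.c1) * hxy
      - (φ p.c1 * φ q.c3 + φ p.c3 * φ q.c1) * hxz
      - (φ p.c2 * φ q.c3 + φ p.c3 * φ q.c2 - φ p.c1 * φ q.c1) * hyz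

end Q4

/-- The variables of a polynomial ring form a weakly regular sequence. -/
lemma weaklyRegular_X (k : Type*) [Field k] :
    RingTheory.Sequence.IsWeaklyRegular (MvPolynomial (Fin 5) k)
      [(X 0 : MvPolynomial (Fin 5) k), X 1, X 2, X 3, X 4] := by
  have key : ∀ (s : Set (Fin 5)) (i : Fin 5), i ∉ s → ∀ I : Ideal (MvPolynomial (Fin 5) k),
      I = Ideal.span (X '' s) → 
      IsSMulRegular (MvPolynomial (Fin 5) k ⧸ (I • ⊤ : Submodule (MvPolynomial (Fin 5) k)
        (MvPolynomial (Fin 5) k))) (X i : MvPolynomial (Fin 5) k) := by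
    intro s i hi I hI
    rw [isSMulRegular_iff_right_eq_zero_of_smul]
    intro a ha
    obtain ⟨f, rfl⟩ := Submodule.Quotient.mk_surjective _ a
    rw [← Submodule.Quotient.mk_smul, Submodule.Quotient.mk_eq_zero, smul_eq_mul,
      smul_eq_mul, Ideal.mul_top, hI, mem_ideal_span_X_image] at ha
    rw [Submodule.Quotient.mk_eq_zero, smul_eq_mul, Ideal.mul_top, hI, mem_ideal_span_X_image]
    intro m hm
    obtain ⟨j, hj, hne⟩ := ha (Finsupp.single i 1 + m) (by
      rw [mem_support_iff, coeff_X_mul]; exact mem_support_iff.mp hm)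
    refine ⟨j, hj, ?_⟩
    have : i ≠ j := fun h => hi (h ▸ hj)
    simpa [Finsupp.single_apply, this] using hne
  refine ⟨fun i hi => ?_⟩
  simp only [List.length_cons, List.length_nil] at hi
  interval_cases i
  · exact key ∅ 0 (by simp) _ (by simp)
  · exact key {0} 1 (by simp) _ (by simp)
  · exact key {0, 1} 2 (by simp) _ (by simp [Set.image_insert_eq, Ideal.span_insert])
  · exact key {0, 1, 2} 3 (by simp) _ (by simp [Set.image_insert_eq, Ideal.span_insert])
  · exact key {0, 1, 2, 3} 4 (by simp) _ (by simp [Set.image_insert_eq, Ideal.span_insert])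

/-- The rank four algebra over the polynomial ring in `R, D, B, C - Z, Y - A`. -/
abbrev QQ (k : Type*) [Field k] : Type _ :=
  Q4 (MvPolynomial (Fin 5) k) (X 0) (X 1) (X 2) (X 3) (X 4)

/-- The evaluation of the eight variables in the rank four algebra. -/
noncomputable def toQ0 (k : Type*) [Field k] : MvPolynomial (Fin 8) k →+* QQ k :=
  eval₂Hom (Q4.incl.comp C)
    ![⟨-X 4, 0, 1, 0⟩, ⟨X 2, 0, 0, 0⟩, ⟨X 3, 0, 0, 1⟩, ⟨X 1, 0, 0, 0⟩, ⟨X 0, 0, 0, 0⟩,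
      ⟨0, 1, 0, 0⟩, ⟨0, 0, 1, 0⟩, ⟨0, 0, 0, 1⟩]

lemma toQ0_ker (k : Type*) [Field k] : ∀ a ∈ idealR121 k, toQ0 k a = 0 := by
  have : idealR121 k ≤ RingHom.ker (toQ0 k) := by
    rw [idealR121, Ideal.span_le]
    rintro a (rfl | rfl | rfl | rfl | rfl | rfl) <;>
    · simp only [SetLike.mem_coe, RingHom.mem_ker, map_add, map_sub, map_mul, map_pow, pow_two,
        toQ0, coe_eval₂Hom, eval₂_X]
      ext1 <;> simp <;> try ring
  exact this

/-- The map from `R̃` to the rank four algebra. -/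
noncomputable def toQ (k : Type*) [Field k] : RTilde121 k →+* QQ k :=
  Ideal.Quotient.lift (idealR121 k) (toQ0 k) (toQ0_ker k)

lemma rels (k : Type*) [Field k] :
    let m := Ideal.Quotient.mk (idealR121 k)
    m (X 5) * m (X 0) + m (X 7) * m (X 1) - m (X 0) * m (X 4) = 0 ∧
    m (X 6) * m (X 0) - m (X 5) * m (X 1) - m (X 1) * m (X 4) = 0 ∧
    m (X 5) * m (X 2) + m (X 6) * m (X 3) + m (X 2) * m (X 4) = 0 ∧
    m (X 7) * m (X 2) - m (X 5) * m (X 3) + m (X 3) * m (X 4) = 0 ∧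
    m (X 5) ^ 2 + m (X 6) * m (X 7) - m (X 4) ^ 2 = 0 ∧
    m (X 0) * m (X 2) + m (X 1) * m (X 3) = 0 := by
  intro m
  simp only [m, ← map_mul, ← map_add, ← map_sub, ← map_pow, Ideal.Quotient.eq_zero_iff_mem]
  refine ⟨?_, ?_, ?_, ?_, ?_, ?_⟩ <;> exact Ideal.subset_span (by simp)

/-- The structure map from the polynomial ring in `R, D, B, C - Z, Y - A`. -/
noncomputable def phi (k : Type*) [Field k] : MvPolynomial (Fin 5) k →+* RTilde121 k :=
  eval₂Hom ((Ideal.Quotient.mk (idealR121 k)).comp C)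
    ![Ideal.Quotient.mk (idealR121 k) (X 4), Ideal.Quotient.mk (idealR121 k) (X 3),
        Ideal.Quotient.mk (idealR121 k) (X 1),
        Ideal.Quotient.mk (idealR121 k) (X 2 - X 7),
        Ideal.Quotient.mk (idealR121 k) (X 6 - X 0)]

/-- The inverse map from the rank four algebra. -/
noncomputable def fromQ (k : Type*) [Field k] : QQ k →+* RTilde121 k := by
  refine Q4.lift (phi k) (Ideal.Quotient.mk (idealR121 k) (X 5))
    (Ideal.Quotient.mk (idealR121 k) (X 6)) (Ideal.Quotient.mk (idealR121 k) (X 7))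
    ?_ ?_ ?_ ?_ ?_ ?_ <;>
  obtain ⟨h1, h2, h3, h4, h5, h6⟩ := rels k <;>
  simp [phi]
  · linear_combination h1
  · linear_combination h2
  · linear_combination h3
  · linear_combination h4
  · linear_combination h6
  · linear_combination h5

lemma fromQ_toQ (k : Type*) [Field k] (s : RTilde121 k) : fromQ k (toQ k s) = s := by
  have : (fromQ k).comp (toQ k) = RingHom.id _ := by
    apply Ideal.Quotient.ringHom_ext
    apply MvPolynomial.ringHom_ext
    · intro a
      simp [toQ, toQ0, fromQ, Q4.lift, Q4.incl, phi]
    · intro i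
      fin_cases i <;> simp [toQ, toQ0, fromQ, Q4.lift, phi]
  exact congrArg (fun f => f s) this

lemma toQ_phi (k : Type*) [Field k] (p : MvPolynomial (Fin 5) k) :
    toQ k (phi k p) = algebraMap _ _ p := by
  have : (toQ k).comp (phi k) = algebraMap _ _ := by
    apply MvPolynomial.ringHom_ext
    · intro a
      simp [toQ, toQ0, phi, Q4.algebraMap_eq, Q4.incl]
    · intro i
      fin_cases i <;> simp [toQ, toQ0, phi, Q4.algebraMap_eq] <;> ext1 <;> simp
  exact congrArg (fun f => f p) this

lemma toQ_fromQ (k : Type*) [Field k] (q : QQ k) : toQ k (fromQ k q) = q := by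
  simp only [fromQ, Q4.lift, RingHom.coe_mk, MonoidHom.coe_mk, OneHom.coe_mk, map_add, map_mul,
    toQ_phi]
  simp only [toQ, toQ0, Ideal.Quotient.lift_mk, coe_eval₂Hom, eval₂_X, Q4.algebraMap_eq]
  ext1 <;> simp

/-- `R̃` is isomorphic to the rank four algebra. -/
noncomputable def eqvQ (k : Type*) [Field k] : QQ k ≃+* RTilde121 k :=
  { fromQ k with
    invFun := toQ k
    left_inv := toQ_fromQ k
    right_inv := fromQ_toQ k }

lemma eqvQ_apply (k : Type*) [Field k] (q : QQ k) : eqvQ k q = fromQ k q := rfl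

lemma fromQ_algebraMap (k : Type*) [Field k] (p : MvPolynomial (Fin 5) k) :
    fromQ k (algebraMap _ _ p) = phi k p := by
  rw [← toQ_phi, fromQ_toQ]

lemma weaklyRegular_RTilde (k : Type*) [Field k] :
    RingTheory.Sequence.IsWeaklyRegular (RTilde121 k)
      [Ideal.Quotient.mk (idealR121 k) (X 4), Ideal.Quotient.mk (idealR121 k) (X 3),
        Ideal.Quotient.mk (idealR121 k) (X 1),
        Ideal.Quotient.mk (idealR121 k) (X 2 - X 7),
        Ideal.Quotient.mk (idealR121 k) (X 6 - X 0)] := by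
  have h := (weaklyRegular_X k).of_flat (S := QQ k)
  refine (AddEquiv.isWeaklyRegular_congr (e := (eqvQ k).toAddEquiv) ?_).mp h
  simp only [List.map_cons, List.map_nil]
  refine .cons ?_ (.cons ?_ (.cons ?_ (.cons ?_ (.cons ?_ .nil)))) <;>
  · intro x
    change fromQ k (_ * x) = _ * fromQ k x
    rw [map_mul, fromQ_algebraMap]
    simp [phi]

/-- Killing the sequence gives the augmentation: all variables can be sent to zero. -/
lemma ne_top_RTilde (k : Type*) [Field k] :
    (⊤ : Submodule (RTilde121 k) (RTilde121 k)) ≠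
      Ideal.ofList [Ideal.Quotient.mk (idealR121 k) (X 4), Ideal.Quotient.mk (idealR121 k) (X 3),
        Ideal.Quotient.mk (idealR121 k) (X 1),
        Ideal.Quotient.mk (idealR121 k) (X 2 - X 7),
        Ideal.Quotient.mk (idealR121 k) (X 6 - X 0)] • ⊤ := by
  have h0 : ∀ a ∈ idealR121 k, constantCoeff a = 0 := by
    have : idealR121 k ≤ RingHom.ker constantCoeff := by
      rw [idealR121, Ideal.span_le]
      rintro a (rfl | rfl | rfl | rfl | rfl | rfl) <;> simp
    exact this
  let f : RTilde121 k →+* k := Ideal.Quotient.lift _ constantCoeff h0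
  intro h
  rw [smul_eq_mul, Ideal.mul_top] at h
  have hle : Ideal.ofList [Ideal.Quotient.mk (idealR121 k) (X 4),
        Ideal.Quotient.mk (idealR121 k) (X 3),
        Ideal.Quotient.mk (idealR121 k) (X 1),
        Ideal.Quotient.mk (idealR121 k) (X 2 - X 7),
        Ideal.Quotient.mk (idealR121 k) (X 6 - X 0)] ≤ RingHom.ker f := by
    rw [Ideal.ofList, Ideal.span_le]
    intro a ha
    simp only [List.mem_cons, List.not_mem_nil, or_false, Set.mem_ofPred_eq] at ha
    rcases ha with (rfl | rfl | rfl | rfl | rfl) <;>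
      simp only [SetLike.mem_coe, RingHom.mem_ker, f, Ideal.Quotient.lift_mk] <;> simp
  rw [← h] at hle
  have h1 : (1 : RTilde121 k) ∈ RingHom.ker f := hle trivial
  rw [RingHom.mem_ker, map_one] at h1
  exact one_ne_zero h1

/-- The square of the maximal ideal in three variables. -/
noncomputable abbrev idealM2 (k : Type*) [Field k] : Ideal (MvPolynomial (Fin 3) k) :=
  Ideal.span ({X 0 ^ 2, X 1 ^ 2, X 2 ^ 2, X 0 * X 1, X 0 * X 2, X 1 * X 2} :
            Set (MvPolynomial (Fin 3) k))

/-- The ideal generated by the sequence. -/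
noncomputable abbrev idealSeq (k : Type*) [Field k] : Ideal (RTilde121 k) :=
  Ideal.span
          ({Ideal.Quotient.mk (idealR121 k) (X 4), Ideal.Quotient.mk (idealR121 k) (X 3),
            Ideal.Quotient.mk (idealR121 k) (X 1),
            Ideal.Quotient.mk (idealR121 k) (X 2 - X 7),
            Ideal.Quotient.mk (idealR121 k) (X 6 - X 0)} : Set (RTilde121 k))

lemma relsM2 (k : Type*) [Field k] :
    let m := Ideal.Quotient.mk (idealM2 k)
    m (X 0) ^ 2 = 0 ∧ m (X 1) ^ 2 = 0 ∧ m (X 2) ^ 2 = 0 ∧ m (X 0) * m (X 1) = 0 ∧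
    m (X 0) * m (X 2) = 0 ∧ m (X 1) * m (X 2) = 0 := by
  intro m
  simp only [m, ← map_mul, ← map_pow, Ideal.Quotient.eq_zero_iff_mem]
  refine ⟨?_, ?_, ?_, ?_, ?_, ?_⟩ <;> exact Ideal.subset_span (by simp)

/-- Forward map on polynomials. -/
noncomputable def fwd0 (k : Type*) [Field k] :
    MvPolynomial (Fin 8) k →ₐ[k] (MvPolynomial (Fin 3) k ⧸ idealM2 k) :=
  aeval ![Ideal.Quotient.mk (idealM2 k) (X 1), 0, Ideal.Quotient.mk (idealM2 k) (X 2), 0, 0,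
    Ideal.Quotient.mk (idealM2 k) (X 0), Ideal.Quotient.mk (idealM2 k) (X 1),
    Ideal.Quotient.mk (idealM2 k) (X 2)]

lemma fwd0_ker (k : Type*) [Field k] : ∀ a ∈ idealR121 k, fwd0 k a = 0 := by
  have : idealR121 k ≤ RingHom.ker (fwd0 k) := by
    obtain ⟨h1, h2, h3, h4, h5, h6⟩ := relsM2 k
    rw [idealR121, Ideal.span_le]
    rintro a (rfl | rfl | rfl | rfl | rfl | rfl) <;>
      simp only [SetLike.mem_coe, RingHom.mem_ker, map_add, map_sub, map_mul, map_pow,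
        fwd0, aeval_X] <;> simp [-map_mul, -map_pow]
    · linear_combination h4
    · linear_combination h2
    · linear_combination h5
    · linear_combination h3
    · linear_combination h1 + h6
    · linear_combination h6
  exact this

/-- Forward map on `R̃`. -/
noncomputable def fwd1 (k : Type*) [Field k] :
    RTilde121 k →ₐ[k] (MvPolynomial (Fin 3) k ⧸ idealM2 k) :=
  Ideal.Quotient.liftₐ _ (fwd0 k) (fwd0_ker k)

lemma fwd1_mk (k : Type*) [Field k] (p : MvPolynomial (Fin 8) k) :
    fwd1 k (Ideal.Quotient.mk _ p) = fwd0 k p := rfl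

lemma fwd1_ker (k : Type*) [Field k] : ∀ a ∈ idealSeq k, fwd1 k a = 0 := by
  have : idealSeq k ≤ RingHom.ker (fwd1 k) := by
    rw [idealSeq, Ideal.span_le]
    rintro a (rfl | rfl | rfl | rfl | rfl) <;>
      simp only [SetLike.mem_coe, RingHom.mem_ker, fwd1_mk] <;> simp [fwd0]
  exact this

/-- Forward map. -/
noncomputable def fwd (k : Type*) [Field k] :
    (RTilde121 k ⧸ idealSeq k) →ₐ[k] (MvPolynomial (Fin 3) k ⧸ idealM2 k) :=
  Ideal.Quotient.liftₐ _ (fwd1 k) (fwd1_ker k)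

lemma fwd_mk (k : Type*) [Field k] (p : MvPolynomial (Fin 8) k) :
    fwd k (Ideal.Quotient.mk _ (Ideal.Quotient.mk _ p)) = fwd0 k p := rfl

/-- The double quotient map. -/
noncomputable def mm (k : Type*) [Field k] :
    MvPolynomial (Fin 8) k →ₐ[k] (RTilde121 k ⧸ idealSeq k) :=
  (Ideal.Quotient.mkₐ k (idealSeq k)).comp (Ideal.Quotient.mkₐ k (idealR121 k))

lemma mm_eq (k : Type*) [Field k] (p : MvPolynomial (Fin 8) k) :
    mm k p = Ideal.Quotient.mk _ (Ideal.Quotient.mk _ p) := rfl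

lemma mm_surj (k : Type*) [Field k] : Function.Surjective (mm k) :=
  Ideal.Quotient.mk_surjective.comp Ideal.Quotient.mk_surjective

lemma mm_rels (k : Type*) [Field k] :
    mm k (X 4) = 0 ∧ mm k (X 3) = 0 ∧ mm k (X 1) = 0 ∧ mm k (X 2) = mm k (X 7) ∧
    mm k (X 6) = mm k (X 0) := by
  rw [← sub_eq_zero (a := mm k (X 2)), ← sub_eq_zero (a := mm k (X 6)), ← map_sub, ← map_sub]
  simp only [mm_eq]
  refine ⟨?_, ?_, ?_, ?_, ?_⟩ <;>
    exact Ideal.Quotient.eq_zero_iff_mem.mpr (Ideal.subset_span (by simp))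

lemma mm_rels2 (k : Type*) [Field k] :
    mm k (X 5) ^ 2 = 0 ∧ mm k (X 6) ^ 2 = 0 ∧ mm k (X 7) ^ 2 = 0 ∧
    mm k (X 5) * mm k (X 6) = 0 ∧ mm k (X 5) * mm k (X 7) = 0 ∧
    mm k (X 6) * mm k (X 7) = 0 := by
  obtain ⟨h1, h2, h3, h4, h5, h6⟩ := rels k
  obtain ⟨g1, g2, g3, g4, g5⟩ := mm_rels k
  apply_fun Ideal.Quotient.mk (idealSeq k) at h1 h2 h3 h4 h5 h6
  simp only [map_add, map_sub, map_mul, map_pow, map_zero, ← mm_eq, g1, g2, g3, g4, ← g5]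
    at h1 h2 h3 h4 h5 h6
  refine ⟨?_, ?_, ?_, ?_, ?_, ?_⟩
  · linear_combination h5 - h6
  · linear_combination h2
  · linear_combination h4
  · linear_combination h1
  · linear_combination h3
  · linear_combination h6

/-- Backward map on polynomials. -/
noncomputable def bwd0 (k : Type*) [Field k] :
    MvPolynomial (Fin 3) k →ₐ[k] (RTilde121 k ⧸ idealSeq k) :=
  aeval ![mm k (X 5), mm k (X 6), mm k (X 7)]

lemma bwd0_ker (k : Type*) [Field k] : ∀ a ∈ idealM2 k, bwd0 k a = 0 := by
  have : idealM2 k ≤ RingHom.ker (bwd0 k) := by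
    obtain ⟨h1, h2, h3, h4, h5, h6⟩ := mm_rels2 k
    rw [idealM2, Ideal.span_le]
    rintro a (rfl | rfl | rfl | rfl | rfl | rfl) <;>
      simp [bwd0, h1, h2, h3, h4, h5, h6]
  exact this

/-- Backward map. -/
noncomputable def bwd (k : Type*) [Field k] :
    (MvPolynomial (Fin 3) k ⧸ idealM2 k) →ₐ[k] (RTilde121 k ⧸ idealSeq k) :=
  Ideal.Quotient.liftₐ _ (bwd0 k) (bwd0_ker k)

lemma bwd_mk (k : Type*) [Field k] (p : MvPolynomial (Fin 3) k) :
    bwd k (Ideal.Quotient.mk _ p) = bwd0 k p := rfl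

lemma fwd_bwd (k : Type*) [Field k] (q : MvPolynomial (Fin 3) k ⧸ idealM2 k) :
    fwd k (bwd k q) = q := by
  obtain ⟨p, rfl⟩ := Ideal.Quotient.mk_surjective q
  rw [bwd_mk]
  have : (fwd k).comp (bwd0 k) = Ideal.Quotient.mkₐ k (idealM2 k) := by
    apply MvPolynomial.algHom_ext
    intro i
    fin_cases i <;> simp [bwd0, mm_eq, fwd_mk, fwd0]
  exact congrArg (fun f => f p) this

lemma bwd_fwd (k : Type*) [Field k] (q : RTilde121 k ⧸ idealSeq k) :
    bwd k (fwd k q) = q := by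
  obtain ⟨p, rfl⟩ := mm_surj k q
  rw [mm_eq, fwd_mk, ← mm_eq]
  obtain ⟨g1, g2, g3, g4, g5⟩ := mm_rels k
  have : (bwd k).comp (fwd0 k) = mm k := by
    apply MvPolynomial.algHom_ext
    intro i
    fin_cases i <;> simp [bwd0, bwd_mk, fwd0, g1, g2, g3, g4, g5]
  exact congrArg (fun f => f p) this

/-- In `R̃^{1,2,1}_k`, the elements `R, D, B, C−Z, Y−A` form a regular sequence, with
quotient isomorphic to `k[X,Y,Z]/(X², Y², Z², XY, XZ, YZ)` (variables `X=0, Y=1, Z=2`). -/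
theorem rTilde121_regular_sequence (k : Type*) [Field k] :
    RingTheory.Sequence.IsRegular (RTilde121 k)
      [Ideal.Quotient.mk (idealR121 k) (X 4), Ideal.Quotient.mk (idealR121 k) (X 3),
        Ideal.Quotient.mk (idealR121 k) (X 1),
        Ideal.Quotient.mk (idealR121 k) (X 2 - X 7),
        Ideal.Quotient.mk (idealR121 k) (X 6 - X 0)] ∧
    Nonempty
      ((RTilde121 k ⧸ Ideal.span
          ({Ideal.Quotient.mk (idealR121 k) (X 4), Ideal.Quotient.mk (idealR121 k) (X 3),
            Ideal.Quotient.mk (idealR121 k) (X 1),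
            Ideal.Quotient.mk (idealR121 k) (X 2 - X 7),
            Ideal.Quotient.mk (idealR121 k) (X 6 - X 0)} : Set (RTilde121 k))) ≃ₐ[k]
        (MvPolynomial (Fin 3) k ⧸ Ideal.span
          ({X 0 ^ 2, X 1 ^ 2, X 2 ^ 2, X 0 * X 1, X 0 * X 2, X 1 * X 2} :
            Set (MvPolynomial (Fin 3) k)))) := by
  exact ⟨⟨weaklyRegular_RTilde k, ne_top_RTilde k⟩,
    ⟨AlgEquiv.ofAlgHom (fwd k) (bwd k) (AlgHom.ext (fwd_bwd k)) (AlgHom.ext (bwd_fwd k))⟩⟩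
end

section
/- Let k be a field of characteristic 0 or of characteristic at least 5. Then the ring R̃^{2,2}_k is a Noetherian integral domain of Krull dimension 7 which is integrally closed in its fraction field (i.e. a normal domain). -/
open MvPolynomial

set_option maxHeartbeats 1000000
set_option synthInstance.maxHeartbeats 400000

universe u

/-- The five Pluecker-type relations after the linear change `P = X - S`, `Q = X + S`. -/
structure PlRel {R : Type*} [CommRing R] (A B C D P Q Y Z T U : R) : Prop where
  h1 : P * A + Z * B = C * T
  h2 : Y * A - Q * B = D * T
  h3 : Z * D + Q * C = A * U
  h4 : P * D - Y * C + B * U = 0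
  h5 : P * Q + Y * Z = T * U

/-- `R` is the universal `k`-algebra on ten elements satisfying the relations. -/
structure IsPl (k : Type u) [Field k] (R : Type u) [CommRing R] [Algebra k R]
    (A B C D P Q Y Z T U : R) : Prop where
  rel : PlRel A B C D P Q Y Z T U
  gen : ∀ M : Subalgebra k R, A ∈ M → B ∈ M → C ∈ M → D ∈ M → P ∈ M → Q ∈ M → Y ∈ M → Z ∈ M →
    T ∈ M → U ∈ M → ∀ r, r ∈ M
  lift : ∀ (L : Type u) [CommRing L] [Algebra k L] (A' B' C' D' P' Q' Y' Z' T' U' : L),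
    PlRel A' B' C' D' P' Q' Y' Z' T' U' → ∃ f : R →ₐ[k] L, f A = A' ∧ f B = B' ∧ f C = C' ∧
      f D = D' ∧ f P = P' ∧ f Q = Q' ∧ f Y = Y' ∧ f Z = Z' ∧ f T = T' ∧ f U = U'

lemma IsPl.swap {k : Type u} [Field k] {R : Type u} [CommRing R] [Algebra k R]
    {A B C D P Q Y Z T U : R} (h : IsPl k R A B C D P Q Y Z T U) :
    IsPl k R T (-B) P Y C Q D Z A U := by
  obtain ⟨⟨h1, h2, h3, h4, h5⟩, gen, lift⟩ := h
  refine ⟨⟨?_, ?_, ?_, ?_, ?_⟩, ?_, ?_⟩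
  · linear_combination -h1
  · linear_combination -h2
  · linear_combination h5
  · linear_combination -h4
  · linear_combination h3
  · intro M hT hB hP hY hC hQ hD hZ hA hU
    exact gen M hA (by simpa using M.neg_mem hB) hC hD hP hQ hY hZ hT hU
  · intro L _ _ T' B' P' Y' C' Q' D' Z' A' U' ⟨g1, g2, g3, g4, g5⟩
    obtain ⟨f, hA, hB, hC, hD, hP, hQ, hY, hZ, hT, hU⟩ := lift L A' (-B') C' D' P' Q' Y' Z' T' U' ⟨by linear_combination -g1,
      by linear_combination -g2, by linear_combination g5, by linear_combination -g4,
      by linear_combination g3⟩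
    exact ⟨f, hT, by simp [hB], hP, hY, hC, hQ, hD, hZ, hA, hU⟩

/-- The polynomial ring in seven variables. -/
abbrev PlS (k : Type u) [Field k] : Type u := MvPolynomial (Fin 7) k

/-- The localization at `A` is a localized polynomial ring. -/
lemma IsPl.away {k : Type u} [Field k] {R : Type u} [CommRing R] [Algebra k R]
    {A B C D P Q Y Z T U : R} (h : IsPl k R A B C D P Q Y Z T U)
    (hA : ∀ r, A * r = 0 → r = 0) :
    ∃ (L : Type u) (_ : CommRing L) (_ : IsDomain L) (_ : IsIntegrallyClosed L) (ψ : R →+* L),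
      Function.Injective ψ ∧ ∀ l, ∃ n r, ψ A ^ n * l = ψ r := by
  obtain ⟨⟨h1, h2, h3, h4, h5⟩, gen, lift⟩ := h
  let a : PlS k := X 0
  let L := Localization.Away a
  have ha0 : a ≠ 0 := X_ne_zero 0
  have hM : Submonoid.powers a ≤ nonZeroDivisors (PlS k) :=
    powers_le_nonZeroDivisors_of_noZeroDivisors ha0
  have hdom : IsDomain L := IsLocalization.isDomain_localization hM
  have hic : IsIntegrallyClosed L := isIntegrallyClosed_of_isLocalization L (Submonoid.powers a) hM
  let i : (PlS k) → L := algebraMap (PlS k) L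
  obtain ⟨ai, hai⟩ : ∃ ai : L, i a * ai = 1 :=
    ⟨IsLocalization.Away.invSelf a, IsLocalization.Away.mul_invSelf a⟩
  let b := i (X 1)
  let c := i (X 2)
  let d := i (X 3)
  let q := i (X 4)
  let z := i (X 5)
  let t := i (X 6)
  obtain ⟨f, fA, fB, fC, fD, fP, fQ, fY, fZ, fT, fU⟩ := lift L (i a) b c d (ai * (c * t - z * b)) q
    (ai * (q * b + d * t)) z t (ai * (z * d + q * c)) ⟨by linear_combination (c * t - z * b) * hai,
      by linear_combination (q * b + d * t) * hai,
      by linear_combination (-z * d - q * c) * hai, by ring, by ring⟩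
  let ι : (PlS k) →ₐ[k] R := aeval ![A, B, C, D, Q, Z, T]
  have key : f.comp ι = IsScalarTower.toAlgHom k (PlS k) L := by
    apply MvPolynomial.algHom_ext
    intro j
    rw [AlgHom.comp_apply, aeval_X, IsScalarTower.toAlgHom_apply]
    fin_cases j
    exacts [fA, fB, fC, fD, fQ, fZ, fT]
  have key' : ∀ p, f (ι p) = algebraMap (PlS k) L p := fun p => DFunLike.congr_fun key p
  have ιa : ι a = A := by simp [ι, a]
  have powA : ∀ n r, A ^ n * r = 0 → r = 0 := by
    intro n
    induction n with
    | zero => intro r; simp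
    | succ n ih => intro r hr; exact hA _ (ih _ (by rw [← hr]; ring))
  have frac : ∀ r : R, ∃ n p, A ^ n * r = ι p := by
    let M : Subalgebra k R :=
      { carrier := {r | ∃ n p, A ^ n * r = ι p}
        mul_mem' := by
          rintro r s ⟨n, p, hp⟩ ⟨m, p', hp'⟩
          exact ⟨n + m, p * p', by rw [map_mul, ← hp, ← hp']; ring⟩
        add_mem' := by
          rintro r s ⟨n, p, hp⟩ ⟨m, p', hp'⟩
          exact ⟨n + m, a ^ m * p + a ^ n * p', by
            rw [map_add, map_mul, map_mul, map_pow, map_pow, ιa, ← hp, ← hp']; ring⟩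
        algebraMap_mem' := fun r => ⟨0, MvPolynomial.C r, by simp [ι]⟩ }
    refine gen M ⟨0, X 0, ?_⟩ ⟨0, X 1, ?_⟩ ⟨0, X 2, ?_⟩ ⟨0, X 3, ?_⟩
      ⟨1, X 2 * X 6 - X 5 * X 1, ?_⟩ ⟨0, X 4, ?_⟩ ⟨1, X 4 * X 1 + X 3 * X 6, ?_⟩ ⟨0, X 5, ?_⟩
      ⟨0, X 6, ?_⟩ ⟨1, X 5 * X 3 + X 4 * X 2, ?_⟩
    all_goals simp [ι]
    · linear_combination h1
    · linear_combination h2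
    · linear_combination -h3
  refine ⟨L, inferInstance, hdom, hic, f.toRingHom, ?_, ?_⟩
  · rw [injective_iff_map_eq_zero]
    intro r hr
    obtain ⟨n, p, hp⟩ := frac r
    have hr' : f r = 0 := hr
    have h0 : algebraMap (PlS k) L p = 0 := by rw [← key', ← hp, map_mul, hr', mul_zero]
    have hp0 : p = 0 := IsLocalization.injective L hM (by rw [h0, map_zero])
    exact powA n r (by rw [hp, hp0, map_zero])
  · intro l
    obtain ⟨⟨p, ⟨_, n, rfl⟩⟩, hl⟩ := IsLocalization.surj (Submonoid.powers a) l
    refine ⟨n, ι p, ?_⟩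
    change f A ^ n * l = f (ι p)
    rw [key', ← hl, fA, mul_comm]
    simp [i]

lemma away_integral {R : Type u} [CommRing R] [IsDomain R] {A : R} (K : Type u) [Field K]
    [Algebra R K] [IsFractionRing R K]
    (h : ∃ (L : Type u) (_ : CommRing L) (_ : IsDomain L) (_ : IsIntegrallyClosed L) (ψ : R →+* L),
      Function.Injective ψ ∧ ∀ l, ∃ n r, ψ A ^ n * l = ψ r) (x : K) (hx : IsIntegral R x) :
    ∃ n r, algebraMap R K A ^ n * x = algebraMap R K r := by
  obtain ⟨L, _, _, _, ψ, inj, hl⟩ := h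
  let F := FractionRing L
  let g : R →+* F := (algebraMap L F).comp ψ
  have hg : Function.Injective g := (IsFractionRing.injective L F).comp inj
  let φ : K →+* F := IsFractionRing.lift hg
  have hφ : ∀ r, φ (algebraMap R K r) = algebraMap L F (ψ r) := fun r =>
    IsFractionRing.lift_algebraMap hg r
  have hint : IsIntegral L (φ x) := by
    obtain ⟨p, pm, hp⟩ := hx
    refine ⟨p.map ψ, pm.map ψ, ?_⟩
    rw [Polynomial.eval₂_map]
    have : (algebraMap L F).comp ψ = φ.comp (algebraMap R K) := by
      ext r; exact (hφ r).symm
    rw [this, ← Polynomial.hom_eval₂, hp, map_zero]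
  obtain ⟨l, hl'⟩ := IsIntegrallyClosed.isIntegral_iff.mp hint
  obtain ⟨n, r, hr⟩ := hl l
  refine ⟨n, r, φ.injective ?_⟩
  rw [map_mul, map_pow, hφ, hφ, ← hl', ← hr, map_mul, map_pow]

lemma dim_eq {S R : Type*} [CommRing S] [CommRing R] [Algebra S R] [Algebra.IsIntegral S R]
    (hinj : Function.Injective (algebraMap S R)) : ringKrullDim R = ringKrullDim S := by
  apply le_antisymm
  · refine Order.krullDim_le_of_strictMono (PrimeSpectrum.comap (algebraMap S R)) ?_
    intro I J hIJ
    exact Ideal.IsIntegral.comap_lt_comap (R := S) (I := I.asIdeal) (J := J.asIdeal) hIJ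
  · refine iSup_le fun l => ?_
    have : FaithfulSMul S R := (faithfulSMul_iff_algebraMap_injective S R).mpr hinj
    obtain ⟨Q, hQ, hQl⟩ := Ideal.exists_ideal_over_prime_of_isIntegral (S := R) l.head.asIdeal ⊥
      (by
        rw [← RingHom.ker_eq_comap_bot, (RingHom.injective_iff_ker_eq_bot _).mp hinj]
        exact bot_le)
    have : Q.LiesOver l.head.asIdeal := ⟨hQl.2.symm⟩
    have := hQl.1
    obtain ⟨L, hL, -⟩ := Ideal.exists_ltSeries_of_hasGoingUp (S := R) l Q
    rw [← hL]
    exact le_iSup (fun p : LTSeries (PrimeSpectrum R) => (p.length : WithBot ℕ∞)) L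

section mats
variable {S : Type*} [CommRing S] (a t y u e f g : S)

/-- Multiplication by `x = B` in the basis `1, x, w, z, xz`. -/
def plMx : Matrix (Fin 5) (Fin 5) S :=
  !![0, -a * g, y * a, 0, t ^ 2 * u - t * y * e - t * f * g;
     1, -e, -f, 0, -t * y + a * u;
     0, t, 0, 0, -t * g - a * y;
     0, -a, -t, 0, -t * f;
     0, 0, 0, 1, -e]

/-- Multiplication by `w = C`. -/
def plMw : Matrix (Fin 5) (Fin 5) S :=
  !![0, y * a, a * u, t * u - y * e - f * g, 0;
     0, -f, 0, -y, t * u;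
     1, 0, -f, -g, -t * y;
     0, -t, -e, -f, y * a + t * g;
     0, 0, -1, 0, -f]

/-- Multiplication by `z = D`. -/
def plMz : Matrix (Fin 5) (Fin 5) S :=
  !![0, 0, t * u - y * e - f * g, 0, y ^ 2 * a + u * a * g;
     0, 0, -y, -u, -y * f + u * e;
     0, 0, -g, y, -u * t;
     1, 0, -f, -g, -y * t + u * a;
     0, 1, 0, 0, -g]

lemma plM_xw : plMx a t y u e f g * plMw a t y u e f g = plMw a t y u e f g * plMx a t y u e f g := by
  ext i j
  fin_cases i <;> fin_cases j <;> simp [plMx, plMw, Matrix.mul_apply, Fin.sum_univ_five] <;> ring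

lemma plM_xz : plMx a t y u e f g * plMz a t y u e f g = plMz a t y u e f g * plMx a t y u e f g := by
  ext i j
  fin_cases i <;> fin_cases j <;> simp [plMx, plMz, Matrix.mul_apply, Fin.sum_univ_five] <;> ring

lemma plM_wz : plMw a t y u e f g * plMz a t y u e f g = plMz a t y u e f g * plMw a t y u e f g := by
  ext i j
  fin_cases i <;> fin_cases j <;> simp [plMw, plMz, Matrix.mul_apply, Fin.sum_univ_five] <;> ring

lemma plM_comm : ∀ p ∈ ({plMx a t y u e f g, plMw a t y u e f g, plMz a t y u e f g} :
      Set (Matrix (Fin 5) (Fin 5) S)),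
    ∀ q ∈ ({plMx a t y u e f g, plMw a t y u e f g, plMz a t y u e f g} :
      Set (Matrix (Fin 5) (Fin 5) S)), p * q = q * p := by
  rintro p (rfl | rfl | rfl) q (rfl | rfl | rfl)
  · rfl
  · exact plM_xw ..
  · exact plM_xz ..
  · exact (plM_xw ..).symm
  · rfl
  · exact plM_wz ..
  · exact (plM_xz ..).symm
  · exact (plM_wz ..).symm
  · rfl

/-- The commutative algebra generated by the three matrices. -/
def plAdj : Subalgebra S (Matrix (Fin 5) (Fin 5) S) :=
  Algebra.adjoin S {plMx a t y u e f g, plMw a t y u e f g, plMz a t y u e f g}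

instance : IsMulCommutative (plAdj a t y u e f g) :=
  Algebra.isMulCommutative_adjoin S (plM_comm a t y u e f g)

lemma pl_rel1 : (plMz a t y u e f g + algebraMap S _ g) * algebraMap S _ a +
    (plMx a t y u e f g + algebraMap S _ e) * plMx a t y u e f g =
    plMw a t y u e f g * algebraMap S _ t := by
  ext i j
  fin_cases i <;> fin_cases j <;> simp [plMx, plMw, plMz, Matrix.mul_apply, Fin.sum_univ_five,
    Matrix.algebraMap_matrix_apply] <;> ring

lemma pl_rel2 : algebraMap S _ y * algebraMap S _ a -
    (plMw a t y u e f g + algebraMap S _ f) * plMx a t y u e f g =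
    plMz a t y u e f g * algebraMap S _ t := by
  ext i j
  fin_cases i <;> fin_cases j <;> simp [plMx, plMw, plMz, Matrix.mul_apply, Fin.sum_univ_five,
    Matrix.algebraMap_matrix_apply] <;> ring

lemma pl_rel3 : (plMx a t y u e f g + algebraMap S _ e) * plMz a t y u e f g +
    (plMw a t y u e f g + algebraMap S _ f) * plMw a t y u e f g =
    algebraMap S _ a * algebraMap S _ u := by
  ext i j
  fin_cases i <;> fin_cases j <;> simp [plMx, plMw, plMz, Matrix.mul_apply, Fin.sum_univ_five,
    Matrix.algebraMap_matrix_apply] <;> ring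

lemma pl_rel4 : (plMz a t y u e f g + algebraMap S _ g) * plMz a t y u e f g -
    algebraMap S _ y * plMw a t y u e f g + plMx a t y u e f g * algebraMap S _ u = 0 := by
  rw [← Algebra.commutes u (plMx a t y u e f g)]
  ext i j
  fin_cases i <;> fin_cases j <;> simp [plMx, plMw, plMz, Matrix.mul_apply, Fin.sum_univ_five,
    Matrix.algebraMap_matrix_apply] <;> ring

lemma pl_rel5 : (plMz a t y u e f g + algebraMap S _ g) * (plMw a t y u e f g + algebraMap S _ f) +
    algebraMap S _ y * (plMx a t y u e f g + algebraMap S _ e) =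
    algebraMap S _ t * algebraMap S _ u := by
  ext i j
  fin_cases i <;> fin_cases j <;> simp [plMx, plMw, plMz, Matrix.mul_apply, Fin.sum_univ_five,
    Matrix.algebraMap_matrix_apply] <;> ring

/-- The three generators as elements of the algebra. -/
def plX : plAdj a t y u e f g := ⟨plMx a t y u e f g, Algebra.subset_adjoin (by simp)⟩
/-- The three generators as elements of the algebra. -/
def plW : plAdj a t y u e f g := ⟨plMw a t y u e f g, Algebra.subset_adjoin (by simp)⟩
/-- The three generators as elements of the algebra. -/
def plZ : plAdj a t y u e f g := ⟨plMz a t y u e f g, Algebra.subset_adjoin (by simp)⟩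

open scoped IsMulCommutative in
lemma plAdj_rel : PlRel (R := plAdj a t y u e f g) (algebraMap S _ a) (plX a t y u e f g)
    (plW a t y u e f g) (plZ a t y u e f g) (plZ a t y u e f g + algebraMap S _ g)
    (plW a t y u e f g + algebraMap S _ f) (algebraMap S _ y) (plX a t y u e f g + algebraMap S _ e)
    (algebraMap S _ t) (algebraMap S _ u) :=
  ⟨Subtype.ext (pl_rel1 ..), Subtype.ext (pl_rel2 ..), Subtype.ext (pl_rel3 ..),
    Subtype.ext (pl_rel4 ..), Subtype.ext (pl_rel5 ..)⟩

end mats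

open scoped IsMulCommutative in
lemma IsPl.free {k : Type u} [Field k] {R : Type u} [CommRing R] [Algebra k R]
    {A B C D P Q Y Z T U : R} (h : IsPl k R A B C D P Q Y Z T U) :
    ∃ (_ : Algebra (PlS k) R) (_ : Module.Basis (Fin 5) (PlS k) R),
      algebraMap (PlS k) R (X 0) = A ∧ algebraMap (PlS k) R (X 1) = T := by
  obtain ⟨⟨h1, h2, h3, h4, h5⟩, gen, lift⟩ := h
  let ι : PlS k →ₐ[k] R := aeval ![A, T, Y, U, Z - B, Q - C, P - D]
  let alg : Algebra (PlS k) R := ι.toRingHom.toAlgebra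
  have hι : ∀ p, algebraMap (PlS k) R p = ι p := fun p => rfl
  have hsm : ∀ (p : PlS k) (r : R), p • r = ι p * r := fun p r => Algebra.smul_def p r
  let v : Fin 5 → R := ![1, B, C, D, B * D]
  have i0 : ι (X 0) = A := aeval_X _ _
  have i1 : ι (X 1) = T := aeval_X _ _
  have i2 : ι (X 2) = Y := aeval_X _ _
  have i3 : ι (X 3) = U := aeval_X _ _
  have i4 : ι (X 4) = Z - B := aeval_X _ _
  have i5 : ι (X 5) = Q - C := aeval_X _ _
  have i6 : ι (X 6) = P - D := aeval_X _ _
  -- spanning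
  let N := Submodule.span (PlS k) (Set.range v)
  have memN : ∀ (c : Fin 5 → PlS k) (r : R),
      r = ι (c 0) + ι (c 1) * B + ι (c 2) * C + ι (c 3) * D + ι (c 4) * (B * D) → r ∈ N := by
    intro c r hr
    have : r = ∑ i, c i • v i := by simp [hsm, Fin.sum_univ_five, v, hr]
    rw [this]
    exact Submodule.sum_mem _ fun i _ => Submodule.smul_mem _ _ (Submodule.subset_span ⟨i, rfl⟩)
  have stab : ∀ m : R, (∀ i, m * v i ∈ N) → ∀ n ∈ N, m * n ∈ N := by
    intro m hm n hn
    induction hn using Submodule.span_induction with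
    | mem x hx => obtain ⟨i, rfl⟩ := hx; exact hm i
    | zero => rw [mul_zero]; exact N.zero_mem
    | add x y _ _ hx hy => rw [mul_add]; exact N.add_mem hx hy
    | smul c x _ hx => rw [mul_smul_comm]; exact N.smul_mem c hx
  let M : Subalgebra k R :=
    { carrier := {r | ∀ n ∈ N, r * n ∈ N}
      mul_mem' := fun {r s} hr hs n hn => by rw [mul_assoc]; exact hr _ (hs _ hn)
      add_mem' := fun {r s} hr hs n hn => by rw [add_mul]; exact N.add_mem (hr _ hn) (hs _ hn)
      algebraMap_mem' := fun c n hn => by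
        have : algebraMap k R c * n = (MvPolynomial.C c : PlS k) • n := by
          rw [hsm]; simp [ι]
        rw [this]; exact N.smul_mem _ hn }
  have ιM : ∀ p, ι p ∈ M := fun p n hn => by rw [← hsm]; exact N.smul_mem _ hn
  have hB : B ∈ M := by
    refine stab B fun i => ?_
    fin_cases i
    · exact memN ![0, 1, 0, 0, 0] _ (by simp [v])
    · refine memN ![-X 0 * X 6, -X 4, X 1, -X 0, 0] _ ?_
      simp [v, i0, i1, i2, i3, i4, i5, i6]
      linear_combination h1
    · refine memN ![X 2 * X 0, -X 5, 0, -X 1, 0] _ ?_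
      simp [v, i0, i1, i2, i3, i4, i5, i6]
      linear_combination -h2
    · exact memN ![0, 0, 0, 0, 1] _ (by simp [v])
    · refine memN ![X 1 ^ 2 * X 3 - X 1 * X 2 * X 4 - X 1 * X 5 * X 6, -X 1 * X 2 + X 0 * X 3,
        -X 1 * X 6 - X 0 * X 2, -X 1 * X 5, -X 4] _ ?_
      simp [v, i0, i1, i2, i3, i4, i5, i6]
      linear_combination D * h1 + T * h5 - A * h4
  have hC : C ∈ M := by
    refine stab C fun i => ?_
    fin_cases i
    · exact memN ![0, 0, 1, 0, 0] _ (by simp [v])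
    · refine memN ![X 2 * X 0, -X 5, 0, -X 1, 0] _ ?_
      simp [v, i0, i1, i2, i3, i4, i5, i6]
      linear_combination -h2
    · refine memN ![X 0 * X 3, 0, -X 5, -X 4, -1] _ ?_
      simp [v, i0, i1, i2, i3, i4, i5, i6]
      linear_combination h3
    · refine memN ![X 1 * X 3 - X 2 * X 4 - X 5 * X 6, -X 2, -X 6, -X 5, 0] _ ?_
      simp [v, i0, i1, i2, i3, i4, i5, i6]
      linear_combination h5
    · refine memN ![0, X 1 * X 3, -X 1 * X 2, X 2 * X 0 + X 1 * X 6, -X 5] _ ?_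
      simp [v, i0, i1, i2, i3, i4, i5, i6]
      linear_combination -D * h2 - T * h4
  have hD : D ∈ M := by
    refine stab D fun i => ?_
    fin_cases i
    · exact memN ![0, 0, 0, 1, 0] _ (by simp [v])
    · exact memN ![0, 0, 0, 0, 1] _ (by simp [v, mul_comm])
    · refine memN ![X 1 * X 3 - X 2 * X 4 - X 5 * X 6, -X 2, -X 6, -X 5, 0] _ ?_
      simp [v, i0, i1, i2, i3, i4, i5, i6]
      linear_combination h5
    · refine memN ![0, -X 3, X 2, -X 6, 0] _ ?_
      simp [v, i0, i1, i2, i3, i4, i5, i6]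
      linear_combination h4
    · refine memN ![X 2 ^ 2 * X 0 + X 3 * X 0 * X 6, -X 2 * X 5 + X 3 * X 4, -X 3 * X 1,
        -X 2 * X 1 + X 3 * X 0, -X 6] _ ?_
      simp [v, i0, i1, i2, i3, i4, i5, i6]
      linear_combination B * h4 - Y * h2 - U * h1
  have hspan : ⊤ ≤ Submodule.span (PlS k) (Set.range v) := by
    intro r _
    have hr : r ∈ M := gen M (i0 ▸ ιM (X 0)) hB hC hD
      (by have := M.add_mem (ιM (X 6)) hD; rwa [i6, sub_add_cancel] at this)
      (by have := M.add_mem (ιM (X 5)) hC; rwa [i5, sub_add_cancel] at this)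
      (i2 ▸ ιM (X 2))
      (by have := M.add_mem (ιM (X 4)) hB; rwa [i4, sub_add_cancel] at this)
      (i1 ▸ ιM (X 1)) (i3 ▸ ιM (X 3)) r
    have h1N : (1 : R) ∈ N := Submodule.subset_span ⟨0, rfl⟩
    have := hr 1 h1N
    rwa [mul_one] at this
  -- independence
  let E := plAdj (X 0 : PlS k) (X 1) (X 2) (X 3) (X 4) (X 5) (X 6)
  obtain ⟨f, fA, fB, fC, fD, fP, fQ, fY, fZ, fT, fU⟩ := lift E _ _ _ _ _ _ _ _ _ _
    (plAdj_rel (X 0 : PlS k) (X 1) (X 2) (X 3) (X 4) (X 5) (X 6))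
  have key : f.comp ι = IsScalarTower.toAlgHom k (PlS k) E := by
    apply MvPolynomial.algHom_ext
    intro j
    rw [AlgHom.comp_apply, IsScalarTower.toAlgHom_apply]
    fin_cases j
    · exact (congrArg f i0).trans fA
    · exact (congrArg f i1).trans fT
    · exact (congrArg f i2).trans fY
    · exact (congrArg f i3).trans fU
    · refine (congrArg f i4).trans ?_
      rw [map_sub, fZ, fB, add_sub_cancel_left]; rfl
    · refine (congrArg f i5).trans ?_
      rw [map_sub, fQ, fC, add_sub_cancel_left]; rfl
    · refine (congrArg f i6).trans ?_
      rw [map_sub, fP, fD, add_sub_cancel_left]; rfl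
  have key' : ∀ p, f (ι p) = algebraMap (PlS k) E p := fun p => DFunLike.congr_fun key p
  let F : R →ₗ[PlS k] (Fin 5 → PlS k) :=
    { toFun := fun r i => (f r : Matrix (Fin 5) (Fin 5) (PlS k)) i 0
      map_add' := fun r s => by ext i; simp
      map_smul' := fun p r => by
        funext i
        rw [hsm, map_mul, key', ← Algebra.smul_def]
        rfl }
  have hF : ∀ i, F (v i) = Pi.single i 1 := by
    intro i
    funext j
    change (f (v i) : Matrix (Fin 5) (Fin 5) (PlS k)) j 0 = _
    fin_cases i
    · simp only [v, Fin.zero_eta, Matrix.cons_val_zero, map_one]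
      fin_cases j <;> simp
    · simp only [v, Fin.mk_one, Matrix.cons_val_one, Matrix.cons_val_zero, fB]
      fin_cases j <;> simp [plX, plMx]
    · change (f C : Matrix (Fin 5) (Fin 5) (PlS k)) j 0 = _
      rw [fC]
      fin_cases j <;> simp [plW, plMw]
    · change (f D : Matrix (Fin 5) (Fin 5) (PlS k)) j 0 = _
      rw [fD]
      fin_cases j <;> simp [plZ, plMz]
    · change (f (B * D) : Matrix (Fin 5) (Fin 5) (PlS k)) j 0 = _
      rw [map_mul, fB, fD]
      change (plMx (X 0 : PlS k) (X 1) (X 2) (X 3) (X 4) (X 5) (X 6) *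
        plMz (X 0 : PlS k) (X 1) (X 2) (X 3) (X 4) (X 5) (X 6)) j 0 = _
      fin_cases j <;> simp [plMx, plMz, Matrix.mul_apply, Fin.sum_univ_five]
  have hli : LinearIndependent (PlS k) v := by
    apply LinearIndependent.of_comp F
    have : F ∘ v = fun i => Pi.single i 1 := funext hF
    rw [this]
    exact Pi.linearIndependent_single_one (Fin 5) (PlS k)
  exact ⟨alg, Module.Basis.mk hli hspan, i0, i1⟩

lemma IsPl.main {k : Type u} [Field k] {R : Type u} [CommRing R] [Algebra k R]
    {A B C D P Q Y Z T U : R} (h : IsPl k R A B C D P Q Y Z T U) :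
    IsDomain R ∧ ringKrullDim R = 7 ∧ IsIntegrallyClosed R := by
  obtain ⟨alg, b, hA, hT⟩ := h.free
  have p0 : Prime (X 0 : PlS k) := X_prime
  have p1 : Prime (X 1 : PlS k) := X_prime
  have repr_mul : ∀ (p : PlS k) (r : R) i, b.repr (algebraMap (PlS k) R p * r) i = p * b.repr r i := by
    intro p r i
    rw [← Algebra.smul_def]; simp
  have reg : ∀ p : PlS k, p ≠ 0 → ∀ r, algebraMap (PlS k) R p * r = 0 → r = 0 := by
    intro p hp r hr
    apply b.repr.injective
    ext1 i
    have := repr_mul p r i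
    rw [hr, map_zero, Finsupp.zero_apply] at this
    rw [map_zero, Finsupp.zero_apply]
    exact (mul_eq_zero.mp this.symm).resolve_left hp
  have regA : ∀ r, A * r = 0 → r = 0 := hA ▸ reg _ p0.ne_zero
  have regT : ∀ r, T * r = 0 → r = 0 := hT ▸ reg _ p1.ne_zero
  have awA := h.away regA
  have awT := h.swap.away regT
  have dom : IsDomain R := by
    obtain ⟨L, _, _, _, ψ, inj, -⟩ := awA
    exact inj.isDomain ψ
  have inj : Function.Injective (algebraMap (PlS k) R) := by
    rw [injective_iff_map_eq_zero]
    intro p hp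
    by_contra hne
    exact one_ne_zero (reg p hne 1 (by rw [hp, zero_mul]))
  have fin : Module.Finite (PlS k) R := Module.Finite.of_basis b
  have hint : Algebra.IsIntegral (PlS k) R := inferInstance
  refine ⟨dom, ?_, ?_⟩
  · rw [dim_eq inj, MvPolynomial.ringKrullDim_of_isNoetherianRing, ringKrullDim_eq_zero_of_field]
    simp
  · rw [isIntegrallyClosed_iff (FractionRing R)]
    intro x hx
    obtain ⟨n, r, hr⟩ := away_integral (FractionRing R) awA x hx
    obtain ⟨m, s, hs⟩ := away_integral (FractionRing R) awT x hx
    have hinjK := IsFractionRing.injective R (FractionRing R)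
    have e1 : T ^ m * r = A ^ n * s := by
      apply hinjK
      rw [map_mul, map_mul, map_pow, map_pow, ← hr, ← hs]; ring
    have hdvd : ∀ i, ∃ c, b.repr r i = X 0 ^ n * c := by
      intro i
      have h1 := congrArg (fun z => b.repr z i) e1
      simp only [← hA, ← hT, ← map_pow, repr_mul] at h1
      refine p0.pow_dvd_of_dvd_mul_left n ?_ ⟨_, h1⟩
      intro hd
      have := p0.dvd_of_dvd_pow hd
      rw [X_dvd_X] at this
      exact absurd this (by decide)
    choose c hc using hdvd
    have hrA : r = A ^ n * ∑ i, c i • b i := by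
      conv_lhs => rw [← b.sum_repr r]
      rw [Finset.mul_sum]
      refine Finset.sum_congr rfl fun i _ => ?_
      rw [hc, mul_smul, Algebra.smul_def, map_pow, hA]
    refine ⟨∑ i, c i • b i, ?_⟩
    have hA0 : algebraMap R (FractionRing R) A ^ n ≠ 0 := by
      apply pow_ne_zero
      intro h0
      have : A = 0 := hinjK (by rw [h0, map_zero])
      exact one_ne_zero (regA 1 (by rw [this, zero_mul]))
    apply mul_left_cancel₀ hA0
    rw [hr, ← map_pow, ← map_mul, ← hrA]

lemma rTilde22_isPl (k : Type u) [Field k] (h2 : (2 : k) ≠ 0) :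
    IsPl k (RTilde22 k) (Ideal.Quotient.mk _ (X 0)) (Ideal.Quotient.mk _ (X 1))
      (Ideal.Quotient.mk _ (X 2)) (Ideal.Quotient.mk _ (X 3))
      (Ideal.Quotient.mk _ (X 7 - X 4)) (Ideal.Quotient.mk _ (X 7 + X 4))
      (Ideal.Quotient.mk _ (X 8)) (Ideal.Quotient.mk _ (X 9)) (Ideal.Quotient.mk _ (X 5))
      (Ideal.Quotient.mk _ (X 6)) := by
  refine ⟨⟨?_, ?_, ?_, ?_, ?_⟩, ?_, ?_⟩
  · simp only [← map_mul, ← map_add]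
    rw [Ideal.Quotient.eq]
    have : (X 7 * X 0 + X 9 * X 1 - X 0 * X 4 - X 2 * X 5 : MvPolynomial (Fin 10) k) ∈ idealR22 k :=
      Ideal.subset_span (by simp)
    convert this using 1; ring
  · simp only [← map_mul, ← map_sub]
    rw [Ideal.Quotient.eq]
    have : (X 8 * X 0 - X 7 * X 1 - X 1 * X 4 - X 3 * X 5 : MvPolynomial (Fin 10) k) ∈ idealR22 k :=
      Ideal.subset_span (by simp)
    convert this using 1; ring
  · simp only [← map_mul, ← map_add]
    rw [Ideal.Quotient.eq]
    have : (X 9 * X 3 + X 7 * X 2 + X 2 * X 4 - X 0 * X 6 : MvPolynomial (Fin 10) k) ∈ idealR22 k :=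
      Ideal.subset_span (by simp)
    convert this using 1; ring
  · simp only [← map_mul, ← map_add, ← map_sub]
    rw [Ideal.Quotient.eq_zero_iff_mem]
    have : (X 7 * X 3 - X 8 * X 2 - X 3 * X 4 + X 1 * X 6 : MvPolynomial (Fin 10) k) ∈ idealR22 k :=
      Ideal.subset_span (by simp)
    convert this using 1; ring
  · simp only [← map_mul, ← map_add]
    rw [Ideal.Quotient.eq]
    have : (X 7 ^ 2 + X 8 * X 9 - X 4 ^ 2 - X 5 * X 6 : MvPolynomial (Fin 10) k) ∈ idealR22 k :=
      Ideal.subset_span (by simp)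
    convert this using 1; ring
  · intro M hA hB hC hD hP hQ hY hZ hT hU r
    obtain ⟨p, rfl⟩ := Ideal.Quotient.mk_surjective r
    let N : Subalgebra k (MvPolynomial (Fin 10) k) := M.comap (Ideal.Quotient.mkₐ k (idealR22 k))
    have hC2 : ∀ c : k, (MvPolynomial.C c : MvPolynomial (Fin 10) k) ∈ N :=
      fun c => N.algebraMap_mem c
    have hhalf : (MvPolynomial.C (2⁻¹ : k) * 2 : MvPolynomial (Fin 10) k) = 1 := by
      rw [← map_ofNat (MvPolynomial.C (σ := Fin 10) (R := k)) 2, ← map_mul,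
        inv_mul_cancel₀ h2, map_one]
    have hP' : (X 7 - X 4 : MvPolynomial (Fin 10) k) ∈ N := hP
    have hQ' : (X 7 + X 4 : MvPolynomial (Fin 10) k) ∈ N := hQ
    have h7 : (X 7 : MvPolynomial (Fin 10) k) ∈ N := by
      have := N.mul_mem (hC2 2⁻¹) (N.add_mem hP' hQ')
      convert this using 1
      linear_combination -X 7 * hhalf
    have h4 : (X 4 : MvPolynomial (Fin 10) k) ∈ N := by
      have := N.sub_mem hQ' h7
      rwa [add_sub_cancel_left] at this
    change p ∈ N
    induction p using MvPolynomial.induction_on with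
    | C c => exact hC2 c
    | add p q hp hq => exact N.add_mem hp hq
    | mul_X p i hp =>
      refine N.mul_mem hp ?_
      fin_cases i
      exacts [hA, hB, hC, hD, h4, hT, hU, h7, hY, hZ]
  · intro L _ _ A' B' C' D' P' Q' Y' Z' T' U' ⟨g1, g2, g3, g4, g5⟩
    obtain ⟨c, hc⟩ : ∃ c : L, c * 2 = 1 := ⟨algebraMap k L 2⁻¹, by
      rw [← map_ofNat (algebraMap k L) 2, ← map_mul, inv_mul_cancel₀ h2, map_one]⟩
    let φ : MvPolynomial (Fin 10) k →ₐ[k] L :=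
      aeval ![A', B', C', D', c * (Q' - P'), T', U', c * (P' + Q'), Y', Z']
    have f0 : φ (X 0) = A' := aeval_X _ _
    have f1 : φ (X 1) = B' := aeval_X _ _
    have f2 : φ (X 2) = C' := aeval_X _ _
    have f3 : φ (X 3) = D' := aeval_X _ _
    have f4 : φ (X 4) = c * (Q' - P') := aeval_X _ _
    have f5 : φ (X 5) = T' := aeval_X _ _
    have f6 : φ (X 6) = U' := aeval_X _ _
    have f7 : φ (X 7) = c * (P' + Q') := aeval_X _ _
    have f8 : φ (X 8) = Y' := aeval_X _ _
    have f9 : φ (X 9) = Z' := aeval_X _ _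
    have hle : idealR22 k ≤ RingHom.ker φ := by
      rw [idealR22, Ideal.span_le]
      rintro p (rfl | rfl | rfl | rfl | rfl) <;> rw [SetLike.mem_coe, RingHom.mem_ker] <;>
        simp only [map_add, map_sub, map_mul, map_pow, f0, f1, f2, f3, f4, f5, f6, f7, f8, f9]
      · linear_combination g1 + A' * P' * hc
      · linear_combination g2 - B' * Q' * hc
      · linear_combination g3 + C' * Q' * hc
      · linear_combination g4 + D' * P' * hc
      · linear_combination g5 + P' * Q' * (2 * c + 1) * hc
    refine ⟨Ideal.Quotient.liftₐ (idealR22 k) φ hle, f0, f1, f2, f3, ?_, ?_, f8, f9, f5, f6⟩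
    · change φ (X 7 - X 4) = P'
      rw [map_sub, f7, f4]; linear_combination P' * hc
    · change φ (X 7 + X 4) = Q'
      rw [map_add, f7, f4]; linear_combination Q' * hc

/-- For a field `k` of characteristic `0` or at least `5`, the ring `R̃^{2,2}_k` is a
Noetherian normal integral domain of Krull dimension `7`. -/
theorem rTilde22_normal_domain (k : Type*) [Field k]
    (hchar : ringChar k = 0 ∨ 5 ≤ ringChar k) :
    IsNoetherianRing (RTilde22 k) ∧ IsDomain (RTilde22 k) ∧
      ringKrullDim (RTilde22 k) = 7 ∧ IsIntegrallyClosed (RTilde22 k) := by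
  have h2 : (2 : k) ≠ 0 := Ring.two_ne_zero (by omega)
  exact ⟨inferInstance, (rTilde22_isPl k h2).main⟩
end

section
/- Let k be a field of characteristic 0 or of characteristic at least 5. Then the ring R̃^{1,2,1}_k is a Noetherian integral domain of Krull dimension 5 which is integrally closed in its fraction field (i.e. a normal domain). -/
open MvPolynomial

set_option maxHeartbeats 1000000
set_option synthInstance.maxHeartbeats 400000

namespace Segre

section Abstract

variable {Q P : Type*} [CommRing Q] [CommRing P]

/-- A ring `Q` with a `Q`-linear retraction from a domain is a domain. -/
theorem injective_of_retraction (φ : Q →+* P) (ρ : P → Q) (h1 : ρ 1 = 1)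
    (hl : ∀ q p, ρ (φ q * p) = q * ρ p) : Function.Injective φ := by
  intro a b hab
  have h2 := hl a 1
  rw [hab, hl b 1, h1] at h2
  simpa using h2.symm

theorem isIntegrallyClosed_of_retraction [IsDomain Q] [IsDomain P] [IsIntegrallyClosed P]
    (φ : Q →+* P) (ρ : P → Q) (h1 : ρ 1 = 1)
    (hl : ∀ q p, ρ (φ q * p) = q * ρ p) : IsIntegrallyClosed Q := by
  have hinj := injective_of_retraction φ ρ h1 hl
  rw [isIntegrallyClosed_iff (FractionRing Q)]
  intro x hx
  obtain ⟨a, b, hb, rfl⟩ := IsFractionRing.div_surjective (A := Q) x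
  have hb0 : b ≠ 0 := nonZeroDivisors.ne_zero hb
  let Φ : FractionRing Q →+* FractionRing P := IsFractionRing.map (K := FractionRing Q)
    (L := FractionRing P) (j := φ) hinj
  have hΦ : ∀ q, Φ (algebraMap Q _ q) = algebraMap P _ (φ q) := fun q => by
    simp [Φ, IsFractionRing.map]
  have hint : IsIntegral P (Φ (algebraMap Q _ a / algebraMap Q _ b)) := by
    obtain ⟨p, hp, hpx⟩ := hx
    refine ⟨p.map φ, hp.map φ, ?_⟩
    rw [Polynomial.eval₂_map]
    have hc : (algebraMap P (FractionRing P)).comp φ = Φ.comp (algebraMap Q _) := by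
      ext q; simp [hΦ]
    rw [hc, ← Polynomial.hom_eval₂, hpx, map_zero]
  obtain ⟨p, hp⟩ := (isIntegrallyClosed_iff (FractionRing P)).1 inferInstance hint
  have hpb : φ b * p = φ a := by
    apply IsFractionRing.injective P (FractionRing P)
    rw [map_mul, hp, map_div₀, hΦ, hΦ]
    have : algebraMap P (FractionRing P) (φ b) ≠ 0 := by
      intro h
      rw [IsFractionRing.to_map_eq_zero_iff] at h
      exact hb0 (hinj (by simpa using h))
    field_simp
  refine ⟨ρ p, ?_⟩
  have h3 : b * ρ p = a := by
    have h4 := hl a 1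
    rw [← hl, hpb]
    rw [mul_one, h1, mul_one] at h4
    exact h4
  have : algebraMap Q (FractionRing Q) b ≠ 0 := by
    intro h
    rw [IsFractionRing.to_map_eq_zero_iff] at h
    exact hb0 h
  rw [← h3]
  simp only [map_mul]
  field_simp

theorem ringKrullDim_le_of_isIntegral (f : P →+* Q) (hf : f.IsIntegral) :
    ringKrullDim Q ≤ ringKrullDim P := by
  algebraize [f]
  refine Order.krullDim_le_of_strictMono (PrimeSpectrum.comap f) ?_
  intro I J hIJ
  exact Ideal.IsIntegral.comap_lt_comap (R := P) (A := Q) (I := I.asIdeal) (J := J.asIdeal) hIJ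

end Abstract

section Straighten

variable {Q : Type*} [CommRing Q] (y z : Fin 4 → Q)

/-- The monomial with `y`-part `α` and `z`-part `β`. -/
def W (α β : Multiset (Fin 4)) : Q := (α.map y).prod * (β.map z).prod

theorem W_congr (h : ∀ i j, y i * z j = y j * z i) (β : Multiset (Fin 4)) :
    ∀ α α' β' : Multiset (Fin 4), α + β = α' + β' → β.card = β'.card →
      W y z α β = W y z α' β' := by
  induction β using Multiset.induction_on with
  | empty =>
    intro α α' β' h1 h2
    have : β' = 0 := by simpa using h2.symm
    subst this
    simp at h1
    rw [h1]
  | cons i β ih =>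
    intro α α' β' h1 h2
    by_cases hi : i ∈ β'
    · obtain ⟨γ, rfl⟩ := Multiset.exists_cons_of_mem hi
      have := ih α α' γ (by simpa using h1) (by simpa using h2)
      simp only [W, Multiset.map_cons, Multiset.prod_cons] at this ⊢
      linear_combination z i * this
    · have hi' : i ∈ α' := by
        have : i ∈ α' + β' := by rw [← h1]; simp
        rcases Multiset.mem_add.1 this with h | h
        · exact h
        · exact absurd h hi
      obtain ⟨δ, rfl⟩ := Multiset.exists_cons_of_mem hi'
      have hne : β' ≠ 0 := by
        rintro rfl
        simp at h2
      obtain ⟨j, hj⟩ := Multiset.exists_mem_of_ne_zero hne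
      obtain ⟨γ, rfl⟩ := Multiset.exists_cons_of_mem hj
      have := ih α (j ::ₘ δ) γ (by
        simp only [Multiset.add_cons, Multiset.cons_add] at h1 ⊢
        rw [Multiset.cons_swap] at h1
        exact (Multiset.cons_inj_right i).1 h1) (by simpa using h2)
      simp only [W, Multiset.map_cons, Multiset.prod_cons] at this ⊢
      linear_combination z i * this + (δ.map y).prod * (γ.map z).prod * h j i

/-- The column content of an exponent vector. -/
def content (m : Fin 2 ⊕ Fin 4 →₀ ℕ) : Multiset (Fin 4) := ∑ i, m (Sum.inr i) • {i}

theorem content_add (m n) : content (m + n) = content m + content n := by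
  simp [content, add_smul, Finset.sum_add_distrib]

theorem content_inl (a : Fin 2) : content (Finsupp.single (Sum.inl a) 1) = 0 := by
  simp [content]

theorem content_inr (j : Fin 4) : content (Finsupp.single (Sum.inr j) 1) = {j} := by
  simp [content, Finsupp.single_apply, ite_smul]

/-- Standard monomial. -/
noncomputable def std (m : Fin 2 ⊕ Fin 4 →₀ ℕ) : Q :=
  if (content m).card = m (Sum.inl 0) + m (Sum.inl 1) then
    W y z ((content m).toList.take (m (Sum.inl 0)) : List (Fin 4))
      ((content m).toList.drop (m (Sum.inl 0)) : List (Fin 4))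
  else 0

theorem std_eq (h : ∀ i j, y i * z j = y j * z i) (m : Fin 2 ⊕ Fin 4 →₀ ℕ)
    (α β : Multiset (Fin 4)) (h1 : α + β = content m) (h2 : α.card = m (Sum.inl 0))
    (h3 : β.card = m (Sum.inl 1)) : std y z m = W y z α β := by
  have hc : (content m).card = m (Sum.inl 0) + m (Sum.inl 1) := by
    rw [← h1, Multiset.card_add, h2, h3]
  rw [std, if_pos hc]
  apply W_congr y z h
  · rw [Multiset.coe_add, List.take_append_drop, Multiset.coe_toList, h1]
  · rw [Multiset.coe_card, List.length_drop, Multiset.length_toList, hc, h3]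
    simp

theorem exists_split (m : Fin 2 ⊕ Fin 4 →₀ ℕ)
    (hc : (content m).card = m (Sum.inl 0) + m (Sum.inl 1)) :
    ∃ α β : Multiset (Fin 4), α + β = content m ∧ α.card = m (Sum.inl 0) ∧
      β.card = m (Sum.inl 1) := by
  refine ⟨((content m).toList.take (m (Sum.inl 0)) : List (Fin 4)),
      ((content m).toList.drop (m (Sum.inl 0)) : List (Fin 4)), ?_, ?_, ?_⟩
  · rw [Multiset.coe_add, List.take_append_drop, Multiset.coe_toList]
  · rw [Multiset.coe_card, List.length_take, Multiset.length_toList, hc]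
    simp
  · rw [Multiset.coe_card, List.length_drop, Multiset.length_toList, hc]
    simp

theorem std_y (h : ∀ i j, y i * z j = y j * z i) (m : Fin 2 ⊕ Fin 4 →₀ ℕ) (j : Fin 4) :
    std y z (Finsupp.single (Sum.inl 0) 1 + Finsupp.single (Sum.inr j) 1 + m)
      = y j * std y z m := by
  by_cases hc : (content m).card = m (Sum.inl 0) + m (Sum.inl 1)
  · obtain ⟨α, β, h1, h2, h3⟩ := exists_split m hc
    rw [std_eq y z h m α β h1 h2 h3, std_eq y z h _ (j ::ₘ α) β]
    · simp [W, mul_assoc]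
    · simp [content_add, content_inl, content_inr, ← h1]
    · simp [h2, add_comm]
    · simp [h3]
  · rw [std, std, if_neg hc, if_neg, mul_zero]
    simp [content_add, content_inl, content_inr]
    omega

theorem std_z (h : ∀ i j, y i * z j = y j * z i) (m : Fin 2 ⊕ Fin 4 →₀ ℕ) (j : Fin 4) :
    std y z (Finsupp.single (Sum.inl 1) 1 + Finsupp.single (Sum.inr j) 1 + m)
      = z j * std y z m := by
  by_cases hc : (content m).card = m (Sum.inl 0) + m (Sum.inl 1)
  · obtain ⟨α, β, h1, h2, h3⟩ := exists_split m hc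
    rw [std_eq y z h m α β h1 h2 h3, std_eq y z h _ α (j ::ₘ β)]
    · simp [W, mul_left_comm]
    · simp [content_add, content_inl, content_inr, ← h1]
    · simp [h2]
    · simp [h3, add_comm]
  · rw [std, std, if_neg hc, if_neg, mul_zero]
    simp [content_add, content_inl, content_inr]
    omega

theorem std_zero : std y z 0 = 1 := by
  simp [std, content, W]

end Straighten

section Main

variable {k Q : Type*} [Field k] [CommRing Q] [Algebra k Q] (y z : Fin 4 → Q)

/-- The retraction. -/
noncomputable def rho (k : Type*) [Field k] [Algebra k Q] :
    MvPolynomial (Fin 2 ⊕ Fin 4) k →ₗ[k] Q :=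
  (MvPolynomial.basisMonomials (Fin 2 ⊕ Fin 4) k).constr k (std y z)

theorem rho_monomial (m : Fin 2 ⊕ Fin 4 →₀ ℕ) (c : k) :
    rho y z k (monomial m c) = c • std y z m := by
  have : monomial m c = c • MvPolynomial.basisMonomials (Fin 2 ⊕ Fin 4) k m := by
    simp [smul_monomial]
  rw [this, map_smul, rho, Module.Basis.constr_basis]

theorem rho_y (h : ∀ i j, y i * z j = y j * z i) (j : Fin 4) (p) :
    rho y z k (X (Sum.inl 0) * X (Sum.inr j) * p) = y j * rho y z k p := by
  induction p using MvPolynomial.induction_on' with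
  | monomial m c =>
    have : (X (Sum.inl 0) * X (Sum.inr j) * monomial m c : MvPolynomial (Fin 2 ⊕ Fin 4) k) =
        monomial (Finsupp.single (Sum.inl 0) 1 + Finsupp.single (Sum.inr j) 1 + m) c := by
      simp [X, monomial_mul]
    rw [this, rho_monomial, rho_monomial, std_y y z h, mul_smul_comm]
  | add p q hp hq => rw [mul_add, map_add, map_add, hp, hq, mul_add]

theorem rho_z (h : ∀ i j, y i * z j = y j * z i) (j : Fin 4) (p) :
    rho y z k (X (Sum.inl 1) * X (Sum.inr j) * p) = z j * rho y z k p := by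
  induction p using MvPolynomial.induction_on' with
  | monomial m c =>
    have : (X (Sum.inl 1) * X (Sum.inr j) * monomial m c : MvPolynomial (Fin 2 ⊕ Fin 4) k) =
        monomial (Finsupp.single (Sum.inl 1) 1 + Finsupp.single (Sum.inr j) 1 + m) c := by
      simp [X, monomial_mul]
    rw [this, rho_monomial, rho_monomial, std_z y z h, mul_smul_comm]
  | add p q hp hq => rw [mul_add, map_add, map_add, hp, hq, mul_add]

theorem rho_one : rho y z k 1 = 1 := by
  have := rho_monomial y z (0 : Fin 2 ⊕ Fin 4 →₀ ℕ) (1 : k)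
  rwa [std_zero, one_smul] at this

theorem rho_linear (h : ∀ i j, y i * z j = y j * z i)
    (htop : Algebra.adjoin k (Set.range y ∪ Set.range z) = ⊤)
    (φ : Q →ₐ[k] MvPolynomial (Fin 2 ⊕ Fin 4) k)
    (hy : ∀ j, φ (y j) = X (Sum.inl 0) * X (Sum.inr j))
    (hz : ∀ j, φ (z j) = X (Sum.inl 1) * X (Sum.inr j)) (q : Q) :
    ∀ p, rho y z k (φ q * p) = q * rho y z k p := by
  have hq : q ∈ Algebra.adjoin k (Set.range y ∪ Set.range z) := by rw [htop]; trivial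
  induction hq using Algebra.adjoin_induction with
  | mem x hx =>
    intro p
    rcases hx with ⟨j, rfl⟩ | ⟨j, rfl⟩
    · rw [hy, rho_y y z h]
    · rw [hz, rho_z y z h]
  | algebraMap r =>
    intro p
    rw [AlgHom.commutes, ← Algebra.smul_def, ← Algebra.smul_def, map_smul]
  | add a b _ _ ha hb => intro p; rw [map_add, add_mul, map_add, ha, hb, add_mul]
  | mul a b _ _ ha hb => intro p; rw [map_mul φ, mul_assoc, ha, hb, mul_assoc]

/-- The chain of substitutions killing variables one after another. -/
noncomputable def kill (k : Type*) [Field k] (n : ℕ) :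
    MvPolynomial (Fin 2 ⊕ Fin 4) k →ₐ[k] MvPolynomial (Fin 2 ⊕ Fin 4) k :=
  aeval (Sum.elim (fun a => if 5 ≤ n + a.val then 0 else X (Sum.inl a))
    (fun j => if 4 ≤ n + j.val ∧ j ≠ 0 then 0 else X (Sum.inr j)))

theorem kill_comp (n m : ℕ) (hnm : n ≤ m) (p : MvPolynomial (Fin 2 ⊕ Fin 4) k) :
    kill k m (kill k n p) = kill k m p := by
  rw [← AlgHom.comp_apply]
  congr 1
  apply MvPolynomial.algHom_ext
  rintro (a | j)
  · simp only [kill, AlgHom.comp_apply, aeval_X, Sum.elim_inl]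
    split_ifs <;> simp <;> omega
  · simp only [kill, AlgHom.comp_apply, aeval_X, Sum.elim_inr]
    split_ifs with h1 h2 h2
    · simp
    · exact absurd ⟨by omega, h1.2⟩ h2
    · rw [aeval_X, Sum.elim_inr, if_pos h2]
    · rw [aeval_X, Sum.elim_inr, if_neg h2]

theorem five_le_dim [IsDomain Q]
    (φ : Q →ₐ[k] MvPolynomial (Fin 2 ⊕ Fin 4) k)
    (hy : ∀ j, φ (y j) = X (Sum.inl 0) * X (Sum.inr j))
    (hz : ∀ j, φ (z j) = X (Sum.inl 1) * X (Sum.inr j)) : 5 ≤ ringKrullDim Q := by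
  let I : ℕ → PrimeSpectrum Q := fun n =>
    ⟨RingHom.ker ((kill k n).comp φ), RingHom.ker_isPrime _⟩
  have hmem : ∀ n q, q ∈ (I n).asIdeal ↔ kill k n (φ q) = 0 := fun n q => by
    simp only [I]
    rw [RingHom.mem_ker]; rfl
  have hle : ∀ n m, n ≤ m → (I n).asIdeal ≤ (I m).asIdeal := by
    intro n m hnm q hq
    rw [hmem] at hq ⊢
    rw [← kill_comp n m hnm, hq, map_zero]
  have hlt : ∀ n m q, n ≤ m → q ∈ (I m).asIdeal → q ∉ (I n).asIdeal → I n < I m := by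
    intro n m q hnm h1 h2
    refine lt_of_le_of_ne (hle n m hnm) ?_
    intro h
    rw [h] at h2
    exact h2 h1
  have h01 : I 0 < I 1 := hlt _ _ (y 3) (by norm_num)
    (by rw [hmem, hy]; simp [kill]) (by rw [hmem, hy]; simp [kill])
  have h12 : I 1 < I 2 := hlt _ _ (y 2) (by norm_num)
    (by rw [hmem, hy]; simp [kill]) (by rw [hmem, hy]; simp [kill])
  have h23 : I 2 < I 3 := hlt _ _ (y 1) (by norm_num)
    (by rw [hmem, hy]; simp [kill]) (by rw [hmem, hy]; simp [kill])
  have h34 : I 3 < I 4 := hlt _ _ (z 0) (by norm_num)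
    (by rw [hmem, hz]; simp [kill]) (by rw [hmem, hz]; simp [kill])
  have h45 : I 4 < I 5 := hlt _ _ (y 0) (by norm_num)
    (by rw [hmem, hy]; simp [kill]) (by rw [hmem, hy]; simp [kill])
  have hstep : ∀ i : Fin 5, I i.castSucc.val < I i.succ.val := by
    intro i
    fin_cases i
    exacts [h01, h12, h23, h34, h45]
  let l : LTSeries (PrimeSpectrum Q) := ⟨5, fun i => I i.val, hstep⟩
  exact Order.le_krullDim_iff (n := 5) |>.2 ⟨l, rfl⟩

theorem dim_le_five [IsDomain Q] (h : ∀ i j, y i * z j = y j * z i)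
    (htop : Algebra.adjoin k (Set.range y ∪ Set.range z) = ⊤) : ringKrullDim Q ≤ 5 := by
  let d : Fin 5 → Q := ![y 0, y 1 + z 0, y 2 + z 1, y 3 + z 2, z 3]
  let f : MvPolynomial (Fin 5) k →ₐ[k] Q := aeval d
  have hd : ringKrullDim (MvPolynomial (Fin 5) k) = 5 := by
    rw [MvPolynomial.ringKrullDim_of_isNoetherianRing, ringKrullDim_eq_zero_of_field]
    simp
  rw [← hd]
  refine ringKrullDim_le_of_isIntegral f.toRingHom ?_
  let alg : Algebra (MvPolynomial (Fin 5) k) Q := f.toRingHom.toAlgebra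
  have hsm : ∀ (p : MvPolynomial (Fin 5) k) (q : Q), p • q = f p * q := fun p q => rfl
  let N : Submodule (MvPolynomial (Fin 5) k) Q :=
    Submodule.span _ {1, y 1, y 2, y 3}
  have hN : N ≠ ⊥ := by
    intro hb
    have : (1 : Q) ∈ N := Submodule.subset_span (by simp)
    rw [hb] at this
    simp at this
  have hfg : N.FG := Submodule.fg_span (by simp)
  -- linear combinations
  have hcomb : ∀ a b c e : MvPolynomial (Fin 5) k,
      f a + f b * y 1 + f c * y 2 + f e * y 3 ∈ N := by
    intro a b c e
    have h0 : f a ∈ N := by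
      have := N.smul_mem a (Submodule.subset_span (by simp) : (1 : Q) ∈ N)
      rwa [hsm, mul_one] at this
    exact N.add_mem (N.add_mem (N.add_mem h0
      (N.smul_mem b (Submodule.subset_span (by simp))))
      (N.smul_mem c (Submodule.subset_span (by simp))))
      (N.smul_mem e (Submodule.subset_span (by simp)))
  have hX : ∀ i, f (X i) = d i := fun i => by simp [f]
  have h01 := h 0 1
  have h02 := h 0 2
  have h03 := h 0 3
  have h12 := h 1 2
  have h13 := h 1 3
  have h23 := h 2 3
  have h11 : y 1 * y 1 ∈ N := by
    convert hcomb (-(X 0 * X 2)) (X 1) (X 0) 0 using 1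
    simp only [map_neg, map_mul, hX, map_zero, d]
    simp
    linear_combination h01
  have h12' : y 1 * y 2 ∈ N := by
    convert hcomb (-(X 0 * X 3)) 0 (X 1) (X 0) using 1
    simp only [map_neg, map_mul, hX, map_zero, d]
    simp
    linear_combination h02
  have h13' : y 1 * y 3 ∈ N := by
    convert hcomb (-(X 0 * X 4)) 0 0 (X 1) using 1
    simp only [map_neg, map_mul, hX, map_zero, d]
    simp
    linear_combination h03
  have h22 : y 2 * y 2 ∈ N := by
    convert hcomb (-(X 0 * X 4)) (-X 3) (X 2) (X 1) using 1
    simp only [map_neg, map_mul, hX, map_zero, d]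
    simp
    linear_combination h03 + h12
  have h23' : y 2 * y 3 ∈ N := by
    convert hcomb 0 (-X 4) 0 (X 2) using 1
    simp only [map_neg, map_mul, hX, map_zero, d]
    simp
    linear_combination h13
  have h33 : y 3 * y 3 ∈ N := by
    convert hcomb 0 0 (-X 4) (X 3) using 1
    simp only [map_neg, map_mul, hX, map_zero, d]
    simp
    linear_combination h23
  have key : ∀ x : Q, x * 1 ∈ N → x * y 1 ∈ N → x * y 2 ∈ N → x * y 3 ∈ N →
      f.toRingHom.IsIntegralElem x := by
    intro x h0 h1 h2 h3
    refine isIntegral_of_smul_mem_submodule (R := MvPolynomial (Fin 5) k) (A := Q) N hN hfg x ?_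
    intro n hn
    induction hn using Submodule.span_induction with
    | mem w hw =>
      rcases hw with rfl | rfl | rfl | rfl
      exacts [h0, h1, h2, h3]
    | zero => rw [smul_zero]; exact N.zero_mem
    | add a b _ _ ha hb => rw [smul_add]; exact N.add_mem ha hb
    | smul r a _ ha => rw [smul_comm]; exact N.smul_mem r ha
  have iy1 : f.toRingHom.IsIntegralElem (y 1) := key _
    (by rw [mul_one]; exact Submodule.subset_span (by simp)) h11 h12' h13'
  have iy2 : f.toRingHom.IsIntegralElem (y 2) := key _
    (by rw [mul_one]; exact Submodule.subset_span (by simp)) (by rwa [mul_comm]) h22 h23'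
  have iy3 : f.toRingHom.IsIntegralElem (y 3) := key _
    (by rw [mul_one]; exact Submodule.subset_span (by simp)) (by rwa [mul_comm])
      (by rwa [mul_comm]) h33
  have id' : ∀ i, f.toRingHom.IsIntegralElem (d i) := fun i => by
    rw [← hX]; exact f.toRingHom.isIntegralElem_map
  have iy0 : f.toRingHom.IsIntegralElem (y 0) := id' 0
  have iz3 : f.toRingHom.IsIntegralElem (z 3) := id' 4
  have iz0 : f.toRingHom.IsIntegralElem (z 0) := by
    have := (id' 1).sub _ iy1
    simpa [d] using this
  have iz1 : f.toRingHom.IsIntegralElem (z 1) := by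
    have := (id' 2).sub _ iy2
    simpa [d] using this
  have iz2 : f.toRingHom.IsIntegralElem (z 2) := by
    have := (id' 3).sub _ iy3
    simpa [d] using this
  intro q
  have hq : q ∈ Algebra.adjoin k (Set.range y ∪ Set.range z) := by rw [htop]; trivial
  induction hq using Algebra.adjoin_induction with
  | mem x hx =>
    rcases hx with ⟨j, rfl⟩ | ⟨j, rfl⟩
    · fin_cases j
      exacts [iy0, iy1, iy2, iy3]
    · fin_cases j
      exacts [iz0, iz1, iz2, iz3]
  | algebraMap r =>
    rw [← f.commutes]; exact f.toRingHom.isIntegralElem_map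
  | add a b _ _ ha hb => exact ha.add _ hb
  | mul a b _ _ ha hb => exact ha.mul _ hb

theorem main (h : ∀ i j, y i * z j = y j * z i)
    (htop : Algebra.adjoin k (Set.range y ∪ Set.range z) = ⊤)
    (φ : Q →ₐ[k] MvPolynomial (Fin 2 ⊕ Fin 4) k)
    (hy : ∀ j, φ (y j) = X (Sum.inl 0) * X (Sum.inr j))
    (hz : ∀ j, φ (z j) = X (Sum.inl 1) * X (Sum.inr j)) :
    IsDomain Q ∧ ringKrullDim Q = 5 ∧ IsIntegrallyClosed Q := by
  have hl := rho_linear y z h htop φ hy hz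
  have h1 : rho y z k 1 = 1 := rho_one y z
  let ψ : Q →+* MvPolynomial (Fin 2 ⊕ Fin 4) k := φ.toRingHom
  let r : MvPolynomial (Fin 2 ⊕ Fin 4) k → Q := fun p => rho y z k p
  have hr1 : r 1 = 1 := h1
  have hrl : ∀ q p, r (ψ q * p) = q * r p := hl
  have hinj : Function.Injective ψ := injective_of_retraction ψ r hr1 hrl
  have hdom : IsDomain Q := hinj.isDomain ψ
  refine ⟨hdom, le_antisymm (dim_le_five (k := k) y z h htop) (five_le_dim y z φ hy hz), ?_⟩
  exact isIntegrallyClosed_of_retraction ψ r hr1 hrl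

end Main

end Segre

/-- For a field `k` of characteristic `0` or at least `5`, the ring `R̃^{1,2,1}_k` is a
Noetherian normal integral domain of Krull dimension `5`. -/
theorem rTilde121_normal_domain (k : Type*) [Field k]
    (hchar : ringChar k = 0 ∨ 5 ≤ ringChar k) :
    IsNoetherianRing (RTilde121 k) ∧ IsDomain (RTilde121 k) ∧
      ringKrullDim (RTilde121 k) = 5 ∧ IsIntegrallyClosed (RTilde121 k) := by
  refine ⟨inferInstance, ?_⟩
  have h2 : (2 : k) ≠ 0 := by
    intro h
    have h' : ((2 : ℕ) : k) = 0 := by exact_mod_cast h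
    have hd := (ringChar.spec k 2).1 h'
    rcases hchar with h0 | h5
    · rw [h0] at hd; simp at hd
    · have := Nat.le_of_dvd (by norm_num) hd
      omega
  let v : Fin 8 → RTilde121 k := fun i => Ideal.Quotient.mk (idealR121 k) (X i)
  have hrel : ∀ p ∈ idealR121 k, Ideal.Quotient.mk (idealR121 k) p = 0 := fun p hp =>
    Ideal.Quotient.eq_zero_iff_mem.2 hp
  have r1 : v 5 * v 0 + v 7 * v 1 - v 0 * v 4 = 0 := by
    have := hrel _ (Ideal.subset_span (Or.inl rfl))
    simpa [v] using this
  have r2 : v 6 * v 0 - v 5 * v 1 - v 1 * v 4 = 0 := by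
    have := hrel _ (Ideal.subset_span (Or.inr (Or.inl rfl)))
    simpa [v] using this
  have r3 : v 5 * v 2 + v 6 * v 3 + v 2 * v 4 = 0 := by
    have := hrel _ (Ideal.subset_span (Or.inr (Or.inr (Or.inl rfl))))
    simpa [v] using this
  have r4 : v 7 * v 2 - v 5 * v 3 + v 3 * v 4 = 0 := by
    have := hrel _ (Ideal.subset_span (Or.inr (Or.inr (Or.inr (Or.inl rfl)))))
    simpa [v] using this
  have r5 : v 5 ^ 2 + v 6 * v 7 - v 4 ^ 2 = 0 := by
    have := hrel _ (Ideal.subset_span (Or.inr (Or.inr (Or.inr (Or.inr (Or.inl rfl))))))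
    simpa [v] using this
  have r6 : v 0 * v 2 + v 1 * v 3 = 0 := by
    have := hrel _ (Ideal.subset_span (Or.inr (Or.inr (Or.inr (Or.inr (Or.inr rfl))))))
    simpa [v] using this
  let y : Fin 4 → RTilde121 k := ![v 5 - v 4, v 6, v 2, - v 1]
  let z : Fin 4 → RTilde121 k := ![v 7, - v 5 - v 4, v 3, v 0]
  let s : Fin 2 → MvPolynomial (Fin 2 ⊕ Fin 4) k := fun a => X (Sum.inl a)
  let t : Fin 4 → MvPolynomial (Fin 2 ⊕ Fin 4) k := fun a => X (Sum.inr a)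
  let c : MvPolynomial (Fin 2 ⊕ Fin 4) k := C (2⁻¹)
  have hc : 2 * c = 1 := by
    have : (2 : MvPolynomial (Fin 2 ⊕ Fin 4) k) = C 2 := (map_ofNat C 2).symm
    rw [this, ← C_mul, mul_inv_cancel₀ h2, C_1]
  let g : Fin 8 → MvPolynomial (Fin 2 ⊕ Fin 4) k :=
    ![s 1 * t 3, - (s 0 * t 3), s 0 * t 2, s 1 * t 2,
      - c * (s 0 * t 0 + s 1 * t 1), c * (s 0 * t 0 - s 1 * t 1), s 0 * t 1, s 1 * t 0]
  have hg : ∀ p ∈ idealR121 k, (aeval g : MvPolynomial (Fin 8) k →ₐ[k] _) p = 0 := by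
    have : idealR121 k ≤ RingHom.ker (aeval g : MvPolynomial (Fin 8) k →ₐ[k] _) := by
      unfold idealR121
      rw [Ideal.span_le]
      rintro p (rfl | rfl | rfl | rfl | rfl | rfl) <;>
        simp only [SetLike.mem_coe, RingHom.mem_ker, map_add, map_sub, map_mul, map_pow, aeval_X]
          <;> simp [g]
      · linear_combination (s 0 * t 0 * s 1 * t 3) * hc
      · linear_combination (-s 0 * t 3 * s 1 * t 1) * hc
      · linear_combination (-s 0 * t 2 * s 1 * t 1) * hc
      · linear_combination (-s 0 * t 0 * s 1 * t 2) * hc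
      · linear_combination (-s 0 * t 0 * s 1 * t 1) * (2 * c + 1) * hc
      · ring
    exact this
  let φ : RTilde121 k →ₐ[k] MvPolynomial (Fin 2 ⊕ Fin 4) k :=
    Ideal.Quotient.liftₐ (idealR121 k) (aeval g) hg
  have hφ : ∀ i, φ (v i) = g i := by
    intro i
    have : φ (v i) = aeval g (X i : MvPolynomial (Fin 8) k) := rfl
    rw [this, aeval_X]
  refine Segre.main (k := k) y z ?_ ?_ φ ?_ ?_
  · intro i j
    fin_cases i <;> fin_cases j <;> simp [y, z]
    all_goals first
      | ring1
      | linear_combination r1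
      | linear_combination -r1
      | linear_combination r2
      | linear_combination -r2
      | linear_combination r3
      | linear_combination -r3
      | linear_combination r4
      | linear_combination -r4
      | linear_combination r5
      | linear_combination -r5
      | linear_combination r6
      | linear_combination -r6
  · set T := Algebra.adjoin k (Set.range y ∪ Set.range z) with hT
    have hyT : ∀ j, y j ∈ T := fun j => Algebra.subset_adjoin (Or.inl ⟨j, rfl⟩)
    have hzT : ∀ j, z j ∈ T := fun j => Algebra.subset_adjoin (Or.inr ⟨j, rfl⟩)
    have hhalf : ∀ x, x + x ∈ T → x ∈ T := by
      intro x hx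
      have := T.smul_mem hx (2⁻¹ : k)
      rwa [← two_smul k x, smul_smul, inv_mul_cancel₀ h2, one_smul] at this
    have hv : ∀ i, v i ∈ T := by
      intro i
      fin_cases i
      · exact hzT 3
      · have := T.neg_mem (hyT 3)
        simpa [y] using this
      · exact hyT 2
      · exact hzT 2
      · apply hhalf
        have := T.neg_mem (T.add_mem (hyT 0) (hzT 1))
        convert this using 1
        simp [y, z]
      · apply hhalf
        have := T.sub_mem (hyT 0) (hzT 1)
        convert this using 1
        simp [y, z]
      · exact hyT 1
      · exact hzT 0
    rw [eq_top_iff]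
    rintro q -
    obtain ⟨p, rfl⟩ := Ideal.Quotient.mk_surjective q
    induction p using MvPolynomial.induction_on with
    | C a => exact T.algebraMap_mem a
    | add p q hp hq => rw [map_add]; exact T.add_mem hp hq
    | mul_X p i hp => rw [map_mul]; exact T.mul_mem hp (hv i)
  · intro j
    fin_cases j <;> simp [y, hφ, g]
    · linear_combination (s 0 * t 0) * hc
    all_goals simp [s, t]
  · intro j
    fin_cases j <;> simp [z, hφ, g]
    · simp [s, t]
    · linear_combination (s 1 * t 1) * hc
    all_goals simp [s, t]
end

section
/- Let k be a field of characteristic 0 or of characteristic at least 5. Then the quotient ring R̃^{2,2}_k/(AD−BC) is an integral domain of Krull dimension 6. -/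
open MvPolynomial

set_option maxHeartbeats 1000000
set_option synthInstance.maxHeartbeats 400000

set_option maxHeartbeats 2000000
set_option linter.all false

namespace R22

section mats
variable {P : Type*} [CommRing P] (A B U Y Z s t : P)

/-- multiplication by `a = X - S` on the basis `1, a, C, D, aC`. -/
def Ma : Matrix (Fin 5) (Fin 5) P :=
  !![0, B*U - U*t + Y*Z, 0, -B*U, -A*U*Y - U*Z*B + Y*Z*B;
     1, s, 0, 0, -A*(U-Y);
     0, U - Y, 0, Y, B*U + Y*Z - Y*t + Y*s;
     0, U, 0, 0, Z*Y;
     0, 0, 1, 0, s - Y]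

/-- multiplication by `C`. -/
def Mc : Matrix (Fin 5) (Fin 5) P :=
  !![0, 0, A*U - Z*B, -A*U, -A*B*U + A*U*t - A*Y*Z - A*U*Y + Y*Z*B;
     0, 0, -A, 0, -Z*B - A*s + A*Y;
     1, 0, t - s, s, -A*U + A*Y + B*U - Y*t + Y*s;
     0, 0, -Z, Z, -A*U + Z*Y;
     0, 1, 1, -1, t - Y]

/-- multiplication by `D`. -/
def Md : Matrix (Fin 5) (Fin 5) P :=
  !![0, -B*U, -A*U, A*U - Y*A + B*s, Y*(A*U - Z*B);
     0, 0, 0, -B, -Y*A;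
     0, Y, s, -s, Y*(t-s) - B*U;
     1, 0, Z, t - Z - B, -Y*Z;
     0, 0, -1, 1, Y]

lemma comm_ac : Ma A B U Y Z s t * Mc A B U Y Z s t = Mc A B U Y Z s t * Ma A B U Y Z s t := by
  ext i j
  fin_cases i <;> fin_cases j <;>
    simp [Ma, Mc, Matrix.mul_apply, Fin.sum_univ_five] <;> ring

lemma comm_ad : Ma A B U Y Z s t * Md A B U Y Z s t = Md A B U Y Z s t * Ma A B U Y Z s t := by
  ext i j
  fin_cases i <;> fin_cases j <;>
    simp [Ma, Md, Matrix.mul_apply, Fin.sum_univ_five] <;> ring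

lemma comm_cd : Mc A B U Y Z s t * Md A B U Y Z s t = Md A B U Y Z s t * Mc A B U Y Z s t := by
  ext i j
  fin_cases i <;> fin_cases j <;>
    simp [Mc, Md, Matrix.mul_apply, Fin.sum_univ_five] <;> ring

lemma mrel1 (i : Fin 5) : (A • Ma A B U Y Z s t + (Z * B) • (1 : Matrix (Fin 5) (Fin 5) P)
    - Mc A B U Y Z s t * (t • 1 - Mc A B U Y Z s t - Md A B U Y Z s t)) i 0 = 0 := by
  simp only [mul_sub, sub_mul, mul_smul_comm, smul_mul_assoc, mul_one, one_mul]
  fin_cases i <;>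
    simp [Ma, Mc, Md] <;> ring

lemma mrel2 (i : Fin 5) : ((Y * A) • (1 : Matrix (Fin 5) (Fin 5) P)
    - B • (s • 1 - Ma A B U Y Z s t - Md A B U Y Z s t)
    - Md A B U Y Z s t * (t • 1 - Mc A B U Y Z s t - Md A B U Y Z s t)) i 0 = 0 := by
  simp only [mul_sub, sub_mul, mul_smul_comm, smul_mul_assoc, mul_one, one_mul]
  fin_cases i <;>
    simp [Ma, Mc, Md] <;> ring

lemma mrel3 (i : Fin 5) : (Z • Md A B U Y Z s t
    + (s • 1 - Ma A B U Y Z s t - Md A B U Y Z s t) * Mc A B U Y Z s t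
    - (A * U) • (1 : Matrix (Fin 5) (Fin 5) P)) i 0 = 0 := by
  simp only [mul_sub, sub_mul, mul_smul_comm, smul_mul_assoc, mul_one, one_mul]
  fin_cases i <;>
    simp [Ma, Mc, Md] <;> ring

lemma mrel4 (i : Fin 5) : (Ma A B U Y Z s t * Md A B U Y Z s t - Y • Mc A B U Y Z s t
    + (B * U) • (1 : Matrix (Fin 5) (Fin 5) P)) i 0 = 0 := by
  fin_cases i <;>
    simp [Ma, Mc, Md] <;> ring

lemma mrel5 (i : Fin 5) : (Ma A B U Y Z s t * (s • 1 - Ma A B U Y Z s t - Md A B U Y Z s t)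
    + (Y * Z) • (1 : Matrix (Fin 5) (Fin 5) P)
    - U • (t • 1 - Mc A B U Y Z s t - Md A B U Y Z s t)) i 0 = 0 := by
  simp only [mul_sub, sub_mul, mul_smul_comm, smul_mul_assoc, mul_one, one_mul]
  fin_cases i <;>
    simp [Ma, Mc, Md] <;> ring

end mats


lemma exists_comm.{u} {P : Type u} [CommRing P] {M : Type u} [Ring M] [Algebra P M] (a c d : M)
    (hac : a * c = c * a) (had : a * d = d * a) (hcd : c * d = d * c) :
    ∃ (T : Type u) (_ : CommRing T) (i : T →+* M) (p : P →+* T) (a' c' d' : T),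
      Function.Injective i ∧ i a' = a ∧ i c' = c ∧ i d' = d ∧ ∀ x, i (p x) = algebraMap P M x := by
  have h : ∀ x ∈ ({a, c, d} : Set M), ∀ y ∈ ({a, c, d} : Set M), x * y = y * x := by
    rintro x (rfl | rfl | rfl) y (rfl | rfl | rfl) <;> simp [*]
  let T := Algebra.adjoin P ({a, c, d} : Set M)
  refine ⟨T, Algebra.adjoinCommRingOfComm P h, T.val.toRingHom, algebraMap P T,
    ⟨a, Algebra.subset_adjoin (by simp)⟩, ⟨c, Algebra.subset_adjoin (by simp)⟩,
    ⟨d, Algebra.subset_adjoin (by simp)⟩, Subtype.val_injective, rfl, rfl, rfl, fun x => rfl⟩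

end R22

namespace R22

/-- the class of the `i`-th variable in `R̃`. -/
noncomputable def v (k : Type*) [Field k] (i : Fin 10) : RTilde22 k :=
  Ideal.Quotient.mk (idealR22 k) (X i)

section
variable (k : Type*) [Field k]

lemma rel1 : v k 7 * v k 0 + v k 9 * v k 1 - v k 0 * v k 4 - v k 2 * v k 5 = 0 := by
  have : Ideal.Quotient.mk (idealR22 k) (X 7 * X 0 + X 9 * X 1 - X 0 * X 4 - X 2 * X 5) = 0 :=
    Ideal.Quotient.eq_zero_iff_mem.2 (Ideal.subset_span (by simp))
  simpa only [v, map_add, map_sub, map_mul] using this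

lemma rel2 : v k 8 * v k 0 - v k 7 * v k 1 - v k 1 * v k 4 - v k 3 * v k 5 = 0 := by
  have : Ideal.Quotient.mk (idealR22 k) (X 8 * X 0 - X 7 * X 1 - X 1 * X 4 - X 3 * X 5) = 0 :=
    Ideal.Quotient.eq_zero_iff_mem.2 (Ideal.subset_span (by simp))
  simpa only [v, map_add, map_sub, map_mul] using this

lemma rel3 : v k 9 * v k 3 + v k 7 * v k 2 + v k 2 * v k 4 - v k 0 * v k 6 = 0 := by
  have : Ideal.Quotient.mk (idealR22 k) (X 9 * X 3 + X 7 * X 2 + X 2 * X 4 - X 0 * X 6) = 0 :=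
    Ideal.Quotient.eq_zero_iff_mem.2 (Ideal.subset_span (by simp))
  simpa only [v, map_add, map_sub, map_mul] using this

lemma rel4 : v k 7 * v k 3 - v k 8 * v k 2 - v k 3 * v k 4 + v k 1 * v k 6 = 0 := by
  have : Ideal.Quotient.mk (idealR22 k) (X 7 * X 3 - X 8 * X 2 - X 3 * X 4 + X 1 * X 6) = 0 :=
    Ideal.Quotient.eq_zero_iff_mem.2 (Ideal.subset_span (by simp))
  simpa only [v, map_add, map_sub, map_mul] using this

lemma rel5 : v k 7 ^ 2 + v k 8 * v k 9 - v k 4 ^ 2 - v k 5 * v k 6 = 0 := by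
  have : Ideal.Quotient.mk (idealR22 k) (X 7 ^ 2 + X 8 * X 9 - X 4 ^ 2 - X 5 * X 6) = 0 :=
    Ideal.Quotient.eq_zero_iff_mem.2 (Ideal.subset_span (by simp))
  simpa only [v, map_add, map_sub, map_mul, map_pow] using this

/-- The polynomial ring of parameters `A, B, U, Y, Z, X + X + D, T + C + D` mapping to `R̃`. -/
noncomputable def jhom : MvPolynomial (Fin 7) k →ₐ[k] RTilde22 k :=
  aeval ![v k 0, v k 1, v k 6, v k 8, v k 9, 2 * v k 7 + v k 3, v k 5 + v k 2 + v k 3]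

/-- The basis of `R̃` over the parameter ring. -/
noncomputable def E : Fin 5 → RTilde22 k :=
  ![1, v k 7 - v k 4, v k 2, v k 3, (v k 7 - v k 4) * v k 2]

lemma span_aux (h2 : (2 : k) ≠ 0) (x : RTilde22 k) :
    ∃ c : Fin 5 → MvPolynomial (Fin 7) k, x = ∑ i, jhom k (c i) * E k i := by
  have r1 := rel1 k
  have r2 := rel2 k
  have r3 := rel3 k
  have r4 := rel4 k
  have r5 := rel5 k
  have j0 : jhom k (X 0) = v k 0 := by simp [jhom]
  have j1 : jhom k (X 1) = v k 1 := by simp [jhom]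
  have j2 : jhom k (X 2) = v k 6 := by simp [jhom]
  have j3 : jhom k (X 3) = v k 8 := by simp [jhom]
  have j4 : jhom k (X 4) = v k 9 := by simp [jhom]
  have j5 : jhom k (X 5) = 2 * v k 7 + v k 3 := by simp [jhom]
  have j6 : jhom k (X 6) = v k 5 + v k 2 + v k 3 := by simp [jhom]
  let N : RTilde22 k → Prop := fun x => ∃ c : Fin 5 → MvPolynomial (Fin 7) k,
    x = ∑ i, jhom k (c i) * E k i
  have hadd : ∀ x y, N x → N y → N (x + y) := by
    rintro _ _ ⟨c, rfl⟩ ⟨d, rfl⟩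
    exact ⟨c + d, by simp [add_mul, Finset.sum_add_distrib]⟩
  have hsmul : ∀ p x, N x → N (jhom k p * x) := by
    rintro p _ ⟨c, rfl⟩
    exact ⟨fun i => p * c i, by simp [Finset.mul_sum, mul_assoc]⟩
  have hC : ∀ (r : k) x, N x → N (algebraMap k _ r * x) := by
    intro r x hx
    have := hsmul (C r) x hx
    rwa [← MvPolynomial.algebraMap_eq, AlgHom.commutes] at this
  have hneg : ∀ x, N x → N (-x) := by
    intro x hx
    have e : -x = jhom k (-1) * x := by
      rw [map_neg, map_one]
      ring
    rw [e]
    exact hsmul (-1) x hx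
  have hsub : ∀ x y, N x → N y → N (x - y) := by
    intro x y hx hy
    simpa [sub_eq_add_neg] using hadd x (-y) hx (hneg y hy)
  -- multiplication by `a = X - S`
  have ha : ∀ x, N x → N ((v k 7 - v k 4) * x) := by
    rintro _ ⟨c, rfl⟩
    refine ⟨(Ma (X 0) (X 1) (X 2) (X 3) (X 4) (X 5) (X 6)).mulVec c, ?_⟩
    simp only [Fin.sum_univ_five, Matrix.mulVec, dotProduct, Ma, E, map_add, map_mul, map_sub]
    simp [j0, j1, j2, j3, j4, j5, j6]
    generalize jhom k (c 0) = c0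
    generalize jhom k (c 1) = c1
    generalize jhom k (c 2) = c2
    generalize jhom k (c 3) = c3
    generalize jhom k (c 4) = c4
    linear_combination c1 * (-r4 - r5) + c3 * r4 + c4 * (v k 2 * (-r4 - r5) + (v k 6 - v k 8) * (r1 + r3) - v k 6 * r3)
  have hc : ∀ x, N x → N (v k 2 * x) := by
    rintro _ ⟨c, rfl⟩
    refine ⟨(Mc (X 0) (X 1) (X 2) (X 3) (X 4) (X 5) (X 6)).mulVec c, ?_⟩
    simp only [Fin.sum_univ_five, Matrix.mulVec, dotProduct, Mc, E, map_add, map_mul, map_sub]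
    simp [j0, j1, j2, j3, j4, j5, j6]
    generalize jhom k (c 0) = c0
    generalize jhom k (c 1) = c1
    generalize jhom k (c 2) = c2
    generalize jhom k (c 3) = c3
    generalize jhom k (c 4) = c4
    linear_combination c2 * (r1 + r3) - c3 * r3 + c4 * ((v k 7 - v k 4) * (r1 + r3) + v k 0 * (r4 + r5) - v k 9 * r4 + (v k 2 * (-r4 - r5) + (v k 6 - v k 8) * (r1 + r3) - v k 6 * r3))
  have hd : ∀ x, N x → N (v k 3 * x) := by
    rintro _ ⟨c, rfl⟩
    refine ⟨(Md (X 0) (X 1) (X 2) (X 3) (X 4) (X 5) (X 6)).mulVec c, ?_⟩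
    simp only [Fin.sum_univ_five, Matrix.mulVec, dotProduct, Md, E, map_add, map_mul, map_sub]
    simp [j0, j1, j2, j3, j4, j5, j6]
    generalize jhom k (c 0) = c0
    generalize jhom k (c 1) = c1
    generalize jhom k (c 2) = c2
    generalize jhom k (c 3) = c3
    generalize jhom k (c 4) = c4
    linear_combination c1 * r4 - c2 * r3 + c3 * (r2 + r3) + c4 * (v k 2 * r4 + v k 8 * (r1 + r3))
  have hX : ∀ x, N x → N (v k 7 * x) := by
    intro x hx
    have h := hC (1/2) _ (hsub _ _ (hsmul (X 5) x hx) (hd x hx))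
    convert h using 1
    have h3 : (algebraMap k (RTilde22 k) (1/2)) * 2 = 1 := by
      rw [← map_ofNat (algebraMap k (RTilde22 k)) 2, ← map_mul]
      simp [h2]
    rw [j5]
    linear_combination (- v k 7 * x) * h3
  have hvar : ∀ (i : Fin 10) x, N x → N (v k i * x) := by
    intro i x hx
    fin_cases i
    · have := hsmul (X 0) x hx; rwa [j0] at this
    · have := hsmul (X 1) x hx; rwa [j1] at this
    · exact hc x hx
    · exact hd x hx
    · have := hsub _ _ (hX x hx) (ha x hx)
      convert this using 1
      simp only [Fin.reduceFinMk]
      ring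
    · have := hsub _ _ (hsub _ _ (hsmul (X 6) x hx) (hc x hx)) (hd x hx)
      convert this using 1
      rw [j6]
      simp only [Fin.reduceFinMk]
      ring
    · have := hsmul (X 2) x hx; rwa [j2] at this
    · exact hX x hx
    · have := hsmul (X 3) x hx; rwa [j3] at this
    · have := hsmul (X 4) x hx; rwa [j4] at this
  have h1 : N 1 := ⟨![1, 0, 0, 0, 0], by simp [Fin.sum_univ_five, E]⟩
  change N x
  obtain ⟨f, rfl⟩ := Ideal.Quotient.mk_surjective x
  induction f using MvPolynomial.induction_on with
  | C r =>
    have := hC r 1 h1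
    rw [mul_one] at this
    exact this
  | add p q hp hq => rw [map_add]; exact hadd _ _ hp hq
  | mul_X p i hp => rw [map_mul, mul_comm]; exact hvar i _ hp

end
end R22

namespace R22

lemma exists_model.{u} {P : Type u} [CommRing P] (A B U Y Z s t : P) :
    ∃ (T : Type u) (_ : CommRing T) (p : P →+* T) (a m d : T) (φ : T →+ (Fin 5 → P)),
      (∀ x y, φ (p x * y) = x • φ y) ∧
      (∀ j l, φ ((![1, a, m, d, a * m] : Fin 5 → T) j) l = if l = j then 1 else 0) ∧
      p A * a + p Z * p B - m * (p t - m - d) = 0 ∧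
      p Y * p A - p B * (p s - a - d) - d * (p t - m - d) = 0 ∧
      p Z * d + (p s - a - d) * m - p A * p U = 0 ∧
      a * d - p Y * m + p B * p U = 0 ∧
      a * (p s - a - d) + p Y * p Z - p U * (p t - m - d) = 0 := by
  obtain ⟨T, _, i, p, a, m, d, hi, ha, hm, hd, hp⟩ := exists_comm
    (P := P) (M := Matrix (Fin 5) (Fin 5) P)
    (Ma A B U Y Z s t) (Mc A B U Y Z s t) (Md A B U Y Z s t)
    (comm_ac _ _ _ _ _ _ _) (comm_ad _ _ _ _ _ _ _) (comm_cd _ _ _ _ _ _ _)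
  have hp' : ∀ x, i (p x) = x • (1 : Matrix (Fin 5) (Fin 5) (P)) := by
    intro x
    rw [hp, Algebra.algebraMap_eq_smul_one]
  -- the basis elements in `T`
  let F : Fin 5 → T := ![1, a, m, d, a * m]
  have hF : ∀ j l, i (F j) l 0 = if l = j then 1 else 0 := by
    intro j l
    fin_cases j
    · fin_cases l <;> simp [F]
    · fin_cases l <;> simp [F, ha, Ma]
    · fin_cases l <;> simp [F, hm, Mc]
    · fin_cases l <;> simp [F, hd, Md]
    · fin_cases l <;> simp [F, ha, hm, Ma, Mc, Matrix.mul_apply, Fin.sum_univ_five]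
  have hT : ∀ x : T, (∀ r, i x r 0 = 0) → x = 0 := by
    intro x hx
    apply hi
    rw [map_zero]
    ext r j : 2
    have e1 : (i x * i (F j)) r 0 = i x r j := by
      rw [Matrix.mul_apply]
      simp [hF]
    have e2 : (i (F j) * i x) r 0 = 0 := by
      rw [Matrix.mul_apply]
      simp [hx]
    rw [← e1, ← map_mul, mul_comm, map_mul, e2]
    rfl
  have q1 : p A * a + p Z * p B - m * (p t - m - d) = 0 := by
    apply hT
    intro r
    have := mrel1 (P := P) A B U Y Z s t r
    simpa only [map_add, map_sub, map_mul, hp', ha, hm, hd, smul_mul_assoc, mul_smul_comm,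
      one_mul, mul_one, smul_smul, mul_comm B Z] using this
  have q2 : p Y * p A - p B * (p s - a - d) - d * (p t - m - d) = 0 := by
    apply hT
    intro r
    have := mrel2 (P := P) A B U Y Z s t r
    simpa only [map_add, map_sub, map_mul, hp', ha, hm, hd, smul_mul_assoc, mul_smul_comm,
      one_mul, mul_one, smul_smul, mul_comm A Y] using this
  have q3 : p Z * d + (p s - a - d) * m - p A * p U = 0 := by
    apply hT
    intro r
    have := mrel3 (P := P) A B U Y Z s t r
    simpa only [map_add, map_sub, map_mul, hp', ha, hm, hd, smul_mul_assoc, mul_smul_comm,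
      one_mul, mul_one, smul_smul, mul_comm U A] using this
  have q4 : a * d - p Y * m + p B * p U = 0 := by
    apply hT
    intro r
    have := mrel4 (P := P) A B U Y Z s t r
    simpa only [map_add, map_sub, map_mul, hp', ha, hm, hd, smul_mul_assoc, mul_smul_comm,
      one_mul, mul_one, smul_smul, mul_comm U B] using this
  have q5 : a * (p s - a - d) + p Y * p Z - p U * (p t - m - d) = 0 := by
    apply hT
    intro r
    have := mrel5 (P := P) A B U Y Z s t r
    simpa only [map_add, map_sub, map_mul, hp', ha, hm, hd, smul_mul_assoc, mul_smul_comm,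
      one_mul, mul_one, smul_smul, mul_comm Z Y] using this
  let φ : T →+ (Fin 5 → P) :=
    { toFun := fun x r => i x r 0
      map_zero' := by ext; simp
      map_add' := fun x y => by ext; simp }
  refine ⟨T, inferInstance, p, a, m, d, φ, ?_, hF, q1, q2, q3, q4, q5⟩
  intro x y
  ext r
  change i (p x * y) r 0 = x * i y r 0
  rw [map_mul, hp', smul_mul_assoc, one_mul]
  rfl

lemma indep_aux (k : Type*) [Field k] (h2 : (2 : k) ≠ 0) (c : Fin 5 → MvPolynomial (Fin 7) k)
    (hc : ∑ i, jhom k (c i) * E k i = 0) : c = 0 := by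
  obtain ⟨T, _, p, a, m, d, φ, hφ, hF, q1, q2, q3, q4, q5⟩ := exists_model
    (P := MvPolynomial (Fin 7) k) (X 0) (X 1) (X 2) (X 3) (X 4) (X 5) (X 6)
  -- the homomorphism
  let κ : k →+* T := p.comp C
  let w : T := κ (1/2)
  have hw : w * 2 = 1 := by
    change κ (1/2) * 2 = 1
    rw [← map_ofNat κ 2, ← map_mul]
    simp [h2]
  let val : Fin 10 → T := ![p (X 0), p (X 1), m, d, w * (p (X 5) - d) - a, p (X 6) - m - d,
    p (X 2), w * (p (X 5) - d), p (X 3), p (X 4)]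
  let θ₀ : MvPolynomial (Fin 10) k →+* T := eval₂Hom κ val
  have hθ₀ : ∀ x ∈ idealR22 k, θ₀ x = 0 := by
    have : idealR22 k ≤ RingHom.ker θ₀ := by
      rw [idealR22, Ideal.span_le]
      rintro x (rfl | rfl | rfl | rfl | rfl) <;>
        simp only [SetLike.mem_coe, RingHom.mem_ker, map_add, map_sub, map_mul, map_pow, θ₀,
          coe_eval₂Hom, eval₂_X] <;> simp [val]
      · linear_combination q1
      · linear_combination q2 + p (X 1) * (d - p (X 5)) * hw
      · linear_combination q3 - m * (d - p (X 5)) * hw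
      · linear_combination q4
      · linear_combination q5 - a * (d - p (X 5)) * hw
    intro x hx
    exact this hx
  let θ : RTilde22 k →+* T := Ideal.Quotient.lift _ θ₀ hθ₀
  have hθv : ∀ l, θ (v k l) = val l := by
    intro l
    simp [θ, v, θ₀]
  have hθj : θ.comp (jhom k).toRingHom = p := by
    apply MvPolynomial.ringHom_ext
    · intro r
      have : (jhom k).toRingHom (C r) = Ideal.Quotient.mk _ (C r) := by
        change jhom k (C r) = _
        rw [← MvPolynomial.algebraMap_eq, AlgHom.commutes]
        rfl
      rw [RingHom.comp_apply, this]
      simp [θ, θ₀, κ]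
    · intro l
      fin_cases l <;> simp [jhom, hθv, val]
      · have e2 : θ 2 = 2 := map_ofNat θ 2
        linear_combination (p (X 5) - d) * hw + w * (p (X 5) - d) * e2
      · ring
  have hθE : ∀ l, θ (E k l) = (![1, a, m, d, a * m] : Fin 5 → T) l := by
    intro l
    fin_cases l <;> simp [E, hθv, val]
  have h0 : ∑ l, p (c l) * (![1, a, m, d, a * m] : Fin 5 → T) l = 0 := by
    have := congrArg θ hc
    rw [map_zero, map_sum] at this
    rw [← this]
    refine Finset.sum_congr rfl fun l _ => ?_
    rw [map_mul, hθE, ← hθj]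
    rfl
  have h1 := congrArg φ h0
  rw [map_sum, map_zero] at h1
  simp only [hφ] at h1
  ext1 r
  have h3 := congrFun h1 r
  simpa only [Finset.sum_apply, Pi.smul_apply, hF, smul_eq_mul, mul_ite, mul_one, mul_zero,
    Finset.sum_ite_eq, Finset.mem_univ, if_true, Pi.zero_apply] using h3

end R22

namespace R22

section
variable (k : Type*) [Field k]

lemma j0 : jhom k (X 0) = v k 0 := by simp [jhom]
lemma j1 : jhom k (X 1) = v k 1 := by simp [jhom]
lemma j4 : jhom k (X 4) = v k 9 := by simp [jhom]

variable {k}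

lemma nzd_A (h2 : (2 : k) ≠ 0) (x : RTilde22 k) (hx : v k 0 * x = 0) : x = 0 := by
  obtain ⟨c, rfl⟩ := span_aux k h2 x
  have h : (fun i => X 0 * c i) = (0 : Fin 5 → MvPolynomial (Fin 7) k) := by
    apply indep_aux k h2
    rw [← hx, Finset.mul_sum]
    refine Finset.sum_congr rfl fun i _ => ?_
    rw [map_mul, j0, mul_assoc]
  have h' : ∀ i, c i = 0 := fun i => by
    have := congrFun h i
    simpa using this
  simp [h']

lemma div_aux (h2 : (2 : k) ≠ 0) (n : Fin 7) (hn : n ≠ 0) (x y : RTilde22 k)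
    (hx : jhom k (X n) * x = v k 0 * y) : ∃ z, x = v k 0 * z := by
  obtain ⟨c, rfl⟩ := span_aux k h2 x
  obtain ⟨d, rfl⟩ := span_aux k h2 y
  have h : (fun i => X n * c i - X 0 * d i) = (0 : Fin 5 → MvPolynomial (Fin 7) k) := by
    apply indep_aux k h2
    rw [← sub_eq_zero, Finset.mul_sum, Finset.mul_sum, ← Finset.sum_sub_distrib] at hx
    rw [← hx]
    refine Finset.sum_congr rfl fun i _ => ?_
    rw [map_sub, map_mul, map_mul, j0]
    ring
  have h' : ∀ i, ∃ e, c i = X 0 * e := fun i => by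
    have h3 : X n * c i = X 0 * d i := sub_eq_zero.1 (congrFun h i)
    have hp : Prime (X 0 : MvPolynomial (Fin 7) k) := MvPolynomial.X_prime
    rcases hp.dvd_or_dvd ⟨_, h3⟩ with h4 | h4
    · rw [MvPolynomial.X_dvd_X] at h4
      exact absurd h4.symm hn
    · exact h4
  choose e he using h'
  refine ⟨∑ i, jhom k (e i) * E k i, ?_⟩
  rw [Finset.mul_sum]
  refine Finset.sum_congr rfl fun i _ => ?_
  rw [he, map_mul, j0, mul_assoc]

lemma nzd_quot (h2 : (2 : k) ≠ 0) (f g : RTilde22 k)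
    (h : v k 0 * f = (v k 0 * v k 3 - v k 1 * v k 2) * g) :
    ∃ e, f = (v k 0 * v k 3 - v k 1 * v k 2) * e := by
  have r1 := rel1 k
  have e1 : jhom k (X 1) * (v k 1 * (v k 9 * g)) =
      v k 0 * ((v k 3 * g - f) * v k 5 - (v k 7 - v k 4) * v k 1 * g) := by
    rw [j1]
    linear_combination v k 5 * h + v k 1 * g * r1
  obtain ⟨z, hz⟩ := div_aux h2 1 (by decide) _ _ e1
  rw [← j1] at hz
  obtain ⟨z', hz'⟩ := div_aux h2 1 (by decide) _ _ hz
  rw [← j4] at hz'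
  obtain ⟨w, rfl⟩ := div_aux h2 4 (by decide) _ _ hz'
  refine ⟨w, ?_⟩
  rw [← sub_eq_zero]
  apply nzd_A h2
  linear_combination h

/-- A parametrization of the locus where `A` is invertible. -/
def par {Q : Type*} [CommRing Q] (A b c T X Z d : Q) : Fin 10 → Q :=
  ![A, A * b, A * c, A * d, X + Z * b - c * T, T, Z * d + c * (X + (X + Z * b - c * T)), X,
    (X + (X + Z * b - c * T)) * b + d * T, Z]

/-- The homomorphism from `R̃` given by the parametrization. -/
noncomputable def parHom {Q : Type*} [CommRing Q] (κ : k →+* Q) (A b c T X' Z d : Q) :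
    RTilde22 k →+* Q :=
  Ideal.Quotient.lift _ (eval₂Hom κ (par A b c T X' Z d)) (by
    have : idealR22 k ≤ RingHom.ker (eval₂Hom κ (par A b c T X' Z d)) := by
      rw [idealR22, Ideal.span_le]
      rintro x (rfl | rfl | rfl | rfl | rfl) <;>
        simp only [SetLike.mem_coe, RingHom.mem_ker, map_add, map_sub, map_mul, map_pow,
          coe_eval₂Hom, eval₂_X] <;> simp [par] <;> ring
    intro x hx
    exact this hx)

lemma parHom_v {Q : Type*} [CommRing Q] (κ : k →+* Q) (A b c T X' Z d : Q) (i : Fin 10) :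
    parHom κ A b c T X' Z d (v k i) = par A b c T X' Z d i := by
  change eval₂Hom κ (par A b c T X' Z d) (X i) = _
  simp

lemma parHom_C {Q : Type*} [CommRing Q] (κ : k →+* Q) (A b c T X' Z d : Q) (r : k) :
    parHom κ A b c T X' Z d (Ideal.Quotient.mk _ (C r)) = κ r := by
  change eval₂Hom κ (par A b c T X' Z d) (C r) = _
  simp

lemma emb {Q R L : Type*} [CommRing Q] [CommRing R] [CommRing L] [Algebra R L]
    (ρ : RTilde22 k →+* R) (hρ : ∀ x, ρ (v k 0) * x = 0 → x = 0)
    [IsLocalization.Away (ρ (v k 0)) L] (κ : k →+* Q) (A b c T X' Z d : Q)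
    (ψ : Q →+* L) (hκ : ∀ r, ψ (κ r) = algebraMap R L (ρ (Ideal.Quotient.mk _ (C r))))
    (hA : ψ A = algebraMap R L (ρ (v k 0)))
    (hb : algebraMap R L (ρ (v k 0)) * ψ b = algebraMap R L (ρ (v k 1)))
    (hc : algebraMap R L (ρ (v k 0)) * ψ c = algebraMap R L (ρ (v k 2)))
    (hd : algebraMap R L (ρ (v k 0)) * ψ d = algebraMap R L (ρ (v k 3)))
    (hT : ψ T = algebraMap R L (ρ (v k 5)))
    (hX : ψ X' = algebraMap R L (ρ (v k 7)))
    (hZ : ψ Z = algebraMap R L (ρ (v k 9)))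
    (x : RTilde22 k) (hx : parHom κ A b c T X' Z d x = 0) : ρ x = 0 := by
  have hinj : Function.Injective (algebraMap R L) := by
    apply IsLocalization.injective (M := Submonoid.powers (ρ (v k 0)))
    rw [Submonoid.powers_le, mem_nonZeroDivisors_iff_right]
    intro y hy
    exact hρ y (by rw [mul_comm]; exact hy)
  have hu : IsUnit (algebraMap R L (ρ (v k 0))) := IsLocalization.Away.algebraMap_isUnit _
  obtain ⟨w, hw⟩ := hu.exists_left_inv
  have key : ψ.comp (parHom κ A b c T X' Z d) = (algebraMap R L).comp ρ := by
    apply Ideal.Quotient.ringHom_ext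
    apply MvPolynomial.ringHom_ext
    · intro r
      simp only [RingHom.comp_apply, parHom_C, hκ]
    · intro i
      change ψ (parHom κ A b c T X' Z d (v k i)) = algebraMap R L (ρ (v k i))
      rw [parHom_v]
      have r1 := congrArg (fun y => algebraMap R L (ρ y)) (rel1 k)
      have r2 := congrArg (fun y => algebraMap R L (ρ y)) (rel2 k)
      have r3 := congrArg (fun y => algebraMap R L (ρ y)) (rel3 k)
      simp only [map_add, map_sub, map_mul, map_zero] at r1 r2 r3
      have hS : ψ (X' + Z * b - c * T) = algebraMap R L (ρ (v k 4)) := by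
        simp only [map_add, map_sub, map_mul, hX, hZ, hT]
        rw [← hb, ← hc] at r1
        apply hu.mul_left_cancel
        linear_combination r1
      have e4 : par A b c T X' Z d 4 = X' + Z * b - c * T := rfl
      have e6 : par A b c T X' Z d 6 = Z * d + c * (X' + (X' + Z * b - c * T)) := rfl
      have e8 : par A b c T X' Z d 8 = (X' + (X' + Z * b - c * T)) * b + d * T := rfl
      fin_cases i
      · exact hA
      · simpa [par, hA] using hb
      · simpa [par, hA] using hc
      · simpa [par, hA] using hd
      · exact hS
      · exact hT
      · change ψ (par A b c T X' Z d 6) = _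
        rw [e6, map_add, map_mul, map_mul, map_add ψ X', hS, hX, hZ]
        rw [← hd, ← hc] at r3
        apply hu.mul_left_cancel
        simp only [Fin.reduceFinMk]
        linear_combination r3
      · exact hX
      · change ψ (par A b c T X' Z d 8) = _
        rw [e8, map_add, map_mul, map_mul, map_add ψ X', hS, hX, hT]
        rw [← hd, ← hb] at r2
        apply hu.mul_left_cancel
        simp only [Fin.reduceFinMk]
        linear_combination -r2
      · exact hZ
  apply hinj
  rw [map_zero]
  have := congrArg (fun F : RTilde22 k →+* L => F x) key
  simp only [RingHom.comp_apply, hx, map_zero] at this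
  exact this.symm

end
end R22

namespace R22

section
variable {k : Type*} [Field k]

lemma char_two (hchar : ringChar k = 0 ∨ 5 ≤ ringChar k) : (2 : k) ≠ 0 := by
  intro h
  have h1 : ringChar k ∣ 2 := ringChar.dvd (by exact_mod_cast h)
  have h2 : ringChar k ≤ 2 := Nat.le_of_dvd (by norm_num) h1
  rcases hchar with h3 | h3
  · rw [h3] at h1
    omega
  · omega

lemma dim_poly (n : ℕ) : ringKrullDim (MvPolynomial (Fin n) k) = n := by
  rw [MvPolynomial.ringKrullDim_of_isNoetherianRing, ringKrullDim_eq_zero_of_field]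
  simp

lemma dim_integral {P S : Type*} [CommRing P] [CommRing S] (f : P →+* S) (hf : f.IsIntegral) :
    ringKrullDim S ≤ ringKrullDim P := by
  letI := f.toAlgebra
  haveI : Algebra.IsIntegral P S := ⟨hf⟩
  refine Order.krullDim_le_of_strictMono (PrimeSpectrum.comap (algebraMap P S)) ?_
  intro I J h
  exact Ideal.IsIntegral.comap_lt_comap (R := P) h

lemma dim_le_seven (h2 : (2 : k) ≠ 0) : ringKrullDim (RTilde22 k) ≤ 7 := by
  have : (jhom k : MvPolynomial (Fin 7) k →+* RTilde22 k).IsIntegral := by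
    apply RingHom.Finite.to_isIntegral
    letI := (jhom k : MvPolynomial (Fin 7) k →+* RTilde22 k).toAlgebra
    change Module.Finite (MvPolynomial (Fin 7) k) (RTilde22 k)
    refine Module.Finite.of_surjective (Fintype.linearCombination _ (E k)) ?_
    intro x
    obtain ⟨c, rfl⟩ := span_aux k h2 x
    exact ⟨c, by simp [Fintype.linearCombination_apply, Algebra.smul_def, RingHom.algebraMap_toAlgebra]⟩
  refine (dim_integral _ this).trans ?_
  rw [dim_poly]
  rfl

/-- the class of `AD - BC`. -/
noncomputable def q (k : Type*) [Field k] : RTilde22 k := v k 0 * v k 3 - v k 1 * v k 2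

/-- the scalars. -/
noncomputable def sc (k : Type*) [Field k] : k →+* RTilde22 k :=
  (Ideal.Quotient.mk (idealR22 k)).comp C

lemma parHom_q {Q : Type*} [CommRing Q] (κ : k →+* Q) (A b c T X' Z d : Q) :
    parHom κ A b c T X' Z d (q k) = A ^ 2 * (d - b * c) := by
  rw [q, map_sub, map_mul, map_mul, parHom_v, parHom_v, parHom_v, parHom_v]
  change A * (A * d) - A * b * (A * c) = _
  ring

lemma par7_inj (h2 : (2 : k) ≠ 0) : Function.Injective
    (parHom (C : k →+* MvPolynomial (Fin 7) k) (X 0) (X 1) (X 2) (X 3) (X 4) (X 5) (X 6)) := by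
  rw [injective_iff_map_eq_zero]
  intro x hx
  let L := Localization.Away (RingHom.id (RTilde22 k) (v k 0))
  have hu : IsUnit (algebraMap (RTilde22 k) L (RingHom.id (RTilde22 k) (v k 0))) :=
    IsLocalization.Away.algebraMap_isUnit _
  obtain ⟨w, hw⟩ := hu.exists_right_inv
  let u : Fin 10 → L := fun i => algebraMap (RTilde22 k) L (v k i)
  replace hw : u 0 * w = 1 := hw
  refine emb (L := L) (RingHom.id _) (nzd_A h2) C _ _ _ _ _ _ _
    (eval₂Hom ((algebraMap (RTilde22 k) L).comp (sc k))
      ![u 0, u 1 * w, u 2 * w, u 5, u 7, u 9, u 3 * w]) ?_ ?_ ?_ ?_ ?_ ?_ ?_ ?_ x hx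
  · intro r
    simp [sc]
  · simp [u]
  · simp only [coe_eval₂Hom, eval₂_X]
    change u 0 * (u 1 * w) = u 1
    linear_combination u 1 * hw
  · simp only [coe_eval₂Hom, eval₂_X]
    change u 0 * (u 2 * w) = u 2
    linear_combination u 2 * hw
  · simp only [coe_eval₂Hom, eval₂_X]
    change u 0 * (u 3 * w) = u 3
    linear_combination u 3 * hw
  · simp [u]
  · simp [u]
  · simp [u]

lemma isDomain_R (h2 : (2 : k) ≠ 0) : IsDomain (RTilde22 k) :=
  (par7_inj h2).isDomain _

lemma q_ne (h2 : (2 : k) ≠ 0) : q k ≠ 0 := by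
  intro h
  have h1 := congrArg (eval ![1, 0, 0, 0, 0, 0, (1 : k)]) (parHom_q (C : k →+* MvPolynomial (Fin 7) k)
    (X 0) (X 1) (X 2) (X 3) (X 4) (X 5) (X 6))
  rw [h, map_zero] at h1
  simp at h1

/-- The quotient ring. -/
def Rq (k : Type*) [Field k] : Type _ := RTilde22 k ⧸ Ideal.span {q k}

noncomputable instance (k : Type*) [Field k] : CommRing (Rq k) :=
  inferInstanceAs (CommRing (RTilde22 k ⧸ Ideal.span {q k}))

/-- the quotient map. -/
noncomputable def pr (k : Type*) [Field k] : RTilde22 k →+* Rq k := Ideal.Quotient.mk _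

lemma pr_q : pr k (q k) = 0 :=
  Ideal.Quotient.eq_zero_iff_mem.2 (Ideal.mem_span_singleton_self _)

lemma nzd_pr (h2 : (2 : k) ≠ 0) (x : Rq k) (hx : pr k (v k 0) * x = 0) : x = 0 := by
  obtain ⟨f, rfl⟩ := Ideal.Quotient.mk_surjective x
  have h1 : pr k (v k 0 * f) = 0 := by
    rw [map_mul]
    exact hx
  obtain ⟨g, hg⟩ := Ideal.mem_span_singleton.1 (Ideal.Quotient.eq_zero_iff_mem.1 h1)
  obtain ⟨e, he⟩ := nzd_quot h2 f g hg
  exact Ideal.Quotient.eq_zero_iff_mem.2 (Ideal.mem_span_singleton.2 ⟨e, he⟩)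

lemma par6_ker (h2 : (2 : k) ≠ 0) (x : RTilde22 k)
    (hx : parHom (C : k →+* MvPolynomial (Fin 6) k) (X 0) (X 1) (X 2) (X 3) (X 4) (X 5)
      (X 1 * X 2) x = 0) : pr k x = 0 := by
  let a0 : Rq k := pr k (v k 0)
  let L := Localization.Away a0
  have hu : IsUnit (algebraMap (Rq k) L (pr k (v k 0))) :=
    IsLocalization.Away.algebraMap_isUnit _
  obtain ⟨w, hw⟩ := hu.exists_right_inv
  let u : Fin 10 → L := fun i => algebraMap (Rq k) L (pr k (v k i))
  replace hw : u 0 * w = 1 := hw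
  have hq : u 0 * u 3 = u 1 * u 2 := by
    have h1 := congrArg (algebraMap (Rq k) L) (pr_q (k := k))
    rw [q] at h1
    simp only [map_sub, map_mul, map_zero] at h1
    exact sub_eq_zero.1 h1
  refine emb (L := L) (pr k) (nzd_pr h2) C _ _ _ _ _ _ _
    (eval₂Hom ((algebraMap (Rq k) L).comp ((pr k).comp (sc k)))
      ![u 0, u 1 * w, u 2 * w, u 5, u 7, u 9]) ?_ ?_ ?_ ?_ ?_ ?_ ?_ ?_ x hx
  · intro r
    simp [sc]
  · simp [u]
  · simp only [coe_eval₂Hom, eval₂_X]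
    change u 0 * (u 1 * w) = u 1
    linear_combination u 1 * hw
  · simp only [coe_eval₂Hom, eval₂_X]
    change u 0 * (u 2 * w) = u 2
    linear_combination u 2 * hw
  · simp only [map_mul, coe_eval₂Hom, eval₂_X]
    change u 0 * ((u 1 * w) * (u 2 * w)) = u 3
    linear_combination (u 1 * u 2 * w) * hw - w * hq + u 3 * hw
  · simp [u]
  · simp [u]
  · simp [u]

/-- Descending a parametrization with `d = b c`. -/
noncomputable def qHom {Q : Type*} [CommRing Q] (κ : k →+* Q) (A b c T X' Z : Q) : Rq k →+* Q :=
  Ideal.Quotient.lift _ (parHom κ A b c T X' Z (b * c)) (by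
    intro x hx
    obtain ⟨y, rfl⟩ := Ideal.mem_span_singleton.1 hx
    rw [map_mul, parHom_q]
    ring)

lemma qHom_pr {Q : Type*} [CommRing Q] (κ : k →+* Q) (A b c T X' Z : Q) (x : RTilde22 k) :
    qHom κ A b c T X' Z (pr k x) = parHom κ A b c T X' Z (b * c) x := rfl

lemma q6_inj (h2 : (2 : k) ≠ 0) : Function.Injective
    (qHom (C : k →+* MvPolynomial (Fin 6) k) (X 0) (X 1) (X 2) (X 3) (X 4) (X 5)) := by
  rw [injective_iff_map_eq_zero]
  intro x hx
  obtain ⟨f, rfl⟩ := Ideal.Quotient.mk_surjective x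
  exact par6_ker h2 f hx

lemma isDomain_Rq (h2 : (2 : k) ≠ 0) : IsDomain (Rq k) := (q6_inj h2).isDomain _

lemma dim_le_six (h2 : (2 : k) ≠ 0) : ringKrullDim (Rq k) ≤ 6 := by
  haveI := isDomain_R h2
  have h1 := ringKrullDim_quotient_succ_le_of_nonZeroDivisor
    (mem_nonZeroDivisors_of_ne_zero (q_ne h2))
  have h3 : ringKrullDim (Rq k) + 1 ≤ 6 + 1 := (h1.trans (dim_le_seven h2)).trans (by norm_num)
  exact (ENat.WithBot.add_le_add_natCast_right_iff (c := 1)).1 (by exact_mod_cast h3)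

lemma six_le_dim (h2 : (2 : k) ≠ 0) : 6 ≤ ringKrullDim (Rq k) := by
  haveI := isDomain_Rq h2
  let φ : Rq k →+* MvPolynomial (Fin 6) k := qHom (C : k →+* MvPolynomial (Fin 6) k) (X 0) (X 1) 0 (X 3) (X 4) (X 5)
  let θ : MvPolynomial (Fin 6) k →+* MvPolynomial (Fin 4) k :=
    eval₂Hom C ![X 0, 0, 0, X 1, X 2, X 3]
  let χ : φ.range →+* MvPolynomial (Fin 4) k := θ.comp (Subring.subtype φ.range)
  have hφ : ∀ i, φ (pr k (v k i)) = par (X 0) (X 1) 0 (X 3) (X 4) (X 5) (X 1 * 0) i := fun i => by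
    rw [qHom_pr, parHom_v]
  have c1 : ringKrullDim φ.range + 1 ≤ ringKrullDim (Rq k) := by
    refine ringKrullDim_succ_le_of_surjective φ.rangeRestrict φ.rangeRestrict_surjective
      (r := pr k (v k 2)) (mem_nonZeroDivisors_of_ne_zero ?_) ?_
    · intro h
      have h1 := qHom_pr (C : k →+* MvPolynomial (Fin 6) k) (X 0) (X 1) (X 2) (X 3) (X 4) (X 5)
        (v k 2)
      rw [h, map_zero, parHom_v] at h1
      have h3 : (X 0 * X 2 : MvPolynomial (Fin 6) k) = 0 := h1.symm
      exact mul_ne_zero (MvPolynomial.X_ne_zero _) (MvPolynomial.X_ne_zero _) h3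
    · apply Subtype.ext
      change φ (pr k (v k 2)) = 0
      rw [hφ]
      change X 0 * 0 = _
      rw [mul_zero]
  have hs : Function.Surjective χ := by
    have key : ∀ p : MvPolynomial (Fin 4) k, ∃ x : Rq k, θ (φ x) = p := by
      intro p
      induction p using MvPolynomial.induction_on with
      | C a =>
        refine ⟨pr k (sc k a), ?_⟩
        have h1 : φ (pr k (sc k a)) = C a := by
          rw [qHom_pr]
          exact parHom_C _ _ _ _ _ _ _ _ _
        rw [h1]
        simp [θ]
      | add p q hp hq =>
        obtain ⟨x, rfl⟩ := hp
        obtain ⟨y, rfl⟩ := hq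
        exact ⟨x + y, by simp⟩
      | mul_X p i hp =>
        obtain ⟨x, rfl⟩ := hp
        have h1 : ∃ y : Rq k, θ (φ y) = X i := by
          refine ⟨pr k (v k (![0, 5, 7, 9] i)), ?_⟩
          rw [hφ]
          fin_cases i <;> simp [par, θ]
        obtain ⟨y, hy⟩ := h1
        exact ⟨x * y, by rw [map_mul, map_mul, hy]⟩
    intro p
    obtain ⟨x, hx⟩ := key p
    exact ⟨⟨φ x, x, rfl⟩, hx⟩
  have c2 : ringKrullDim (MvPolynomial (Fin 4) k) + 1 ≤ ringKrullDim φ.range := by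
    refine ringKrullDim_succ_le_of_surjective χ hs
      (r := φ.rangeRestrict (pr k (v k 1))) (mem_nonZeroDivisors_of_ne_zero ?_) ?_
    · intro h
      have h1 : φ (pr k (v k 1)) = 0 := congrArg Subtype.val h
      rw [hφ] at h1
      have h3 : (X 0 * X 1 : MvPolynomial (Fin 6) k) = 0 := h1
      exact mul_ne_zero (MvPolynomial.X_ne_zero _) (MvPolynomial.X_ne_zero _) h3
    · change θ (φ (pr k (v k 1))) = 0
      rw [hφ]
      simp [par, θ]
  rw [dim_poly] at c2
  calc (6 : WithBot ℕ∞) = ((4 : ℕ) : WithBot ℕ∞) + 1 + 1 := by norm_num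
    _ ≤ ringKrullDim φ.range + 1 := by gcongr
    _ ≤ _ := c1

end
end R22

/-- For a field `k` of characteristic `0` or at least `5`, the quotient
`R̃^{2,2}_k/(AD−BC)` is an integral domain of Krull dimension `6`. -/
theorem rTilde22_quotient_ADsubBC_domain (k : Type*) [Field k]
    (hchar : ringChar k = 0 ∨ 5 ≤ ringChar k) :
    IsDomain (RTilde22 k ⧸ Ideal.span
      {Ideal.Quotient.mk (idealR22 k) (X 0 * X 3 - X 1 * X 2)}) ∧
    ringKrullDim (RTilde22 k ⧸ Ideal.span
      {Ideal.Quotient.mk (idealR22 k) (X 0 * X 3 - X 1 * X 2)}) = 6 := by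
  have h2 := R22.char_two hchar
  exact ⟨R22.isDomain_Rq h2, le_antisymm (R22.dim_le_six h2) (R22.six_le_dim h2)⟩
end
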